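/- Let T be an ABC-tile having exactly 14 neighbors and let α be a neighbor of T. Then the boundary of the set T ∩ (T + α), taken in the subspace topology of the topological boundary ∂T of T, equals L_α = ⋃_{β ∈ ℤ³, β ∉ {0, α}} (T ∩ (T + α) ∩ (T + β)); in particular, this boundary is a simple closed curve. -/

import Mathlib

open MeasureTheory

noncomputable def Mmat (A B C : ℤ) : Matrix (Fin 3) (Fin 3) ℝ :=
  !![0, 0, -(C : ℝ); 1, 0, -(B : ℝ); 0, 1, -(A : ℝ)]

def Ddig (C : ℤ) : Set (Fin 3 → ℝ) :=
  {d | ∃ i : ℤ, 0 ≤ i ∧ i < C ∧ d = ![(i : ℝ), 0, 0]}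

def toR (α : Fin 3 → ℤ) : Fin 3 → ℝ := fun i => (α i : ℝ)

def tileTranslate (v : Fin 3 → ℝ) (T : Set (Fin 3 → ℝ)) : Set (Fin 3 → ℝ) :=
  (fun x => x + v) '' T

def IsABCTile (A B C : ℤ) (T : Set (Fin 3 → ℝ)) : Prop :=
  1 ≤ A ∧ A ≤ B ∧ B < C ∧
  T.Nonempty ∧ IsCompact T ∧ 0 < volume T ∧
  (Mmat A B C).mulVec '' T = ⋃ d ∈ Ddig C, tileTranslate d T

def Neighbors (T : Set (Fin 3 → ℝ)) : Set (Fin 3 → ℤ) :=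
  {α | α ≠ 0 ∧ (T ∩ tileTranslate (toR α) T).Nonempty}

noncomputable def pR (A B C : ℤ) (u : ℕ → ℝ) (k : ℕ) : ℝ :=
  u (k+3) + A * u (k+2) + B * u (k+1) + C * u k

noncomputable def vec (A B : ℤ) (a b c : ℝ) : Fin 3 → ℝ := ![c + A*b + B*a, b + A*a, a]

theorem mulVec_vec (A B C : ℤ) (a b c : ℝ) :
    (Mmat A B C).mulVec (vec A B a b c) = vec A B b c (-(A*c+B*b+C*a)) := by
  ext i
  fin_cases i <;> simp [Mmat, vec, Matrix.mulVec, dotProduct, Fin.sum_univ_three] <;> ring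

theorem vec_eq (A B : ℤ) (x : Fin 3 → ℝ) :
    x = vec A B (x 2) (x 1 - A * x 2) (x 0 - B * x 2 - A * (x 1 - A * x 2)) := by
  ext i
  fin_cases i <;> simp [vec]

theorem vec_inj (A B : ℤ) {a b c a' b' c' : ℝ} (h : vec A B a b c = vec A B a' b' c') :
    a = a' ∧ b = b' ∧ c = c' := by
  have h0 := congrFun h 0
  have h1 := congrFun h 1
  have h2 := congrFun h 2
  simp [vec] at h0 h1 h2
  subst h2
  have : b = b' := by linarith
  subst this
  exact ⟨rfl, rfl, by linarith⟩

theorem vec_add (A B : ℤ) (a b c a' b' c' : ℝ) :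
    vec A B a b c + vec A B a' b' c' = vec A B (a+a') (b+b') (c+c') := by
  ext i; fin_cases i <;> simp [vec] <;> ring

theorem vec_add_d (A B : ℤ) (a b c d : ℝ) :
    vec A B a b c + ![d,0,0] = vec A B a b (c+d) := by
  ext i; fin_cases i <;> simp [vec] ; ring

/-- forward step -/
theorem T_fwd {A B C : ℤ} {T : Set (Fin 3 → ℝ)} (hT : IsABCTile A B C T) {a b c : ℝ}
    (h : vec A B a b c ∈ T) :
    ∃ d : ℤ, 0 ≤ d ∧ d < C ∧ vec A B b c (-d-(A*c+B*b+C*a)) ∈ T := by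
  have h1 : (Mmat A B C).mulVec (vec A B a b c) ∈ ⋃ d ∈ Ddig C, tileTranslate d T := by
    rw [← hT.2.2.2.2.2.2]; exact ⟨_, h, rfl⟩
  simp only [Set.mem_iUnion] at h1
  obtain ⟨d, ⟨i, hi0, hi1, rfl⟩, y, hy, hyx⟩ := h1
  refine ⟨i, hi0, hi1, ?_⟩
  rw [mulVec_vec] at hyx
  have : y = vec A B b c (-i-(A*c+B*b+C*a)) := by
    have h2 : y + ![(i:ℝ),0,0] = vec A B b c (-i-(A*c+B*b+C*a)) + ![(i:ℝ),0,0] := by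
      rw [vec_add_d]; simp only at hyx; rw [hyx]; congr 1; ring
    exact add_right_cancel h2
  rwa [← this]

theorem T_bwd {A B C : ℤ} {T : Set (Fin 3 → ℝ)} (hT : IsABCTile A B C T) {b c e : ℝ}
    (h : vec A B b c e ∈ T) (d : ℤ) (h0 : 0 ≤ d) (h1 : d < C) :
    ∃ a : ℝ, vec A B a b c ∈ T ∧ e + A * c + B * b + C * a = -d := by
  have h2 : vec A B b c (e+d) ∈ (Mmat A B C).mulVec '' T := by
    rw [hT.2.2.2.2.2.2]
    simp only [Set.mem_iUnion]
    exact ⟨![(d:ℝ),0,0], ⟨d, h0, h1, rfl⟩, _, h, vec_add_d _ _ _ _ _ _⟩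
  obtain ⟨x, hx, hx2⟩ := h2
  rw [vec_eq A B x] at hx2 hx
  rw [mulVec_vec] at hx2
  obtain ⟨e1, e2, e3⟩ := vec_inj A B hx2
  refine ⟨x 2, ?_, ?_⟩
  · rw [← e1, ← e2]; exact hx
  · rw [← e1, ← e2] ; linarith

theorem S1 {A B C : ℤ} {T : Set (Fin 3 → ℝ)} (hT : IsABCTile A B C T) {a b c : ℝ}
    (h : vec A B a b c ∈ T) :
    ∃ u : ℕ → ℝ, u 0 = a ∧ u 1 = b ∧ u 2 = c ∧
      (∀ k, vec A B (u k) (u (k+1)) (u (k+2)) ∈ T) ∧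
      ∃ d : ℕ → ℤ, ∀ k, 0 ≤ d k ∧ d k < C ∧ pR A B C u k = -(d k) := by
  have H : ∀ s : {p : ℝ × ℝ × ℝ // vec A B p.1 p.2.1 p.2.2 ∈ T},
      ∃ s' : {p : ℝ × ℝ × ℝ // vec A B p.1 p.2.1 p.2.2 ∈ T}, s'.1.1 = s.1.2.1 ∧ s'.1.2.1 = s.1.2.2 ∧
      ∃ d : ℤ, 0 ≤ d ∧ d < C ∧ s'.1.2.2 = -d - (A * s.1.2.2 + B * s.1.2.1 + C * s.1.1) := by
    rintro ⟨⟨a, b, c⟩, hs⟩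
    obtain ⟨d, h0, h1, h2⟩ := T_fwd hT hs
    exact ⟨⟨⟨b, c, _⟩, h2⟩, rfl, rfl, d, h0, h1, rfl⟩
  choose f f1 f2 d d0 d1 d2 using H
  let s : ℕ → {p : ℝ × ℝ × ℝ // vec A B p.1 p.2.1 p.2.2 ∈ T} := fun n => f^[n] ⟨⟨a,b,c⟩, h⟩
  have hs : ∀ n, s (n+1) = f (s n) := fun n => Function.iterate_succ_apply' _ _ _
  have e1 : ∀ n, (s (n+1)).1.1 = (s n).1.2.1 := fun n => by rw [hs, f1]
  have e2 : ∀ n, (s (n+1)).1.2.1 = (s n).1.2.2 := fun n => by rw [hs, f2]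
  refine ⟨fun n => (s n).1.1, rfl, e1 0, ?_, ?_, fun n => d (s n), ?_⟩
  · show (s 2).1.1 = _
    rw [e1, e2]; rfl
  · intro k
    have := (s k).2
    rw [← e2, ← e1, ← e1] at this
    exact this
  · intro k
    refine ⟨d0 _, d1 _, ?_⟩
    simp only [pR]
    rw [show k+3 = (k+2)+1 from rfl, e1 (k+2), show k+2 = (k+1)+1 from rfl, e2 (k+1), e1 (k+1), e2 k, e1 k, hs k, d2]
    ring

theorem S2 {A B C : ℤ} {T : Set (Fin 3 → ℝ)} (hT : IsABCTile A B C T) (N : ℕ) :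
    ∀ d : ℕ → ℤ, (∀ k, 0 ≤ d k ∧ d k < C) →
    ∃ u : ℕ → ℝ, (∀ k ≤ N, vec A B (u k) (u (k+1)) (u (k+2)) ∈ T) ∧
      ∀ k < N, pR A B C u k = -(d k) := by
  induction N with
  | zero =>
    intro d hd
    obtain ⟨x, hx⟩ := hT.2.2.2.1
    rw [vec_eq A B x] at hx
    obtain ⟨u, h0, h1, h2, h, -⟩ := S1 hT hx
    exact ⟨u, fun k _ => h k, fun k hk => by omega⟩
  | succ N ih =>
    intro d hd
    obtain ⟨u, hu, hu2⟩ := ih (fun k => d (k+1)) (fun k => hd _)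
    obtain ⟨a, ha, ha2⟩ := T_bwd hT (hu 0 (by omega)) (d 0) (hd 0).1 (hd 0).2
    refine ⟨fun k => Nat.casesOn k a u, ?_, ?_⟩
    · intro k hk
      cases k with
      | zero => exact ha
      | succ k => exact hu k (by omega)
    · intro k hk
      cases k with
      | zero => exact ha2
      | succ k => exact hu2 k (by omega)

/-- one contraction block -/
theorem block {A B C : ℤ} (hA : 1 ≤ A) (hB : A ≤ B) (hC : B < C) (u : ℕ → ℝ) (k : ℕ)
    (hu : ∀ j < 4, C * u (k+j) = u (k+j+4) + (A-1) * u (k+j+3) + (B-A) * u (k+j+2) + (C-B) * u (k+j+1))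
    (L U : ℝ) (h : ∀ j, 4 ≤ j → j < 8 → L ≤ u (k+j) ∧ u (k+j) ≤ U) :
    ∃ L' U' : ℝ, U' - L' ≤ (1 - 1/(2*(C:ℝ)^4)) * (U - L) ∧ ∀ j < 4, L' ≤ u (k+j) ∧ u (k+j) ≤ U' := by
  have hA' : (0:ℝ) ≤ A - 1 := by have : (1:ℝ) ≤ A := by exact_mod_cast hA
                                 linarith
  have hB' : (0:ℝ) ≤ B - A := by have : (A:ℝ) ≤ B := by exact_mod_cast hB
                                 linarith
  have hC' : (1:ℝ) ≤ C - B := by have : (B:ℝ) + 1 ≤ C := by exact_mod_cast hC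
                                 linarith
  have hC1 : (1:ℝ) ≤ C := by linarith
  -- general step
  have key : ∀ (v : ℕ → ℝ), (∀ j < 4, C * v (k+j) = v (k+j+4) + (A-1) * v (k+j+3) + (B-A) * v (k+j+2) + (C-B) * v (k+j+1)) →
      (∀ j, 4 ≤ j → j < 8 → 0 ≤ v (k+j)) → ∀ δ, δ ≤ v (k+7) → 0 ≤ δ → ∀ j < 4, δ / (C:ℝ)^4 ≤ v (k+j) := by
    intro v hv h0 δ hδ hδ0
    have n4 := h0 4 (by norm_num) (by norm_num)
    have n5 := h0 5 (by norm_num) (by norm_num)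
    have n6 := h0 6 (by norm_num) (by norm_num)
    have n7 := h0 7 (by norm_num) (by norm_num)
    have q3 := hv 3 (by norm_num)
    have q2 := hv 2 (by norm_num)
    have q1 := hv 1 (by norm_num)
    have q0 := hv 0 (by norm_num)
    simp only [add_assoc] at q0 q1 q2 q3
    norm_num at q0 q1 q2 q3
    have st : ∀ x y : ℝ, x ≤ C * y → x / C ≤ y := fun x y h => by
      rw [div_le_iff₀ (by linarith)]; linarith
    have m3 : δ / C ≤ v (k+3) := by
      apply st; rw [q3]
      have := mul_nonneg hA' n6
      have := mul_nonneg hB' n5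
      have := mul_nonneg (by linarith : (0:ℝ) ≤ C - B) n4
      linarith
    have p3 : 0 ≤ v (k+3) := le_trans (by positivity) m3
    have m2 : δ / C / C ≤ v (k+2) := by
      apply st; rw [q2]
      have := mul_nonneg hA' n5
      have := mul_nonneg hB' n4
      nlinarith
    have p2 : 0 ≤ v (k+2) := le_trans (by positivity) m2
    have m1 : δ / C / C / C ≤ v (k+1) := by
      apply st; rw [q1]
      have := mul_nonneg hA' n4
      have := mul_nonneg hB' p3
      nlinarith
    have p1 : 0 ≤ v (k+1) := le_trans (by positivity) m1
    have m0 : δ / C / C / C / C ≤ v k := by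
      apply st; rw [q0]
      have := mul_nonneg hA' p3
      have := mul_nonneg hB' p2
      nlinarith
    have dd : ∀ x : ℝ, 0 ≤ x → x / C ≤ x := fun x hx => div_le_self hx hC1
    have e : δ / (C:ℝ)^4 = δ / C / C / C / C := by field_simp
    have d3 := dd (δ / C / C / C) (by positivity)
    have d2 := dd (δ / C / C) (by positivity)
    have d1 := dd (δ / C) (by positivity)
    intro j hj
    rw [e]
    interval_cases j
    · simpa using m0
    · linarith
    · linarith
    · linarith
  have cc : (C:ℝ)^4 ≠ 0 := by positivity
  have hUL : L ≤ U := (h 4 (by norm_num) (by norm_num)).1.trans (h 4 (by norm_num) (by norm_num)).2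
  rcases le_total (u (k+7)) ((U+L)/2) with hm | hm
  · refine ⟨L, U - (U-L)/2/(C:ℝ)^4, ?_, ?_⟩
    · apply le_of_eq; field_simp; ring
    · intro j hj
      have k1 := key (fun n => u n - L) (fun j hj => by have := hu j hj; linear_combination this)
        (fun j h1 h2 => by have := h j h1 h2; linarith) 0 (by
          have := h 7 (by norm_num) (by norm_num); linarith) le_rfl j hj
      have k2 := key (fun n => U - u n) (fun j hj => by have := hu j hj; linear_combination -this)
        (fun j h1 h2 => by have := h j h1 h2; linarith) ((U-L)/2) (by linarith) (by linarith) j hj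
      simp only [zero_div] at k1 k2
      constructor <;> linarith
  · refine ⟨L + (U-L)/2/(C:ℝ)^4, U, ?_, ?_⟩
    · apply le_of_eq; field_simp; ring
    · intro j hj
      have k1 := key (fun n => U - u n) (fun j hj => by have := hu j hj; linear_combination -this)
        (fun j h1 h2 => by have := h j h1 h2; linarith) 0 (by
          have := h 7 (by norm_num) (by norm_num); linarith) le_rfl j hj
      have k2 := key (fun n => u n - L) (fun j hj => by have := hu j hj; linear_combination this)
        (fun j h1 h2 => by have := h j h1 h2; linarith) ((U-L)/2) (by linarith) (by linarith) j hj
      simp only [zero_div] at k1 k2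
      constructor <;> linarith

noncomputable def kap (C : ℤ) : ℝ := 1 - 1/(2*(C:ℝ)^4)

theorem kap_nonneg {C : ℤ} (h : 1 ≤ C) : 0 ≤ kap C := by
  have : (1:ℝ) ≤ C := by exact_mod_cast h
  have h4 : (1:ℝ) ≤ (C:ℝ)^4 := one_le_pow₀ this
  unfold kap
  have : 1/(2*(C:ℝ)^4) ≤ 1 := by
    rw [div_le_one (by positivity)]; linarith
  linarith

theorem kap_lt {C : ℤ} (h : 1 ≤ C) : kap C < 1 := by
  have : (1:ℝ) ≤ C := by exact_mod_cast h
  have : 0 < 1/(2*(C:ℝ)^4) := by positivity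
  unfold kap; linarith

theorem S3 {A B C : ℤ} (hA : 1 ≤ A) (hB : A ≤ B) (hC : B < C) (R : ℝ) (n : ℕ) (u : ℕ → ℝ)
    (hu : ∀ k ≤ 4*n, pR A B C u k = 0) (hR : ∀ j < 4, |u (4*n+j)| ≤ R) :
    ∀ j < 4, |u j| ≤ 2 * R * kap C ^ n := by
  have hu4 : ∀ k < 4*n, C * u k = u (k+4) + (A-1) * u (k+3) + (B-A) * u (k+2) + (C-B) * u (k+1) := by
    intro k hk
    have h1 := hu k (by omega)
    have h2 := hu (k+1) (by omega)
    simp only [pR] at h1 h2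
    rw [show k+1+3 = k+4 by ring, show k+1+2=k+3 by ring, show k+1+1 = k+2 by ring] at h2
    linear_combination h1 - h2
  have key : ∀ m ≤ n, ∃ L U : ℝ, U - L ≤ 2*R*kap C^m ∧ ∀ j < 4, L ≤ u (4*(n-m)+j) ∧ u (4*(n-m)+j) ≤ U := by
    intro m
    induction m with
    | zero =>
      intro _
      refine ⟨-R, R, by simp; linarith, fun j hj => ?_⟩
      have := abs_le.mp (hR j hj)
      simpa using this
    | succ m ih =>
      intro hm
      obtain ⟨L, U, h1, h2⟩ := ih (by omega)
      obtain ⟨L', U', h3, h4⟩ := block hA hB hC u (4*(n-(m+1))) (fun j hj => hu4 _ (by omega)) L U (by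
        intro j hj hj2
        have := h2 (j-4) (by omega)
        rwa [show 4*(n-m)+(j-4) = 4*(n-(m+1))+j by omega] at this)
      refine ⟨L', U', h3.trans ?_, h4⟩
      change kap C * (U-L) ≤ _
      calc kap C * (U-L) ≤ kap C * (2*R*kap C^m) := mul_le_mul_of_nonneg_left h1 (kap_nonneg (by omega))
        _ = _ := by ring
  obtain ⟨L, U, h1, h2⟩ := key n le_rfl
  have h0 := hu 0 (by omega)
  simp only [pR, Nat.sub_self, Nat.mul_zero, zero_add] at h0 h2
  have a0 := h2 0 (by norm_num)
  have a1 := h2 1 (by norm_num)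
  have a2 := h2 2 (by norm_num)
  have a3 := h2 3 (by norm_num)
  have hA' : (1:ℝ) ≤ A := by exact_mod_cast hA
  have hB' : (A:ℝ) ≤ B := by exact_mod_cast hB
  have hC' : (B:ℝ) ≤ C := by exact_mod_cast hC.le
  have hL : L ≤ 0 := by
    by_contra hL; push Not at hL
    have := mul_pos (by linarith : (0:ℝ) < A) (by linarith : 0 < u 2)
    have := mul_pos (by linarith : (0:ℝ) < B) (by linarith : 0 < u 1)
    have := mul_pos (by linarith : (0:ℝ) < C) (by linarith : 0 < u 0)
    linarith
  have hU : 0 ≤ U := by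
    by_contra hL; push Not at hL
    have := mul_pos (by linarith : (0:ℝ) < A) (by linarith : 0 < -u 2)
    have := mul_pos (by linarith : (0:ℝ) < B) (by linarith : 0 < -u 1)
    have := mul_pos (by linarith : (0:ℝ) < C) (by linarith : 0 < -u 0)
    linarith
  intro j hj
  have := h2 j hj
  rw [abs_le]; constructor <;> linarith

theorem vec_bd {A B C : ℤ} {T : Set (Fin 3 → ℝ)} (hT : IsABCTile A B C T) :
    ∃ R : ℝ, 0 < R ∧ ∀ a b c, vec A B a b c ∈ T → |a| ≤ R := by
  obtain ⟨R, h0, hR⟩ := hT.2.2.2.2.1.isBounded.exists_pos_norm_le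
  refine ⟨R, h0, fun a b c h => ?_⟩
  have := (norm_le_pi_norm (vec A B a b c) 2).trans (hR _ h)
  simpa [vec] using this

theorem vec_bd' {A B C : ℤ} {T : Set (Fin 3 → ℝ)} (hT : IsABCTile A B C T) :
    ∃ R : ℝ, 0 < R ∧ ∀ u : ℕ → ℝ, (∀ k, vec A B (u k) (u (k+1)) (u (k+2)) ∈ T) → ∀ k, |u k| ≤ R := by
  obtain ⟨R, h0, h⟩ := vec_bd hT
  exact ⟨R, h0, fun u hu k => h _ _ _ (hu k)⟩

theorem vec_cont (A B : ℤ) : Continuous (fun p : ℝ × ℝ × ℝ => vec A B p.1 p.2.1 p.2.2) := by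
  unfold vec
  refine continuous_pi fun i => ?_
  fin_cases i <;> simp <;> fun_prop

theorem vec_norm_le (A B : ℤ) (a b c e : ℝ) (ha : |a| ≤ e) (hb : |b| ≤ e) (hc : |c| ≤ e) :
    ‖vec A B a b c‖ ≤ (1 + |(A:ℝ)| + |(B:ℝ)|) * e := by
  have he : 0 ≤ e := (abs_nonneg a).trans ha
  have pA := abs_nonneg (A:ℝ)
  have pB := abs_nonneg (B:ℝ)
  rw [pi_norm_le_iff_of_nonneg (by positivity)]
  have hAb : |(A:ℝ) * b| ≤ |(A:ℝ)| * e := by rw [abs_mul]; gcongr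
  have hAa : |(A:ℝ) * a| ≤ |(A:ℝ)| * e := by rw [abs_mul]; gcongr
  have hBa : |(B:ℝ) * a| ≤ |(B:ℝ)| * e := by rw [abs_mul]; gcongr
  have := mul_nonneg pA he
  have := mul_nonneg pB he
  intro i
  fin_cases i
  · have h1 := abs_add_le (c + A*b) (B*a)
    have h2 := abs_add_le c (A*b)
    simp [vec]; linarith
  · have h2 := abs_add_le b (A*a)
    simp [vec]; linarith
  · simp [vec]; linarith

theorem tendsto_kap {C : ℤ} (h : 1 ≤ C) (R : ℝ) :
    Filter.Tendsto (fun n => R * kap C ^ n) Filter.atTop (nhds 0) := by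
  have := (tendsto_pow_atTop_nhds_zero_of_lt_one (kap_nonneg h) (kap_lt h)).const_mul R
  simpa using this

theorem S4 {A B C : ℤ} {T : Set (Fin 3 → ℝ)} (hT : IsABCTile A B C T) (u : ℕ → ℝ) (d : ℕ → ℤ)
    (hd : ∀ k, 0 ≤ d k ∧ d k < C) (hu : ∀ k, pR A B C u k = -(d k)) (R : ℝ) (hR : ∀ k, |u k| ≤ R) :
    vec A B (u 0) (u 1) (u 2) ∈ T := by
  obtain ⟨R', h0, hR'⟩ := vec_bd hT
  have hcl : IsClosed T := hT.2.2.2.2.1.isClosed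
  have H : ∀ n : ℕ, ∃ v : ℕ → ℝ, vec A B (v 0) (v 1) (v 2) ∈ T ∧ ∀ j < 4, |u j - v j| ≤ 2 * (R + R') * kap C ^ n := by
    intro n
    obtain ⟨v, hv, hv2⟩ := S2 hT (4*n+4) d hd
    refine ⟨v, hv 0 (by omega), ?_⟩
    apply S3 hT.1 hT.2.1 hT.2.2.1 (R + R') n (fun k => u k - v k)
    · intro k hk
      have h1 := hu k
      have h2 := hv2 k (by omega)
      simp only [pR] at *
      linear_combination h1 - h2
    · intro j hj
      have h1 := hR (4*n+j)
      have h2 := hR' _ _ _ (hv (4*n+j) (by omega))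
      exact (abs_sub _ _).trans (add_le_add h1 h2)
  choose v hv hv2 using H
  have hC1 : 1 ≤ C := by have := hT.1; have := hT.2.1; have := hT.2.2.1; omega
  have lim : ∀ j < 4, Filter.Tendsto (fun n => v n j) Filter.atTop (nhds (u j)) := by
    intro j hj
    rw [tendsto_iff_dist_tendsto_zero]
    refine squeeze_zero (fun _ => dist_nonneg) (fun n => ?_) (tendsto_kap hC1 (2*(R+R')))
    rw [dist_comm, Real.dist_eq]; exact hv2 n j hj
  have := ((vec_cont A B).tendsto (u 0, u 1, u 2)).comp
    ((lim 0 (by norm_num)).prodMk_nhds ((lim 1 (by norm_num)).prodMk_nhds (lim 2 (by norm_num))))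
  exact hcl.mem_of_tendsto this (Filter.Eventually.of_forall hv)

theorem S5 {A B C : ℤ} {T : Set (Fin 3 → ℝ)} (hT : IsABCTile A B C T) (d : ℕ → ℤ)
    (hd : ∀ k, 0 ≤ d k ∧ d k < C) :
    ∃ u : ℕ → ℝ, (∀ k, vec A B (u k) (u (k+1)) (u (k+2)) ∈ T) ∧ ∀ k, pR A B C u k = -(d k) := by
  obtain ⟨R, h0, hR⟩ := vec_bd hT
  have hcl : IsClosed T := hT.2.2.2.2.1.isClosed
  let K : ℕ → Set (ℕ → ℝ) := fun N => {u | (∀ k, u k ∈ Set.Icc (-R) R) ∧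
    (∀ k ≤ N, vec A B (u k) (u (k+1)) (u (k+2)) ∈ T) ∧ ∀ k < N, pR A B C u k = -(d k)}
  have hb : IsCompact {u : ℕ → ℝ | ∀ k, u k ∈ Set.Icc (-R) R} := by
    have := isCompact_univ_pi (fun k : ℕ => (isCompact_Icc : IsCompact (Set.Icc (-R) R)))
    have e : {u : ℕ → ℝ | ∀ k, u k ∈ Set.Icc (-R) R} = Set.univ.pi (fun _ => Set.Icc (-R) R) := by
      ext u
      constructor
      · intro h k _; exact h k
      · intro h k; exact h k trivial
    rw [e]; exact this
  have hclosed : ∀ N, IsClosed (K N) := by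
    intro N
    refine hb.isClosed.inter (IsClosed.inter ?_ ?_)
    · have e : {u : ℕ → ℝ | ∀ k ≤ N, vec A B (u k) (u (k+1)) (u (k+2)) ∈ T} =
          ⋂ k, ⋂ (_ : k ≤ N), {u | vec A B (u k) (u (k+1)) (u (k+2)) ∈ T} := by
        ext u; simp
      change IsClosed {u : ℕ → ℝ | ∀ k ≤ N, vec A B (u k) (u (k+1)) (u (k+2)) ∈ T}
      rw [e]
      refine isClosed_iInter fun k => isClosed_iInter fun _ => ?_
      exact hcl.preimage ((vec_cont A B).comp (by fun_prop :
        Continuous fun u : ℕ → ℝ => (u k, u (k+1), u (k+2))))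
    · have e : {u : ℕ → ℝ | ∀ k < N, pR A B C u k = -(d k)} =
          ⋂ k, ⋂ (_ : k < N), {u | pR A B C u k = -(d k)} := by
        ext u; simp
      change IsClosed {u : ℕ → ℝ | ∀ k < N, pR A B C u k = -(d k)}
      rw [e]
      refine isClosed_iInter fun k => isClosed_iInter fun _ => ?_
      refine isClosed_eq ?_ continuous_const
      unfold pR; fun_prop
  have := IsCompact.nonempty_iInter_of_sequence_nonempty_isCompact_isClosed K ?_ ?_ ?_ hclosed
  · obtain ⟨u, hu⟩ := this
    simp only [Set.mem_iInter] at hu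
    exact ⟨u, fun k => (hu k).2.1 k le_rfl, fun k => (hu (k+1)).2.2 k (by omega)⟩
  · intro n u hu
    exact ⟨hu.1, fun k hk => hu.2.1 k (by omega), fun k hk => hu.2.2 k (by omega)⟩
  · intro n
    obtain ⟨u, hu, hu2⟩ := S2 hT (n+3) d hd
    refine ⟨fun k => if k ≤ n+3 then u k else 0, fun k => ?_, fun k hk => ?_, fun k hk => ?_⟩
    · by_cases hk : k ≤ n+3
      · simp only [hk, if_true]
        exact abs_le.mp (hR _ _ _ (hu k hk))
      · simp [hk]; exact h0.le
    · simp only [show k ≤ n+3 by omega, show k+1 ≤ n+3 by omega, show k+2 ≤ n+3 by omega, if_true]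
      exact hu k (by omega)
    · simp only [pR, show k ≤ n+3 by omega, show k+1 ≤ n+3 by omega, show k+2 ≤ n+3 by omega,
        show k+3 ≤ n+3 by omega, if_true]
      exact hu2 k (by omega)
  · exact hb.of_isClosed_subset (hclosed 0) (fun u hu => hu.1)

/-! orbits -/
noncomputable def orb (A B C : ℤ) (x : Fin 3 → ℝ) (k : ℕ) : ℝ := ((Mmat A B C).mulVec^[k] x) 2

theorem orb_vec_succ (A B C : ℤ) (a b c : ℝ) (k : ℕ) :
    orb A B C (vec A B a b c) (k+1) = orb A B C (vec A B b c (-(A*c+B*b+C*a))) k := by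
  simp only [orb, Function.iterate_succ_apply, mulVec_vec]

theorem orb_eq (A B C : ℤ) (u : ℕ → ℝ) (hu : ∀ k, pR A B C u k = 0) (k : ℕ) :
    orb A B C (vec A B (u 0) (u 1) (u 2)) k = u k := by
  induction k generalizing u with
  | zero => simp [orb, vec]
  | succ k ih =>
    rw [orb_vec_succ]
    have := ih (fun k => u (k+1)) (fun k => hu (k+1))
    simp only [zero_add] at this
    rw [← this]
    congr 2
    have := hu 0
    simp only [pR, zero_add] at this
    linarith

theorem exists_hom (A B C : ℤ) (a b c : ℝ) : ∃ u : ℕ → ℝ, u 0 = a ∧ u 1 = b ∧ u 2 = c ∧ ∀ k, pR A B C u k = 0 := by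
  refine ⟨fun k => orb A B C (vec A B a b c) k, by simp [orb, vec], ?_, ?_, ?_⟩
  · show orb A B C (vec A B a b c) (0+1) = b
    rw [orb_vec_succ]; simp [orb, vec]
  · show orb A B C (vec A B a b c) (0+1+1) = c
    rw [orb_vec_succ, orb_vec_succ]; simp [orb, vec]
  · intro k
    suffices H : ∀ a b c, pR A B C (fun k => orb A B C (vec A B a b c) k) k = 0 from H a b c
    induction k with
    | zero =>
      intro a b c
      simp only [pR, zero_add]
      rw [show (3:ℕ) = 0+1+1+1 from rfl, show (2:ℕ) = 0+1+1 from rfl, show (1:ℕ)=0+1 from rfl]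
      simp only [orb_vec_succ]
      simp [orb, vec]; ring
    | succ k ih =>
      intro a b c
      have := ih b c (-(A*c+B*b+C*a))
      simp only [pR] at *
      rw [show k+1+3 = (k+3)+1 by ring, show k+1+2 = (k+2)+1 by ring]
      simp only [orb_vec_succ]
      simpa [orb_vec_succ] using this

theorem orb_rec (A B C : ℤ) (x : Fin 3 → ℝ) (k : ℕ) : pR A B C (orb A B C x) k = 0 := by
  obtain ⟨u, h0, h1, h2, hu⟩ := exists_hom A B C (x 2) (x 1 - A * x 2) (x 0 - B * x 2 - A * (x 1 - A * x 2))
  have hx : x = vec A B (u 0) (u 1) (u 2) := by rw [h0, h1, h2]; exact vec_eq A B x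
  rw [hx]
  have : orb A B C (vec A B (u 0) (u 1) (u 2)) = u := funext (orb_eq A B C u hu)
  rw [this]; exact hu k

theorem vec_orb (A B C : ℤ) (x : Fin 3 → ℝ) :
    vec A B (orb A B C x 0) (orb A B C x 1) (orb A B C x 2) = x := by
  obtain ⟨u, h0, h1, h2, hu⟩ := exists_hom A B C (x 2) (x 1 - A * x 2) (x 0 - B * x 2 - A * (x 1 - A * x 2))
  have hx : x = vec A B (u 0) (u 1) (u 2) := by rw [h0, h1, h2]; exact vec_eq A B x
  have : orb A B C x = u := by rw [hx]; exact funext (orb_eq A B C u hu)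
  rw [this, ← hx]

/-! addresses -/
def qq (A B C : ℤ) (F : ℕ → ℤ) (k : ℕ) : ℤ :=
  F (k+4) + (A-1) * F (k+3) + (B-A) * F (k+2) + (C-B) * F (k+1) - C * F k

def Adr (A B C : ℤ) (F : ℕ → ℤ) : Prop := ∀ k, 0 ≤ qq A B C F k ∧ qq A B C F k < C

def TRep (A B C : ℤ) (F : ℕ → ℤ) (x : Fin 3 → ℝ) : Prop :=
  Adr A B C F ∧ ∃ R : ℝ, ∀ k, |orb A B C x k - ((F (k+1) - F k : ℤ) : ℝ)| ≤ R

def win (A B : ℤ) (F : ℕ → ℤ) : Fin 3 → ℤ :=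
  ![(F 3 - F 2) + A * (F 2 - F 1) + B * (F 1 - F 0), (F 2 - F 1) + A * (F 1 - F 0), F 1 - F 0]

def BdInc (G : ℕ → ℤ) : Prop := ∃ R : ℤ, ∀ k, |G (k+1) - G k| ≤ R

theorem toR_win (A B : ℤ) (F : ℕ → ℤ) :
    toR (win A B F) = vec A B ((F 1 - F 0 : ℤ) : ℝ) ((F 2 - F 1 : ℤ) : ℝ) ((F 3 - F 2 : ℤ) : ℝ) := by
  ext i; fin_cases i <;> simp [toR, win, vec]

theorem qq_add (A B C : ℤ) (F G : ℕ → ℤ) (k : ℕ) :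
    qq A B C (fun n => F n + G n) k = qq A B C F k + qq A B C G k := by
  simp only [qq]; ring

theorem qq_sub (A B C : ℤ) (F G : ℕ → ℤ) (k : ℕ) :
    qq A B C (fun n => F n - G n) k = qq A B C F k - qq A B C G k := by
  simp only [qq]; ring

theorem qq_addc (A B C : ℤ) (F : ℕ → ℤ) (c : ℤ) (k : ℕ) :
    qq A B C (fun n => F n + c) k = qq A B C F k := by
  simp only [qq]; ring

theorem qq_subc (A B C : ℤ) (F : ℕ → ℤ) (c : ℤ) (k : ℕ) :
    qq A B C (fun n => F n - c) k = qq A B C F k := by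
  simp only [qq]; ring

theorem Adr.addc {A B C : ℤ} {F : ℕ → ℤ} (h : Adr A B C F) (c : ℤ) : Adr A B C (fun n => F n + c) := by
  intro k; rw [qq_addc]; exact h k

theorem TRep.addc {A B C : ℤ} {F : ℕ → ℤ} {x} (h : TRep A B C F x) (c : ℤ) : TRep A B C (fun n => F n + c) x := by
  obtain ⟨h1, R, h2⟩ := h
  refine ⟨h1.addc c, R, fun k => ?_⟩
  have := h2 k
  rwa [show F (k+1) + c - (F k + c) = F (k+1) - F k by ring]

theorem pR_inc (A B C : ℤ) (F : ℕ → ℤ) (k : ℕ) :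
    pR A B C (fun k => ((F (k+1) - F k : ℤ) : ℝ)) k = ((qq A B C F k : ℤ) : ℝ) := by
  simp only [pR, qq]; push_cast
  rw [show k+3+1 = k+4 by ring, show k+2+1 = k+3 by ring, show k+1+1=k+2 by ring]; ring

theorem pR_sub (A B C : ℤ) (u v : ℕ → ℝ) (k : ℕ) :
    pR A B C (fun k => u k - v k) k = pR A B C u k - pR A B C v k := by
  simp only [pR]; ring

theorem pR_add (A B C : ℤ) (u v : ℕ → ℝ) (k : ℕ) :
    pR A B C (fun k => u k + v k) k = pR A B C u k + pR A B C v k := by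
  simp only [pR]; ring

theorem pR_unique (A B C : ℤ) (u v : ℕ → ℝ) (h : ∀ k, pR A B C u k = pR A B C v k)
    (h0 : u 0 = v 0) (h1 : u 1 = v 1) (h2 : u 2 = v 2) : ∀ k, u k = v k := by
  intro k
  induction k using Nat.strong_induction_on with
  | _ k ih =>
    match k, ih with
    | 0, _ => exact h0
    | 1, _ => exact h1
    | 2, _ => exact h2
    | k+3, ih =>
      have := h k
      simp only [pR] at this
      rw [ih k (by omega), ih (k+1) (by omega), ih (k+2) (by omega)] at this
      linarith

theorem rec4 {α : Type*} (w0 w1 w2 w3 : α) (f : ℕ → α → α → α → α → α) :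
    ∃ F : ℕ → α, F 0 = w0 ∧ F 1 = w1 ∧ F 2 = w2 ∧ F 3 = w3 ∧
      ∀ k, F (k+4) = f k (F k) (F (k+1)) (F (k+2)) (F (k+3)) := by
  let s : ℕ → α × α × α × α := fun n => Nat.rec (w0, w1, w2, w3)
    (fun k p => (p.2.1, p.2.2.1, p.2.2.2, f k p.1 p.2.1 p.2.2.1 p.2.2.2)) n
  have e : ∀ k, s (k+1) = ((s k).2.1, (s k).2.2.1, (s k).2.2.2, f k (s k).1 (s k).2.1 (s k).2.2.1 (s k).2.2.2) :=
    fun k => rfl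
  refine ⟨fun k => (s k).1, rfl, rfl, rfl, rfl, fun k => rfl⟩

theorem TRep.window {A B C : ℤ} {T : Set (Fin 3 → ℝ)} (hT : IsABCTile A B C T) {F : ℕ → ℤ} {x}
    (h : TRep A B C F x) (n : ℕ) :
    vec A B (orb A B C x n - ((F (n+1) - F n : ℤ) : ℝ)) (orb A B C x (n+1) - ((F (n+2) - F (n+1) : ℤ) : ℝ))
      (orb A B C x (n+2) - ((F (n+3) - F (n+2) : ℤ) : ℝ)) ∈ T := by
  obtain ⟨h1, R, h2⟩ := h
  have := S4 hT (fun k => orb A B C x (n+k) - ((F (n+k+1) - F (n+k) : ℤ) : ℝ)) (fun k => qq A B C F (n+k))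
    (fun k => h1 (n+k)) (fun k => by
      have e := pR_sub A B C (orb A B C x) (fun k => ((F (k+1) - F k : ℤ) : ℝ)) (n+k)
      rw [orb_rec, pR_inc, zero_sub] at e
      rw [← e]; rfl) R (fun k => h2 (n+k))
  exact this

theorem TRep.unif {A B C : ℤ} {T : Set (Fin 3 → ℝ)} (hT : IsABCTile A B C T) :
    ∃ R : ℝ, 0 < R ∧ ∀ F x, TRep A B C F x → ∀ k, |orb A B C x k - ((F (k+1) - F k : ℤ) : ℝ)| ≤ R := by
  obtain ⟨R, h0, hR⟩ := vec_bd hT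
  exact ⟨R, h0, fun F x h k => hR _ _ _ (h.window hT k)⟩

theorem TRep.mem {A B C : ℤ} {T : Set (Fin 3 → ℝ)} (hT : IsABCTile A B C T) {F : ℕ → ℤ} {x}
    (h : TRep A B C F x) : x ∈ tileTranslate (toR (win A B F)) T := by
  refine ⟨_, h.window hT 0, ?_⟩
  simp only [zero_add]
  rw [toR_win, vec_add]
  simp only [sub_add_cancel]
  exact vec_orb A B C x

theorem exists_rep {A B C : ℤ} {T : Set (Fin 3 → ℝ)} (hT : IsABCTile A B C T) {x} {α : Fin 3 → ℤ}
    (hx : x ∈ tileTranslate (toR α) T) : ∃ F, F 0 = 0 ∧ TRep A B C F x ∧ win A B F = α := by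
  obtain ⟨y, hy, rfl⟩ := hx
  have hy0 := hy
  rw [vec_eq A B y] at hy
  obtain ⟨u, u0, u1, u2, hu, d, hd⟩ := S1 hT hy
  obtain ⟨F, F0, F1, F2, F3, hF⟩ := rec4 (0:ℤ) (α 2) (α 2 + (α 1 - A * α 2))
    (α 2 + (α 1 - A * α 2) + (α 0 - B * α 2 - A * (α 1 - A * α 2)))
    (fun k a b c e => d k - ((A-1) * e + (B-A) * c + (C-B)*b - C * a))
  have hq : ∀ k, qq A B C F k = d k := fun k => by simp only [qq, hF]; ring
  have hw : win A B F = α := by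
    ext i; fin_cases i <;> simp [win, F0, F1, F2, F3]
  have hyv : y = vec A B (u 0) (u 1) (u 2) := by rw [u0, u1, u2]; exact vec_eq A B y
  have hx : y + toR α = vec A B (u 0 + ((F 1 - F 0 : ℤ):ℝ)) (u 1 + ((F 2 - F 1 : ℤ):ℝ)) (u 2 + ((F 3 - F 2 : ℤ):ℝ)) := by
    conv_lhs => rw [← hw, toR_win, hyv]
    rw [vec_add]
  obtain ⟨R, -, hR⟩ := vec_bd' hT
  have key : ∀ k, orb A B C (y + toR α) k = u k + ((F (k+1) - F k : ℤ):ℝ) := by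
    have hz := vec_orb A B C (y + toR α)
    conv_rhs at hz => rw [hx]
    obtain ⟨e0, e1, e2⟩ := vec_inj A B hz
    refine pR_unique A B C _ _ (fun k => ?_) e0 e1 e2
    rw [orb_rec, pR_add, pR_inc, (hd k).2.2, hq]; simp
  refine ⟨F, F0, ⟨fun k => ?_, R, fun k => ?_⟩, hw⟩
  · rw [hq]; exact ⟨(hd k).1, (hd k).2.1⟩
  · rw [key]; simpa using hR u hu k

theorem Adr.rep {A B C : ℤ} {T : Set (Fin 3 → ℝ)} (hT : IsABCTile A B C T) {F : ℕ → ℤ}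
    (h : Adr A B C F) : ∃ x, TRep A B C F x := by
  obtain ⟨u, hu, hu2⟩ := S5 hT (qq A B C F) h
  obtain ⟨R, -, hR⟩ := vec_bd' hT
  have hz : ∀ k, pR A B C (fun k => u k + ((F (k+1) - F k : ℤ) : ℝ)) k = 0 := by
    intro k; rw [pR_add, pR_inc, hu2]; simp
  refine ⟨_, h, R, fun k => (?_ : |orb A B C (vec A B (u 0 + ((F (0+1) - F 0 : ℤ) : ℝ)) (u 1 + ((F (1+1) - F 1 : ℤ) : ℝ))
    (u 2 + ((F (2+1) - F 2 : ℤ) : ℝ))) k - ((F (k+1) - F k : ℤ) : ℝ)| ≤ R)⟩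
  have := orb_eq A B C _ hz k
  rw [this]; simpa using hR u hu k

theorem TRep.bd {A B C : ℤ} {F F' : ℕ → ℤ} {x} (h : TRep A B C F x) (h' : TRep A B C F' x) :
    BdInc (fun n => F' n - F n) := by
  obtain ⟨-, R, h1⟩ := h
  obtain ⟨-, R', h2⟩ := h'
  refine ⟨⌈R + R'⌉, fun k => ?_⟩
  have := abs_sub_le ((F' (k+1) - F' k : ℤ):ℝ) (orb A B C x k) ((F (k+1) - F k : ℤ) : ℝ)
  have a := h1 k
  have b := h2 k
  rw [abs_sub_comm] at b
  have c := Int.le_ceil (R+R')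
  have : |(((F' (k+1) - F' k) - (F (k+1) - F k) : ℤ):ℝ)| ≤ ((⌈R+R'⌉ : ℤ):ℝ) := by
    push_cast at *; linarith
  rw [← Int.cast_abs, Int.cast_le] at this
  rwa [show F' (k+1) - F (k+1) - (F' k - F k) = (F' (k+1) - F' k) - (F (k+1) - F k) by ring]

theorem TRep.of_bd {A B C : ℤ} {F F' : ℕ → ℤ} {x} (h : TRep A B C F x) (h' : Adr A B C F')
    (hb : BdInc (fun n => F' n - F n)) : TRep A B C F' x := by
  obtain ⟨-, R, h1⟩ := h
  obtain ⟨R', h2⟩ := hb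
  refine ⟨h', R + R', fun k => ?_⟩
  have b : |((F' (k+1) - F (k+1) - (F' k - F k) : ℤ) : ℝ)| ≤ (R':ℝ) := by
    rw [← Int.cast_abs, Int.cast_le]; exact h2 k
  have := abs_sub (orb A B C x k - ((F (k+1) - F k : ℤ) : ℝ)) ((F' (k+1) - F (k+1) - (F' k - F k) : ℤ) : ℝ)
  have e : orb A B C x k - ((F' (k+1) - F' k : ℤ) : ℝ) = (orb A B C x k - ((F (k+1) - F k : ℤ) : ℝ)) - ((F' (k+1) - F (k+1) - (F' k - F k) : ℤ) : ℝ) := by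
    push_cast; ring
  rw [e]
  have := h1 k
  linarith

theorem orb_close {A B C : ℤ} {T : Set (Fin 3 → ℝ)} (hT : IsABCTile A B C T) (x x' : Fin 3 → ℝ) (n : ℕ) (R : ℝ)
    (h : ∀ j < 4, |orb A B C x (4*n+j) - orb A B C x' (4*n+j)| ≤ R) :
    dist x x' ≤ (1 + |(A:ℝ)| + |(B:ℝ)|) * (2 * R * kap C ^ n) := by
  have := S3 hT.1 hT.2.1 hT.2.2.1 R n (fun k => orb A B C x k - orb A B C x' k) (fun k _ => by
    rw [pR_sub, orb_rec, orb_rec, sub_zero]) h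
  have e : x - x' = vec A B (orb A B C x 0 - orb A B C x' 0) (orb A B C x 1 - orb A B C x' 1) (orb A B C x 2 - orb A B C x' 2) := by
    have := vec_add A B (orb A B C x 0 - orb A B C x' 0) (orb A B C x 1 - orb A B C x' 1) (orb A B C x 2 - orb A B C x' 2)
      (orb A B C x' 0) (orb A B C x' 1) (orb A B C x' 2)
    simp only [sub_add_cancel, vec_orb] at this
    exact sub_eq_of_eq_add this.symm
  rw [dist_eq_norm, e]
  exact vec_norm_le _ _ _ _ _ _ (this 0 (by norm_num)) (this 1 (by norm_num)) (this 2 (by norm_num))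

theorem TRep.close {A B C : ℤ} {T : Set (Fin 3 → ℝ)} (hT : IsABCTile A B C T) (ε : ℝ) (hε : 0 < ε) :
    ∃ n : ℕ, ∀ F F' x x', TRep A B C F x → TRep A B C F' x' →
      (∀ k ≤ n, F k = F' k) → dist x x' < ε := by
  obtain ⟨R, hR0, hR⟩ := TRep.unif hT
  have hC1 : 1 ≤ C := by have := hT.1; have := hT.2.1; have := hT.2.2.1; omega
  have lim := tendsto_kap hC1 ((1 + |(A:ℝ)| + |(B:ℝ)|) * (2 * (R+R)))
  obtain ⟨n, hn⟩ := (lim.eventually (gt_mem_nhds hε)).exists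
  refine ⟨4*n+4, fun F F' x x' h h' hF => ?_⟩
  refine (orb_close hT x x' n (R+R) fun j hj => ?_).trans_lt (by rw [← mul_assoc]; exact hn)
  have a := hR F x h (4*n+j)
  have b := hR F' x' h' (4*n+j)
  rw [← hF _ (by omega), ← hF _ (by omega)] at b
  rw [abs_sub_comm] at b
  refine (abs_sub_le _ _ _).trans (add_le_add a b)

theorem TRep.unique {A B C : ℤ} {T : Set (Fin 3 → ℝ)} (hT : IsABCTile A B C T) {F x x'}
    (h : TRep A B C F x) (h' : TRep A B C F x') : x = x' := by
  by_contra hne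
  obtain ⟨n, hn⟩ := TRep.close hT (dist x x') (dist_pos.mpr hne)
  exact lt_irrefl _ (hn F F x x' h h' (fun _ _ => rfl))

theorem back_ext {C : ℤ} (A B : ℤ) (hC : 0 < C) (n : ℕ) : ∀ a b c : ℤ, ∃ V : ℕ → ℤ, V n = a ∧ V (n+1) = b ∧ V (n+2) = c ∧
    ∀ k, 0 ≤ V (k+3) + A * V (k+2) + B * V (k+1) + C * V k ∧ V (k+3) + A * V (k+2) + B * V (k+1) + C * V k < C := by
  induction n with
  | zero =>
    intro a b c
    obtain ⟨F, F0, F1, F2, F3, hF⟩ := rec4 a b c (-(A*c+B*b+C*a)) (fun k p q r s => -(A*s+B*r+C*q))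
    refine ⟨F, F0, F1, F2, fun k => ?_⟩
    rcases k with _ | k
    · simp only [zero_add, F0, F1, F2, F3]
      constructor <;> linarith
    · rw [show k+1+3 = k+4 by ring, hF, show k+1+2 = k+3 by ring, show k+1+1=k+2 by ring]
      constructor <;> linarith
  | succ n ih =>
    intro a b c
    obtain ⟨V, V0, V1, V2, hV⟩ := ih a b c
    refine ⟨fun k => Nat.casesOn k (-((V 2 + A * V 1 + B * V 0) / C)) V, V0, V1, V2, fun k => ?_⟩
    rcases k with _ | k
    · show 0 ≤ V 2 + A * V 1 + B * V 0 + C * (-((V 2 + A * V 1 + B * V 0) / C)) ∧ V 2 + A * V 1 + B * V 0 + C * (-((V 2 + A * V 1 + B * V 0) / C)) < C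
      have h1 := Int.emod_nonneg (V 2 + A * V 1 + B * V 0) hC.ne'
      have h2 := Int.emod_lt_of_pos (V 2 + A * V 1 + B * V 0) hC
      have h3 := Int.emod_add_mul_ediv (V 2 + A * V 1 + B * V 0) C
      constructor <;> linarith
    · exact hV k

theorem tiles_dense {A B C : ℤ} {T : Set (Fin 3 → ℝ)} (hT : IsABCTile A B C T) (x : Fin 3 → ℝ) (ε : ℝ) (hε : 0 < ε) :
    ∃ y α, y ∈ tileTranslate (toR α) T ∧ dist x y < ε := by
  obtain ⟨R, hR0, hR⟩ := TRep.unif hT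
  have hA := hT.1
  have hB := hT.2.1
  have hC := hT.2.2.1
  have hC1 : 1 ≤ C := by omega
  have rA : (1:ℝ) ≤ A := by exact_mod_cast hA
  have rB : (A:ℝ) ≤ B := by exact_mod_cast hB
  have rC : (B:ℝ) ≤ C := by exact_mod_cast hC.le
  have lim := tendsto_kap hC1 ((1 + |(A:ℝ)| + |(B:ℝ)|) * (2 * (4*C+R)))
  obtain ⟨n, hn⟩ := (lim.eventually (gt_mem_nhds hε)).exists
  obtain ⟨V, V0, V1, V2, hV⟩ := back_ext A B (by omega : 0 < C) (4*n) ⌊orb A B C x (4*n)⌋ ⌊orb A B C x (4*n+1)⌋ ⌊orb A B C x (4*n+2)⌋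
  let F : ℕ → ℤ := fun k => ∑ i ∈ Finset.range k, V i
  have hF : ∀ k, F (k+1) - F k = V k := fun k => by simp [F, Finset.sum_range_succ]
  have hq : ∀ k, qq A B C F k = V (k+3) + A * V (k+2) + B * V (k+1) + C * V k := by
    intro k; rw [← hF, ← hF, ← hF, ← hF]; simp only [qq, add_assoc]; norm_num; ring
  have hadr : Adr A B C F := fun k => by rw [hq]; exact hV k
  obtain ⟨y, hy⟩ := hadr.rep hT
  refine ⟨y, _, hy.mem hT, ?_⟩
  refine (orb_close hT x y n (4*C+R) fun j hj => ?_).trans_lt (by rw [← mul_assoc]; exact hn)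
  have b := hR F y hy (4*n+j)
  rw [hF, abs_sub_comm] at b
  refine (abs_sub_le _ (V (4*n+j) : ℝ) _).trans (add_le_add ?_ b)
  have fl : ∀ r : ℝ, |r - ⌊r⌋| ≤ 1 := fun r => by
    rw [abs_of_nonneg (by linarith [Int.floor_le r])]
    linarith [Int.lt_floor_add_one r]
  have f0 : |orb A B C x (4*n) - V (4*n)| ≤ 1 := by rw [V0]; exact fl _
  have f1 : |orb A B C x (4*n+1) - V (4*n+1)| ≤ 1 := by rw [V1]; exact fl _
  have f2 : |orb A B C x (4*n+2) - V (4*n+2)| ≤ 1 := by rw [V2]; exact fl _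
  interval_cases j
  · rw [add_zero]; linarith
  · linarith
  · linarith
  · have h1 := orb_rec A B C x (4*n)
    have h2 := hV (4*n)
    have h3 : (0:ℝ) ≤ V (4*n+3) + A * V (4*n+2) + B * V (4*n+1) + C * V (4*n) := by exact_mod_cast h2.1
    have h4 : V (4*n+3) + A * V (4*n+2) + B * V (4*n+1) + C * V (4*n) ≤ (C:ℝ) := by exact_mod_cast h2.2.le
    simp only [pR] at h1
    rw [abs_le] at *
    constructor <;> nlinarith

def NbSeq (A B C : ℤ) (G : ℕ → ℤ) : Prop := BdInc G ∧ ∀ k, |qq A B C G k| < C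

def wz (A B a b c d : ℤ) : Fin 3 → ℤ :=
  ![(d - c) + A * (c - b) + B * (b - a), (c - b) + A * (b - a), b - a]

theorem win_eq_wz (A B : ℤ) (F : ℕ → ℤ) : win A B F = wz A B (F 0) (F 1) (F 2) (F 3) := rfl

theorem wz_inj {A B a b c d a' b' c' d' : ℤ} (h : wz A B a b c d = wz A B a' b' c' d') :
    b' = b + (a' - a) ∧ c' = c + (a' - a) ∧ d' = d + (a' - a) := by
  have h0 := congrFun h 0
  have h1 := congrFun h 1
  have h2 := congrFun h 2
  simp [wz] at h0 h1 h2
  have e : b' = b + (a' - a) := by linarith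
  rw [h2] at h0 h1
  have e2 : c' = c + (a' - a) := by linarith
  refine ⟨e, e2, ?_⟩
  have e3 : c' - b' = c - b := by linarith
  rw [e3] at h0
  linarith

theorem wz_ne_zero {A B a b c d : ℤ} (h : ¬ (b = a ∧ c = a ∧ d = a)) : wz A B a b c d ≠ 0 := by
  intro h0
  have : wz A B a b c d = wz A B a a a a := by
    rw [h0]; ext i; fin_cases i <;> simp [wz]
  have := wz_inj this
  apply h; omega

theorem tileTranslate_zero (T : Set (Fin 3 → ℝ)) : tileTranslate (toR 0) T = T := by
  have : toR 0 = 0 := by ext i; simp [toR]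
  simp [tileTranslate, this]

theorem BdInc.sub {F G : ℕ → ℤ} (hF : BdInc F) (hG : BdInc G) : BdInc (fun n => F n - G n) := by
  obtain ⟨R, h⟩ := hF
  obtain ⟨R', h'⟩ := hG
  refine ⟨R + R', fun k => ?_⟩
  have := abs_sub (F (k+1) - F k) (G (k+1) - G k)
  rw [show F (k+1) - G (k+1) - (F k - G k) = (F (k+1) - F k) - (G (k+1) - G k) by ring]
  exact this.trans (add_le_add (h k) (h' k))

theorem BdInc.of_bdd {G : ℕ → ℤ} (c R : ℤ) (h : ∀ k, c ≤ G k ∧ G k ≤ c + R) : BdInc G := by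
  refine ⟨R, fun k => ?_⟩
  have h1 := h k
  have h2 := h (k+1)
  rw [abs_le]; constructor <;> linarith

theorem NbSeq.of_adr {A B C : ℤ} {F F' : ℕ → ℤ} (h : Adr A B C F) (h' : Adr A B C F')
    (hb : BdInc (fun n => F' n - F n)) : NbSeq A B C (fun n => F' n - F n) := by
  refine ⟨hb, fun k => ?_⟩
  rw [qq_sub, abs_lt]
  have := h k
  have := h' k
  constructor <;> linarith

theorem NbSeq.of_rep {A B C : ℤ} {F F' : ℕ → ℤ} {x} (h : TRep A B C F x) (h' : TRep A B C F' x) :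
    NbSeq A B C (fun n => F' n - F n) := NbSeq.of_adr h.1 h'.1 (h.bd h')

theorem NbSeq.shift {A B C : ℤ} {G : ℕ → ℤ} (h : NbSeq A B C G) (n : ℕ) : NbSeq A B C (fun k => G (n+k)) := by
  obtain ⟨⟨R, h1⟩, h2⟩ := h
  exact ⟨⟨R, fun k => h1 (n+k)⟩, fun k => h2 (n+k)⟩

theorem exists_digits (A B C w0 w1 w2 w3 : ℤ) (d : ℕ → ℤ) :
    ∃ F : ℕ → ℤ, F 0 = w0 ∧ F 1 = w1 ∧ F 2 = w2 ∧ F 3 = w3 ∧ ∀ k, qq A B C F k = d k := by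
  obtain ⟨F, F0, F1, F2, F3, hF⟩ := rec4 w0 w1 w2 w3
    (fun k a b c e => d k - ((A-1) * e + (B-A) * c + (C-B)*b - C * a))
  exact ⟨F, F0, F1, F2, F3, fun k => by simp only [qq, hF]; ring⟩

theorem NbSeq.mem_nb {A B C : ℤ} {T : Set (Fin 3 → ℝ)} (hT : IsABCTile A B C T) {G : ℕ → ℤ}
    (h : NbSeq A B C G) (h0 : ¬ (G 1 = G 0 ∧ G 2 = G 0 ∧ G 3 = G 0)) :
    wz A B (G 0) (G 1) (G 2) (G 3) ∈ Neighbors T := by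
  obtain ⟨F, F0, F1, F2, F3, hF⟩ := exists_digits A B C 0 0 0 0 (fun k => max 0 (-qq A B C G k))
  have hq : ∀ k, -C < qq A B C G k ∧ qq A B C G k < C := fun k => abs_lt.mp (h.2 k)
  have hA : Adr A B C F := fun k => by
    rw [hF]; have := hq k; constructor <;> omega
  have hA' : Adr A B C (fun n => F n + G n) := fun k => by
    rw [qq_add, hF]; have := hq k; constructor <;> omega
  obtain ⟨x, hx⟩ := hA.rep hT
  have hx' : TRep A B C (fun n => F n + G n) x := hx.of_bd hA' (by simpa using h.1)
  refine ⟨wz_ne_zero h0, x, ?_, ?_⟩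
  · have := hx.mem hT
    rw [win_eq_wz, F0, F1, F2, F3, show wz A B 0 0 0 0 = 0 by ext i; fin_cases i <;> simp [wz], tileTranslate_zero] at this
    exact this
  · have := hx'.mem hT
    rw [win_eq_wz, F0, F1, F2, F3] at this
    simpa using this

theorem qq_periodic {A B C : ℤ} (w : ℕ → ℤ)
    (h0 : |w 0 * (1-C) + (A-1) * w 3 + (B-A) * w 2 + (C-B) * w 1| < C)
    (h1 : |w 1 * (1-C) + (A-1) * w 0 + (B-A) * w 3 + (C-B) * w 2| < C)
    (h2 : |w 2 * (1-C) + (A-1) * w 1 + (B-A) * w 0 + (C-B) * w 3| < C)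
    (h3 : |w 3 * (1-C) + (A-1) * w 2 + (B-A) * w 1 + (C-B) * w 0| < C) (R : ℤ)
    (hw : ∀ j < 4, 0 ≤ w j ∧ w j ≤ R) :
    NbSeq A B C (fun k => w (k % 4)) := by
  refine ⟨BdInc.of_bdd 0 R fun k => by simpa using hw (k%4) (Nat.mod_lt _ (by norm_num)), fun k => ?_⟩
  simp only [qq]
  have h4 : k % 4 = 0 ∨ k % 4 = 1 ∨ k % 4 = 2 ∨ k % 4 = 3 := by omega
  rcases h4 with h | h | h | h
  · rw [show (k+4)%4=0 by omega, show (k+3)%4 = 3 by omega, show (k+2)%4=2 by omega, show (k+1)%4=1 by omega, h]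
    convert h0 using 2; ring
  · rw [show (k+4)%4=1 by omega, show (k+3)%4 = 0 by omega, show (k+2)%4=3 by omega, show (k+1)%4=2 by omega, h]
    convert h1 using 2; ring
  · rw [show (k+4)%4=2 by omega, show (k+3)%4 = 1 by omega, show (k+2)%4=0 by omega, show (k+1)%4=3 by omega, h]
    convert h2 using 2; ring
  · rw [show (k+4)%4=3 by omega, show (k+3)%4 = 2 by omega, show (k+2)%4=1 by omega, show (k+1)%4=0 by omega, h]
    convert h3 using 2; ring

/-- the 14 standard neighbours -/
def bwin : Finset (Fin 4 → Fin 2) := Finset.univ.filter (fun w => ¬ (w 1 = w 0 ∧ w 2 = w 0 ∧ w 3 = w 0))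

theorem bwin_card : bwin.card = 14 := by decide

def bz (A B : ℤ) (w : Fin 4 → Fin 2) : Fin 3 → ℤ :=
  wz A B ((w 0).val : ℤ) ((w 1).val : ℤ) ((w 2).val : ℤ) ((w 3).val : ℤ)

theorem bin_ineq {A B C : ℤ} (hA : 1 ≤ A) (hB : A ≤ B) (hC : B < C) (a b c d : ℤ)
    (ha : a = 0 ∨ a = 1) (hb : b = 0 ∨ b = 1) (hc : c = 0 ∨ c = 1) (hd : d = 0 ∨ d = 1) :
    |a * (1-C) + (A-1) * d + (B-A) * c + (C-B) * b| < C := by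
  rw [abs_lt]
  rcases ha with rfl | rfl <;> rcases hb with rfl | rfl <;> rcases hc with rfl | rfl <;> rcases hd with rfl | rfl <;>
    constructor <;> linarith

theorem bz_mem {A B C : ℤ} {T : Set (Fin 3 → ℝ)} (hT : IsABCTile A B C T) {w : Fin 4 → Fin 2} (hw : w ∈ bwin) :
    bz A B w ∈ Neighbors T := by
  obtain ⟨hA, hB, hC, -⟩ := id hT
  have b01 : ∀ i, ((w i).val : ℤ) = 0 ∨ ((w i).val : ℤ) = 1 := fun i => by have := (w i).isLt; omega
  let v : ℕ → ℤ := fun k => if k = 0 then ((w 0).val : ℤ) else if k = 1 then ((w 1).val : ℤ) else if k = 2 then ((w 2).val : ℤ) else ((w 3).val : ℤ)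
  have hv : ∀ k, v k = 0 ∨ v k = 1 := by
    intro k; simp only [v]; split_ifs <;> exact b01 _
  have := qq_periodic (A := A) (B := B) (C := C) v (bin_ineq hA hB hC _ _ _ _ (hv _) (hv _) (hv _) (hv _))
    (bin_ineq hA hB hC _ _ _ _ (hv _) (hv _) (hv _) (hv _)) (bin_ineq hA hB hC _ _ _ _ (hv _) (hv _) (hv _) (hv _))
    (bin_ineq hA hB hC _ _ _ _ (hv _) (hv _) (hv _) (hv _)) 1 (fun j _ => by have := hv j; omega)
  refine this.mem_nb hT ?_
  simp only [bwin, Finset.mem_filter, Finset.mem_univ, true_and] at hw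
  intro h
  apply hw
  simp [v] at h
  refine ⟨Fin.ext (by omega), Fin.ext (by omega), Fin.ext (by omega)⟩

theorem bz_inj (A B : ℤ) : Set.InjOn (bz A B) (bwin : Set (Fin 4 → Fin 2)) := by
  intro w hw w' hw' h
  simp only [bwin, Finset.coe_filter, Finset.mem_univ, true_and, Set.mem_ofPred_eq, Fin.ext_iff] at hw hw'
  have := wz_inj h
  have l0 := (w 0).isLt
  have l1 := (w 1).isLt
  have l2 := (w 2).isLt
  have l3 := (w 3).isLt
  have l0' := (w' 0).isLt
  have l1' := (w' 1).isLt
  have l2' := (w' 2).isLt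
  have l3' := (w' 3).isLt
  ext i
  fin_cases i <;> simp <;> omega

theorem nb_eq {A B C : ℤ} {T : Set (Fin 3 → ℝ)} (hT : IsABCTile A B C T) (h14 : (Neighbors T).ncard = 14) :
    Neighbors T = bz A B '' (bwin : Set (Fin 4 → Fin 2)) := by
  symm
  have hfin : (Neighbors T).Finite := Set.finite_of_ncard_ne_zero (by rw [h14]; norm_num)
  apply Set.eq_of_subset_of_ncard_le _ _ hfin
  · rintro _ ⟨w, hw, rfl⟩
    exact bz_mem hT hw
  · rw [h14, Set.InjOn.ncard_image (bz_inj A B), Set.ncard_coe_finset, bwin_card]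

/-- standing hypotheses -/
structure Std (A B C : ℤ) (T : Set (Fin 3 → ℝ)) : Prop where
  hT : IsABCTile A B C T
  nb : Neighbors T = bz A B '' (bwin : Set (Fin 4 → Fin 2))
  hA : 1 ≤ A
  hB : A < B
  hC : B < C

theorem NbSeq.bin0 {A B C : ℤ} {T : Set (Fin 3 → ℝ)} (hT : IsABCTile A B C T)
    (hnb : Neighbors T = bz A B '' (bwin : Set (Fin 4 → Fin 2))) {G : ℕ → ℤ} (h : NbSeq A B C G)
    (h0 : ¬ (G 1 = G 0 ∧ G 2 = G 0 ∧ G 3 = G 0)) : ∃ m, ∀ j < 4, m ≤ G j ∧ G j ≤ m + 1 := by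
  have := h.mem_nb hT h0
  rw [hnb] at this
  obtain ⟨w, hw, he⟩ := this
  have hh := wz_inj he
  have l0 := (w 0).isLt
  have l1 := (w 1).isLt
  have l2 := (w 2).isLt
  have l3 := (w 3).isLt
  refine ⟨G 0 - (w 0).val, fun j hj => ?_⟩
  interval_cases j <;> constructor <;> omega

theorem std_of {A B C : ℤ} {T : Set (Fin 3 → ℝ)} (hT : IsABCTile A B C T) (h14 : (Neighbors T).ncard = 14) :
    Std A B C T := by
  obtain ⟨hA, hB, hC, -⟩ := id hT
  refine ⟨hT, nb_eq hT h14, hA, ?_, hC⟩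
  rcases hB.lt_or_eq with h | h
  · exact h
  exfalso
  subst h
  have key := qq_periodic (A := A) (B := A) (C := C) (fun k => if k = 0 then 0 else if k = 2 then 2 else 1)
    (by simp; rw [abs_lt]; constructor <;> linarith) (by simp; rw [abs_lt]; constructor <;> linarith)
    (by simp; rw [abs_lt]; constructor <;> linarith) (by simp; rw [abs_lt]; constructor <;> linarith) 2
    (fun j _ => by split_ifs <;> norm_num)
  obtain ⟨m, hm⟩ := key.bin0 hT (nb_eq hT h14) (by simp)
  have a := hm 0 (by norm_num)
  have b := hm 2 (by norm_num)
  simp at a b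
  omega

theorem NbSeq.persist {A B C : ℤ} (hC : 0 < C) {G : ℕ → ℤ} (h : NbSeq A B C G)
    (h0 : ¬ (G 1 = G 0 ∧ G 2 = G 0 ∧ G 3 = G 0)) (k : ℕ) :
    ¬ (G (k+1) = G k ∧ G (k+2) = G k ∧ G (k+3) = G k) := by
  induction k with
  | zero => simpa using h0
  | succ k ih =>
    rintro ⟨h1, h2, h3⟩
    rw [show k+1+1 = k+2 by ring] at h1
    rw [show k+1+2 = k+3 by ring] at h2
    rw [show k+1+3 = k+4 by ring] at h3
    have := h.2 k
    simp only [qq] at this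
    rw [h1, h2, h3, show G (k+1) + (A-1) * G (k+1) + (B-A) * G (k+1) + (C-B) * G (k+1) - C * G k = C * (G (k+1) - G k) by ring,
      abs_mul, abs_of_pos hC] at this
    have h5 : |G (k+1) - G k| < 1 := by
      by_contra h; push Not at h; nlinarith
    have h6 := Int.abs_lt_one_iff.mp h5
    apply ih; omega

theorem NbSeq.bin {A B C : ℤ} {T : Set (Fin 3 → ℝ)} (S : Std A B C T) {G : ℕ → ℤ} (h : NbSeq A B C G)
    (h0 : ¬ (G 1 = G 0 ∧ G 2 = G 0 ∧ G 3 = G 0)) : ∃ m, ∀ k, m ≤ G k ∧ G k ≤ m + 1 := by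
  have hp := h.persist (by have := S.hA; have := S.hB; have := S.hC; omega) h0
  have hb : ∀ k, ∃ m, ∀ j < 4, m ≤ G (k+j) ∧ G (k+j) ≤ m + 1 := fun k =>
    (h.shift k).bin0 S.hT S.nb (by simpa using hp k)
  obtain ⟨m, hm⟩ := h.bin0 S.hT S.nb h0
  refine ⟨m, ?_⟩
  have key : ∀ k, ∀ j < 4, m ≤ G (k+j) ∧ G (k+j) ≤ m + 1 := by
    intro k
    induction k with
    | zero => simpa using hm
    | succ k ih =>
      have i0 := ih 0 (by norm_num)
      have i1 := ih 1 (by norm_num)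
      have i2 := ih 2 (by norm_num)
      have i3 := ih 3 (by norm_num)
      obtain ⟨m', hm'⟩ := hb (k+1)
      have j0 := hm' 0 (by norm_num)
      have j1 := hm' 1 (by norm_num)
      have j2 := hm' 2 (by norm_num)
      have j3 := hm' 3 (by norm_num)
      rw [show k+1+1 = k+2 by ring] at j1
      rw [show k+1+2 = k+3 by ring] at j2
      rw [show k+1+3 = k+4 by ring] at j3
      rw [add_zero] at i0 j0
      have p0 := hp k
      have p1 := hp (k+1)
      rw [show k+1+1 = k+2 by ring, show k+1+2 = k+3 by ring, show k+1+3 = k+4 by ring] at p1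
      have g4 : m ≤ G (k+4) ∧ G (k+4) ≤ m + 1 := by
        by_cases hc : G (k+2) = G (k+1) ∧ G (k+3) = G (k+1)
        · have hq := abs_lt.mp (h.2 k)
          simp only [qq] at hq
          rw [hc.1, hc.2] at hq
          have e : G (k+4) + (A-1) * G (k+1) + (B-A) * G (k+1) + (C-B) * G (k+1) - C * G k =
            (G (k+4) - G (k+1)) + C * (G (k+1) - G k) := by ring
          rw [e] at hq
          have n1 : G (k+1) - G k = 1 ∨ G (k+1) - G k = -1 := by omega
          have n2 : G (k+4) - G (k+1) = 1 ∨ G (k+4) - G (k+1) = -1 := by omega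
          rcases n1 with n1 | n1 <;> rw [n1] at hq <;> omega
        · omega
      intro j hj
      interval_cases j
      · exact i1
      · rw [show k+1+1 = k+2 by ring]; exact i2
      · rw [show k+1+2 = k+3 by ring]; exact i3
      · rw [show k+1+3 = k+4 by ring]; exact g4
  intro k; simpa using key k 0 (by norm_num)

/-- if the first window is constant then the whole difference is constant -/
theorem NbSeq.nonconst_of {A B C : ℤ} {G : ℕ → ℤ} (hC : 0 < C) (h : NbSeq A B C G) (k : ℕ)
    (h0 : ¬ (G (k+1) = G k ∧ G (k+2) = G k ∧ G (k+3) = G k)) (n : ℕ) (hn : k ≤ n) :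
    ¬ (G (n+1) = G n ∧ G (n+2) = G n ∧ G (n+3) = G n) := by
  have := (h.shift k).persist hC (by simpa using h0) (n-k)
  rw [show k + (n-k+1) = n+1 by omega, show k+(n-k+2) = n+2 by omega, show k+(n-k+3) = n+3 by omega, show k+(n-k)=n by omega] at this
  exact this

theorem toR_closed : Topology.IsClosedEmbedding toR :=
  Topology.IsClosedEmbedding.piMap (fun _ : Fin 3 => Int.isClosedEmbedding_coe_real)

open scoped Pointwise in
theorem tiles_closed {T : Set (Fin 3 → ℝ)} (hT : IsCompact T) (S : Set (Fin 3 → ℤ)) :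
    IsClosed (⋃ β ∈ S, tileTranslate (toR β) T) := by
  have h : IsClosed (toR '' S) := toR_closed.isClosedMap _ (isClosed_discrete S)
  have h2 := h.add_left_of_isCompact hT
  convert h2 using 1
  ext y
  simp only [Set.mem_iUnion, tileTranslate, Set.mem_image, Set.mem_add, exists_prop]
  constructor
  · rintro ⟨β, hβ, x, hx, rfl⟩; exact ⟨x, hx, _, ⟨β, hβ, rfl⟩, rfl⟩
  · rintro ⟨x, hx, _, ⟨β, hβ, rfl⟩, rfl⟩; exact ⟨β, hβ, x, hx, rfl⟩

theorem tiles_avoid {T : Set (Fin 3 → ℝ)} (hT : IsCompact T) (S : Set (Fin 3 → ℤ)) (x : Fin 3 → ℝ)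
    (hx : ∀ β ∈ S, x ∉ tileTranslate (toR β) T) :
    ∃ ε > 0, ∀ y, dist y x < ε → ∀ β ∈ S, y ∉ tileTranslate (toR β) T := by
  have h := (tiles_closed hT S).isOpen_compl
  rw [Metric.isOpen_iff] at h
  obtain ⟨ε, h0, h1⟩ := h x (by simpa using hx)
  refine ⟨ε, h0, fun y hy => ?_⟩
  have := h1 (show y ∈ Metric.ball x ε from hy)
  simpa using this

/-- nonconstant windows -/
def NC (G : ℕ → ℤ) : Prop := ∀ k, ¬ (G (k+1) = G k ∧ G (k+2) = G k ∧ G (k+3) = G k)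

def ZWin (F : ℕ → ℤ) : Prop := F 0 = 0 ∧ F 1 = 0 ∧ F 2 = 0 ∧ F 3 = 0

theorem zero_rep {A B C : ℤ} {T : Set (Fin 3 → ℝ)} (hT : IsABCTile A B C T) {x} (hx : x ∈ T) :
    ∃ F, ZWin F ∧ TRep A B C F x := by
  rw [← tileTranslate_zero T] at hx
  obtain ⟨F, F0, hF, hw⟩ := exists_rep hT hx
  refine ⟨F, ?_, hF⟩
  rw [win_eq_wz, show (0: Fin 3 → ℤ) = wz A B 0 0 0 0 by ext i; fin_cases i <;> simp [wz]] at hw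
  have := wz_inj hw
  refine ⟨F0, ?_, ?_, ?_⟩ <;> omega

theorem ZWin.mem {A B C : ℤ} {T : Set (Fin 3 → ℝ)} (hT : IsABCTile A B C T) {F x} (h : ZWin F)
    (hx : TRep A B C F x) : x ∈ T := by
  have := hx.mem hT
  obtain ⟨F0, F1, F2, F3⟩ := h
  rw [win_eq_wz, F0, F1, F2, F3, show wz A B 0 0 0 0 = 0 by ext i; fin_cases i <;> simp [wz], tileTranslate_zero] at this
  exact this

theorem ZWin.mem' {A B C : ℤ} {T : Set (Fin 3 → ℝ)} (hT : IsABCTile A B C T) {F G : ℕ → ℤ} {x} (h : ZWin F)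
    (hx : TRep A B C (fun n => F n + G n) x) : x ∈ tileTranslate (toR (wz A B (G 0) (G 1) (G 2) (G 3))) T := by
  have := hx.mem hT
  obtain ⟨F0, F1, F2, F3⟩ := h
  rw [win_eq_wz, F0, F1, F2, F3] at this
  simpa using this

theorem Std.Cpos {A B C : ℤ} {T : Set (Fin 3 → ℝ)} (S : Std A B C T) : 0 < C := by
  have := S.hA; have := S.hB; have := S.hC; omega

/-- any other tile through x is a binary perturbation -/
theorem pair_bin {A B C : ℤ} {T : Set (Fin 3 → ℝ)} (S : Std A B C T) {F x} (hF : TRep A B C F x) (h0 : ZWin F)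
    {α : Fin 3 → ℤ} (hα : α ≠ 0) (hx : x ∈ tileTranslate (toR α) T) :
    ∃ G, TRep A B C (fun n => F n + G n) x ∧ (∀ k, 0 ≤ G k ∧ G k ≤ 1) ∧ NC G ∧ NbSeq A B C G ∧
      wz A B (G 0) (G 1) (G 2) (G 3) = α := by
  obtain ⟨F', F'0, hF', hw⟩ := exists_rep S.hT hx
  obtain ⟨z0, z1, z2, z3⟩ := h0
  have hnb := NbSeq.of_rep hF hF'
  have hnc : ¬ (F' 1 - F 1 = F' 0 - F 0 ∧ F' 2 - F 2 = F' 0 - F 0 ∧ F' 3 - F 3 = F' 0 - F 0) := by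
    rintro ⟨a, b, c⟩
    apply hα
    rw [← hw, win_eq_wz]
    have e1 : F' 1 = 0 := by omega
    have e2 : F' 2 = 0 := by omega
    have e3 : F' 3 = 0 := by omega
    rw [F'0, e1, e2, e3]; ext i; fin_cases i <;> simp [wz]
  obtain ⟨m, hm⟩ := hnb.bin S hnc
  have hp := hnb.persist S.Cpos hnc
  refine ⟨fun n => F' n - F n - m, ?_, fun k => ?_, fun k => ?_, ⟨?_, ?_⟩, ?_⟩
  · have := hF'.addc (-m)
    convert this using 2; ring
  · have := hm k; constructor <;> dsimp only <;> omega
  · have := hp k; dsimp only; omega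
  · obtain ⟨R, h⟩ := hnb.1
    refine ⟨R, fun k => ?_⟩
    have := h k
    rwa [show F' (k+1) - F (k+1) - m - (F' k - F k - m) = F' (k+1) - F (k+1) - (F' k - F k) by ring]
  · intro k; rw [qq_subc]; exact hnb.2 k
  · rw [← hw, win_eq_wz]
    simp only [wz, z0, z1, z2, z3]
    ext i; fin_cases i <;> simp

theorem NC.upstep {G : ℕ → ℤ} (h : NC G) (hb : ∀ k, 0 ≤ G k ∧ G k ≤ 1) (n : ℕ) :
    ∃ k ≥ n, G k = 0 ∧ G (k+1) = 1 := by
  by_contra hc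
  push Not at hc
  have h1 : ∀ k ≥ n, G k = 0 → ∀ j, G (k+j) = 0 := by
    intro k hk h0 j
    induction j with
    | zero => exact h0
    | succ j ih =>
      have := hc (k+j) (by omega) ih
      have := hb (k+j+1)
      rw [← add_assoc]; omega
  have h2 : ∃ k ≥ n, G k = 0 := by
    have a := h n
    have := hb n
    have := hb (n+1)
    have := hb (n+2)
    have := hb (n+3)
    by_contra hh
    push Not at hh
    have := hh n (by omega)
    have := hh (n+1) (by omega)
    have := hh (n+2) (by omega)
    have := hh (n+3) (by omega)
    omega
  obtain ⟨k, hk, hk0⟩ := h2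
  apply h k
  rw [h1 k hk hk0, h1 k hk hk0, h1 k hk hk0, hk0]; simp

theorem digits_agree {A B C : ℤ} {F F' : ℕ → ℤ} (n : ℕ) (h0 : F 0 = F' 0) (h1 : F 1 = F' 1) (h2 : F 2 = F' 2) (h3 : F 3 = F' 3)
    (h : ∀ k < n, qq A B C F k = qq A B C F' k) : ∀ k < n + 4, F k = F' k := by
  intro k
  induction k using Nat.strong_induction_on with
  | _ k ih =>
    match k, ih with
    | 0, _ => exact fun _ => h0
    | 1, _ => exact fun _ => h1
    | 2, _ => exact fun _ => h2
    | 3, _ => exact fun _ => h3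
    | k+4, ih =>
      intro hk
      have := h k (by omega)
      simp only [qq] at this
      rw [ih k (by omega) (by omega), ih (k+1) (by omega) (by omega), ih (k+2) (by omega) (by omega), ih (k+3) (by omega) (by omega)] at this
      linarith

theorem mem_frontier_of_nb {A B C : ℤ} {T : Set (Fin 3 → ℝ)} (S : Std A B C T) {x α} (hx : x ∈ T)
    (hα : α ≠ 0) (hx' : x ∈ tileTranslate (toR α) T) : x ∈ frontier T := by
  have hcl : IsClosed T := S.hT.2.2.2.2.1.isClosed
  rw [hcl.frontier_eq]
  refine ⟨hx, fun hi => ?_⟩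
  rw [mem_interior_iff_mem_nhds, Metric.mem_nhds_iff] at hi
  obtain ⟨ε, hε, hb⟩ := hi
  obtain ⟨n, hn⟩ := TRep.close S.hT ε hε
  obtain ⟨F', F'0, hF', hw⟩ := exists_rep S.hT hx'
  obtain ⟨F2, a0, a1, a2, a3, hq⟩ := exists_digits A B C (F' 0) (F' 1) (F' 2) (F' 3) (fun k => if k < n then qq A B C F' k else 0)
  have hadr : Adr A B C F2 := fun k => by
    rw [hq]; split_ifs
    · exact hF'.1 k
    · exact ⟨le_rfl, S.Cpos⟩
  obtain ⟨y, hy⟩ := hadr.rep S.hT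
  have hag := digits_agree (A := A) (B := B) (C := C) n a0 a1 a2 a3 (fun k hk => by rw [hq]; simp [hk])
  have hd : dist y x < ε := hn F2 F' y x hy hF' (fun k hk => hag k (by omega))
  have hyT : y ∈ T := hb hd
  obtain ⟨F, hz, hF⟩ := zero_rep S.hT hyT
  have hy' : y ∈ tileTranslate (toR α) T := by
    have := hy.mem S.hT
    rw [win_eq_wz, a0, a1, a2, a3, ← win_eq_wz, hw] at this; exact this
  have hnb := NbSeq.of_rep hF hy
  obtain ⟨z0, z1, z2, z3⟩ := hz
  have hnc : ¬ (F2 1 - F 1 = F2 0 - F 0 ∧ F2 2 - F 2 = F2 0 - F 0 ∧ F2 3 - F 3 = F2 0 - F 0) := by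
    rintro ⟨a, b, c⟩
    apply hα
    rw [← hw, win_eq_wz]
    have e1 : F' 1 = 0 := by omega
    have e2 : F' 2 = 0 := by omega
    have e3 : F' 3 = 0 := by omega
    rw [F'0, e1, e2, e3]; ext i; fin_cases i <;> simp [wz]
  obtain ⟨m, hm⟩ := hnb.bin S hnc
  have hp := hnb.persist S.Cpos hnc
  obtain ⟨k, hk, g0, g1⟩ := NC.upstep (G := fun n => F2 n - F n - m) (fun k => by have := hp k; dsimp only; omega)
    (fun k => by have := hm k; constructor <;> omega) n
  have e := qq_sub A B C F2 F k
  have e2 := qq_subc A B C (fun n => F2 n - F n) m k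
  rw [e, hq, if_neg (by omega)] at e2
  have f := (hF.1 k).1
  simp only [qq] at e2
  have m2 := hm (k+2)
  have m3 := hm (k+3)
  have m4 := hm (k+4)
  rw [g0, g1] at e2
  have t1 : 0 ≤ (A-1) * (F2 (k+3) - F (k+3) - m) := mul_nonneg (by linarith [S.hA]) (by linarith)
  have t2 : 0 ≤ (B-A) * (F2 (k+2) - F (k+2) - m) := mul_nonneg (by linarith [S.hB]) (by linarith)
  have := S.hC
  simp only [qq] at f
  linarith

theorem frontier_subset {A B C : ℤ} {T : Set (Fin 3 → ℝ)} (hT : IsABCTile A B C T) {x} (hx : x ∈ frontier T) :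
    ∃ β ≠ 0, x ∈ tileTranslate (toR β) T := by
  by_contra hc
  push Not at hc
  have hcl : IsClosed T := hT.2.2.2.2.1.isClosed
  obtain ⟨ε, h0, h1⟩ := tiles_avoid hT.2.2.2.2.1 {β | β ≠ 0} x hc
  apply hx.2
  rw [mem_interior_iff_mem_nhds, Metric.mem_nhds_iff]
  refine ⟨ε, h0, fun y hy => ?_⟩
  rw [← hcl.closure_eq, Metric.mem_closure_iff]
  intro δ hδ
  rw [Metric.mem_ball] at hy
  obtain ⟨z, β, hz, hd⟩ := tiles_dense hT y (min δ (ε - dist y x)) (lt_min hδ (by linarith))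
  refine ⟨z, ?_, hd.trans_le (min_le_left _ _)⟩
  have h2 : dist z x < ε := by
    have := dist_triangle z y x
    have := hd.trans_le (min_le_right _ _)
    rw [dist_comm z y] at *
    linarith
  by_cases hβ : β = 0
  · rw [hβ, tileTranslate_zero] at hz; exact hz
  · exact absurd hz (h1 z h2 β hβ)

def Alt (A B C a b c d : ℤ) : Prop := ∃ H : ℕ → ℤ, H 0 = a ∧ H 1 = b ∧ H 2 = c ∧ H 3 = d ∧
  (∀ k, 0 ≤ H k ∧ H k ≤ 1) ∧ (∀ k, |qq A B C H k| < C) ∧ ∃ n, ∀ k ≥ n, H (k+2) = H k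

theorem Alt.step {A B C a b c d : ℤ} (e : ℤ) (h : Alt A B C b c d e) (ha : 0 ≤ a ∧ a ≤ 1)
    (hq : |e + (A-1) * d + (B-A) * c + (C-B) * b - C * a| < C) : Alt A B C a b c d := by
  obtain ⟨H, h0, h1, h2, h3, hb, hH, n, hn⟩ := h
  refine ⟨fun k => Nat.casesOn k a H, rfl, h0, h1, h2, fun k => ?_, fun k => ?_, n+1, fun k hk => ?_⟩
  · rcases k with _ | k
    · exact ha
    · exact hb k
  · rcases k with _ | k
    · show |H 3 + (A-1) * H 2 + (B-A) * H 1 + (C-B) * H 0 - C * a| < C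
      rw [h0, h1, h2, h3]; exact hq
    · exact hH k
  · rcases k with _ | k
    · omega
    · exact hn k (by omega)

theorem alt_base {A B C : ℤ} (hA : 1 ≤ A) (hB : A < B) (hC : B < C) : Alt A B C 0 1 0 1 := by
  refine ⟨fun k => ((k % 2 : ℕ) : ℤ), by simp, by simp, by simp, by simp, fun k => by dsimp only; omega, fun k => ?_, 0, fun k _ => by simp⟩
  simp only [qq]
  rcases Nat.mod_two_eq_zero_or_one k with h | h
  · rw [show (k+4)%2 = 0 by omega, show (k+3)%2=1 by omega, show (k+2)%2=0 by omega, show (k+1)%2=1 by omega, h, abs_lt]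
    push_cast; constructor <;> linarith
  · rw [show (k+4)%2 = 1 by omega, show (k+3)%2=0 by omega, show (k+2)%2=1 by omega, show (k+1)%2=0 by omega, h, abs_lt]
    push_cast; constructor <;> linarith

theorem alt_base' {A B C : ℤ} (hA : 1 ≤ A) (hB : A < B) (hC : B < C) : Alt A B C 1 0 1 0 := by
  refine ⟨fun k => (((k+1) % 2 : ℕ) : ℤ), by simp, by simp, by simp, by simp, fun k => by dsimp only; omega, fun k => ?_, 0, fun k _ => by
    dsimp only; omega⟩
  simp only [qq]
  rcases Nat.mod_two_eq_zero_or_one k with h | h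
  · rw [show (k+4+1)%2 = 1 by omega, show (k+3+1)%2=0 by omega, show (k+2+1)%2=1 by omega, show (k+1+1)%2=0 by omega, show (k+1)%2=1 by omega, abs_lt]
    push_cast; constructor <;> linarith
  · rw [show (k+4+1)%2 = 0 by omega, show (k+3+1)%2=1 by omega, show (k+2+1)%2=0 by omega, show (k+1+1)%2=1 by omega, show (k+1)%2=0 by omega, abs_lt]
    push_cast; constructor <;> linarith

theorem alt_all {A B C : ℤ} (hA : 1 ≤ A) (hB : A < B) (hC : B < C) (a b c d : ℤ)
    (ha : 0 ≤ a ∧ a ≤ 1) (hb : 0 ≤ b ∧ b ≤ 1) (hc : 0 ≤ c ∧ c ≤ 1) (hd : 0 ≤ d ∧ d ≤ 1)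
    (hn : ¬ (b = a ∧ c = a ∧ d = a)) : Alt A B C a b c d := by
  have z : (0:ℤ) ≤ 0 ∧ (0:ℤ) ≤ 1 := by norm_num
  have o : (0:ℤ) ≤ 1 ∧ (1:ℤ) ≤ 1 := by norm_num
  have p0101 := alt_base hA hB hC
  have p1010 := alt_base' hA hB hC
  have p0010 : Alt A B C 0 0 1 0 := p0101.step 1 z (by rw [abs_lt]; constructor <;> linarith)
  have p0001 : Alt A B C 0 0 0 1 := p0010.step 0 z (by rw [abs_lt]; constructor <;> linarith)
  have p1000 : Alt A B C 1 0 0 0 := p0001.step 1 o (by rw [abs_lt]; constructor <;> linarith)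
  have p0100 : Alt A B C 0 1 0 0 := p1000.step 0 z (by rw [abs_lt]; constructor <;> linarith)
  have p1101 : Alt A B C 1 1 0 1 := p1010.step 0 o (by rw [abs_lt]; constructor <;> linarith)
  have p1110 : Alt A B C 1 1 1 0 := p1101.step 1 o (by rw [abs_lt]; constructor <;> linarith)
  have p0111 : Alt A B C 0 1 1 1 := p1110.step 0 z (by rw [abs_lt]; constructor <;> linarith)
  have p1011 : Alt A B C 1 0 1 1 := p0111.step 1 o (by rw [abs_lt]; constructor <;> linarith)
  have p1100 : Alt A B C 1 1 0 0 := p1000.step 0 o (by rw [abs_lt]; constructor <;> linarith)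
  have p0110 : Alt A B C 0 1 1 0 := p1100.step 0 z (by rw [abs_lt]; constructor <;> linarith)
  have p0011 : Alt A B C 0 0 1 1 := p0110.step 0 z (by rw [abs_lt]; constructor <;> linarith)
  have p1001 : Alt A B C 1 0 0 1 := p0011.step 1 o (by rw [abs_lt]; constructor <;> linarith)
  have a' : a = 0 ∨ a = 1 := by omega
  have b' : b = 0 ∨ b = 1 := by omega
  have c' : c = 0 ∨ c = 1 := by omega
  have d' : d = 0 ∨ d = 1 := by omega
  rcases a' with rfl | rfl <;> rcases b' with rfl | rfl <;> rcases c' with rfl | rfl <;> rcases d' with rfl | rfl <;>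
    first | assumption | (exact absurd ⟨rfl, rfl, rfl⟩ hn)

/-- splice -/
theorem exists_splice {A B C : ℤ} {T : Set (Fin 3 → ℝ)} (S : Std A B C T) {G : ℕ → ℤ} (hb : ∀ k, 0 ≤ G k ∧ G k ≤ 1)
    (hnc : NC G) (hG : ∀ k, |qq A B C G k| < C) (n : ℕ) :
    ∃ H : ℕ → ℤ, (∀ k < n+4, H k = G k) ∧ (∀ k, 0 ≤ H k ∧ H k ≤ 1) ∧ (∀ k, |qq A B C H k| < C) ∧
      ∃ N, ∀ k ≥ N, H (k+2) = H k := by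
  obtain ⟨H, h0, h1, h2, h3, hHb, hH, N, hN⟩ := alt_all S.hA S.hB S.hC (G n) (G (n+1)) (G (n+2)) (G (n+3)) (hb _) (hb _) (hb _) (hb _) (hnc n)
  have e : ∀ k < n+4, (if k < n then G k else H (k-n)) = G k := by
    intro k hk
    by_cases h : k < n
    · simp [h]
    · rw [if_neg h]
      have : k = n ∨ k = n+1 ∨ k = n+2 ∨ k = n+3 := by omega
      rcases this with rfl | rfl | rfl | rfl
      · simpa using h0
      · simpa using h1
      · simpa using h2
      · simpa using h3
  refine ⟨fun k => if k < n then G k else H (k-n), e, fun k => ?_, fun k => ?_, N + n, fun k hk => ?_⟩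
  · dsimp only; split_ifs
    · exact hb k
    · exact hHb _
  · by_cases hk : k < n
    · have := hG k
      simp only [qq] at *
      rw [e _ (by omega), e _ (by omega), e _ (by omega), e _ (by omega), e _ (by omega)]; exact this
    · have := hH (k-n)
      simp only [qq] at *
      rw [if_neg (by omega), if_neg (by omega), if_neg (by omega), if_neg (by omega), if_neg (by omega),
        show k+4-n = k-n+4 by omega, show k+3-n = k-n+3 by omega, show k+2-n = k-n+2 by omega, show k+1-n = k-n+1 by omega]
      exact this
  · dsimp only
    rw [if_neg (by omega), if_neg (by omega), show k+2-n = k-n+2 by omega]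
    exact hN _ (by omega)

/-- no third tile along eventually alternating pair with minimal digits -/
theorem no_third {A B C : ℤ} {T : Set (Fin 3 → ℝ)} (S : Std A B C T) {F G g : ℕ → ℤ} (N : ℕ)
    (hGb : ∀ k, 0 ≤ G k ∧ G k ≤ 1) (hgb : ∀ k, 0 ≤ g k ∧ g k ≤ 1) (hgn : NC g) (hGn : NC G) (hd : NC (fun n => g n - G n))
    (hdb : ∃ m, ∀ k, m ≤ g k - G k ∧ g k - G k ≤ m + 1)
    (hper : ∀ k ≥ N, G (k+2) = G k) (hF : Adr A B C F) (hFG : Adr A B C (fun n => F n + G n)) (hFg : Adr A B C (fun n => F n + g n))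
    (hmin : ∀ k ≥ N, min (qq A B C F k) (qq A B C F k + qq A B C G k) = 0) : False := by
  obtain ⟨hA, hB, hC⟩ := (⟨S.hA, S.hB, S.hC⟩ : _ ∧ _ ∧ _)
  obtain ⟨m, hm⟩ := hdb
  -- find place with G k = 0, k ≥ N
  obtain ⟨k, hk, g0, g1⟩ := hGn.upstep hGb N
  have G2 : G (k+2) = 0 := by rw [hper k hk, g0]
  have G3 : G (k+3) = 1 := by rw [hper (k+1) (by omega), g1]
  have G4 : G (k+4) = 0 := by rw [hper (k+2) (by omega), G2]
  have G5 : G (k+5) = 1 := by rw [hper (k+3) (by omega), G3]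
  have G6 : G (k+6) = 0 := by rw [hper (k+4) (by omega), G4]
  have G7 : G (k+7) = 1 := by rw [hper (k+5) (by omega), G5]
  have G8 : G (k+8) = 0 := by rw [hper (k+6) (by omega), G6]
  have up : ∀ j, G j = 0 → G (j+1) = 1 → G (j+2) = 0 → G (j+3) = 1 → m = 0 → g j ≠ g (j+2) ∧ g (j+1) = 1 ∧ g (j+3) = 1 := by
    intro j h0 h1 h2 h3 hm0
    have n0 := hgn j
    have d0 := hd j
    have m1 := hm (j+1)
    have m3 := hm (j+3)
    have b0 := hgb j
    have b1 := hgb (j+1)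
    have b2 := hgb (j+2)
    have b3 := hgb (j+3)
    clear hgn hGn hd hper hF hFG hFg hmin
    dsimp only at d0
    rw [h0, h1, h2, h3] at d0
    rw [h1] at m1
    rw [h3] at m3
    have e1 : g (j+1) = 1 := by omega
    have e3 : g (j+3) = 1 := by omega
    refine ⟨?_, e1, e3⟩
    rw [e1, e3] at *
    omega
  have dn : ∀ j, G j = 0 → G (j+1) = 1 → G (j+2) = 0 → G (j+3) = 1 → m = -1 → g (j+1) ≠ g (j+3) ∧ g j = 0 ∧ g (j+2) = 0 := by
    intro j h0 h1 h2 h3 hm0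
    have n0 := hgn j
    have d0 := hd j
    have m1 := hm j
    have m3 := hm (j+2)
    have b0 := hgb j
    have b1 := hgb (j+1)
    have b2 := hgb (j+2)
    have b3 := hgb (j+3)
    clear hgn hGn hd hper hF hFG hFg hmin
    dsimp only at d0
    rw [h0, h1, h2, h3] at d0
    rw [h0] at m1
    rw [h2] at m3
    have e1 : g j = 0 := by omega
    have e3 : g (j+2) = 0 := by omega
    refine ⟨?_, e1, e3⟩
    rw [e1, e3] at *
    omega
  have hmm : m = 0 ∨ m = -1 := by
    have m0 := hm k
    have m1 := hm (k+1)
    have b0 := hgb k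
    have b1 := hgb (k+1)
    rw [g0] at m0
    rw [g1] at m1
    have hgn0 := hgn k
    have hd0 := hd k
    have b2 := hgb (k+2)
    have b3 := hgb (k+3)
    have m2 := hm (k+2)
    have m3 := hm (k+3)
    rw [G2] at m2
    rw [G3] at m3
    clear hgn hGn hd hper hF hFG hFg hmin up dn
    omega
  have adr : ∀ j, 0 ≤ qq A B C F j + qq A B C g j ∧ qq A B C F j + qq A B C g j < C := fun j => by
    have := hFg j; rwa [qq_add] at this
  rcases hmm with rfl | rfl
  · -- g ≥ G
    obtain ⟨x0, e1, e3⟩ := up k g0 g1 G2 G3 rfl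
    obtain ⟨x2, -, e5⟩ := up (k+2) G2 G3 G4 G5 rfl
    obtain ⟨x4, -, e7⟩ := up (k+4) G4 G5 G6 G7 rfl
    have alt : (g k = 1 ∧ g (k+2) = 0 ∧ g (k+4) = 1) ∨ (g (k+2) = 1 ∧ g (k+4) = 0 ∧ g (k+6) = 1) := by
      have b0 := hgb k
      have b2 := hgb (k+2)
      have b4 := hgb (k+4)
      have b6 := hgb (k+6)
      simp only [add_assoc, Nat.reduceAdd] at x2 x4
      clear hgn hGn hd hper hF hFG hFg hmin up dn
      omega
    have key : ∀ j, j ≥ N → G j = 0 → G (j+1) = 1 → G (j+2) = 0 → G (j+3) = 1 → G (j+4) = 0 →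
       g j = 1 → g (j+1) = 1 → g (j+2) = 0 → g (j+3) = 1 → g (j+4) = 1 → False := by
      intro j hj a0 a1 a2 a3 a4 c0 c1 c2 c3 c4
      have h1 := hmin j hj
      have h2 := adr j
      have h3 : qq A B C G j = A - 1 + (C - B) := by simp only [qq, a0, a1, a2, a3, a4]; ring
      have h4 : qq A B C g j = A - B := by simp only [qq, c0, c1, c2, c3, c4]; ring
      omega
    rcases alt with ⟨x, y, z⟩ | ⟨x, y, z⟩
    · exact key k hk g0 g1 G2 G3 G4 x e1 y e3 z
    · exact key (k+2) (by omega) G2 G3 G4 G5 G6 x e3 y e5 z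
  · -- g ≤ G
    obtain ⟨x0, e0, e2⟩ := dn k g0 g1 G2 G3 rfl
    obtain ⟨x2, -, e4⟩ := dn (k+2) G2 G3 G4 G5 rfl
    obtain ⟨x4, -, e6⟩ := dn (k+4) G4 G5 G6 G7 rfl
    have alt : (g (k+1) = 1 ∧ g (k+3) = 0 ∧ g (k+5) = 1) ∨ (g (k+3) = 1 ∧ g (k+5) = 0 ∧ g (k+7) = 1) := by
      have b0 := hgb (k+1)
      have b2 := hgb (k+3)
      have b4 := hgb (k+5)
      have b6 := hgb (k+7)
      simp only [add_assoc, Nat.reduceAdd] at x2 x4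
      clear hgn hGn hd hper hF hFG hFg hmin up dn
      omega
    have key : ∀ j, j ≥ N → G j = 1 → G (j+1) = 0 → G (j+2) = 1 → G (j+3) = 0 → G (j+4) = 1 →
       g j = 1 → g (j+1) = 0 → g (j+2) = 0 → g (j+3) = 0 → g (j+4) = 1 → False := by
      intro j hj a0 a1 a2 a3 a4 c0 c1 c2 c3 c4
      have h1 := hmin j hj
      have h2 := adr j
      have h5 := hF j
      have h3 : qq A B C G j = 1 + (B - A) - C := by simp only [qq, a0, a1, a2, a3, a4]; ring
      have h4 : qq A B C g j = 1 - C := by simp only [qq, c0, c1, c2, c3, c4]; ring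
      omega
    rcases alt with ⟨x, y, z⟩ | ⟨x, y, z⟩
    · exact key (k+1) (by omega) g1 G2 G3 G4 G5 x e2 y e4 z
    · exact key (k+3) (by omega) G3 G4 G5 G6 G7 x e4 y e6 z

theorem edge_approx {A B C : ℤ} {T : Set (Fin 3 → ℝ)} (S : Std A B C T) {x} {α β : Fin 3 → ℤ} (hα : α ≠ 0) (hβ : β ≠ 0) (hαβ : β ≠ α)
    (hx : x ∈ T) (hxβ : x ∈ tileTranslate (toR β) T) (ε : ℝ) (hε : 0 < ε) :
    ∃ y ∈ T, y ∈ tileTranslate (toR β) T ∧ y ∉ tileTranslate (toR α) T ∧ dist y x < ε := by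
  obtain ⟨F, hz, hF⟩ := zero_rep S.hT hx
  obtain ⟨G, hFG, hGb, hGn, hGnb, hGw⟩ := pair_bin S hF hz hβ hxβ
  obtain ⟨n, hn⟩ := TRep.close S.hT ε hε
  obtain ⟨H, hHG, hHb, hHq, N, hN⟩ := exists_splice S hGb hGn hGnb.2 n
  obtain ⟨F2, a0, a1, a2, a3, hq⟩ := exists_digits A B C (F 0) (F 1) (F 2) (F 3)
    (fun k => if k < n then qq A B C F k else max 0 (-qq A B C H k))
  have hag := digits_agree (A := A) (B := B) (C := C) n a0 a1 a2 a3 (fun k hk => by rw [hq]; simp [hk])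
  have hqH : ∀ k < n, qq A B C H k = qq A B C G k := by
    intro k hk; simp only [qq]
    rw [hHG _ (by omega), hHG _ (by omega), hHG _ (by omega), hHG _ (by omega), hHG _ (by omega)]
  have hadr : Adr A B C F2 := fun k => by
    rw [hq]; split_ifs
    · exact hF.1 k
    · have := abs_lt.mp (hHq k); constructor <;> omega
  have hadr2 : Adr A B C (fun n => F2 n + H n) := fun k => by
    rw [qq_add, hq]; split_ifs with h
    · rw [hqH k h]; have := hFG.1 k; rwa [qq_add] at this
    · have := abs_lt.mp (hHq k); constructor <;> omega
  obtain ⟨y, hy⟩ := hadr.rep S.hT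
  have hz2 : ZWin F2 := by
    obtain ⟨z0, z1, z2, z3⟩ := hz
    exact ⟨a0.trans z0, a1.trans z1, a2.trans z2, a3.trans z3⟩
  have hHbd : BdInc H := BdInc.of_bdd 0 1 (by simpa using hHb)
  have hy2 : TRep A B C (fun n => F2 n + H n) y := hy.of_bd hadr2 (by simpa using hHbd)
  refine ⟨y, hz2.mem S.hT hy, ?_, ?_, hn F2 F y x hy hF (fun k hk => hag k (by omega))⟩
  · have := hz2.mem' S.hT hy2
    rw [hHG 0 (by omega), hHG 1 (by omega), hHG 2 (by omega), hHG 3 (by omega), hGw] at this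
    exact this
  · intro hyα
    obtain ⟨g, hFg, hgb, hgn, hgnb, hgw⟩ := pair_bin S hy hz2 hα hyα
    have hHnc0 : ¬ (H 1 = H 0 ∧ H 2 = H 0 ∧ H 3 = H 0) := by
      rw [hHG 0 (by omega), hHG 1 (by omega), hHG 2 (by omega), hHG 3 (by omega)]
      exact hGn 0
    have hHn : NC H := NbSeq.persist S.Cpos ⟨hHbd, hHq⟩ hHnc0
    have hD : NbSeq A B C (fun n => (F2 n + g n) - (F2 n + H n)) := NbSeq.of_rep hy2 hFg
    simp only [add_sub_add_left_eq_sub] at hD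
    have hDn : ¬ (g 1 - H 1 = g 0 - H 0 ∧ g 2 - H 2 = g 0 - H 0 ∧ g 3 - H 3 = g 0 - H 0) := by
      rintro ⟨x1, x2, x3⟩
      apply hαβ
      rw [← hgw, ← hGw]
      rw [hHG 0 (by omega), hHG 1 (by omega), hHG 2 (by omega), hHG 3 (by omega)] at *
      simp only [wz]
      rw [show G 3 - G 2 = g 3 - g 2 by omega, show G 2 - G 1 = g 2 - g 1 by omega, show G 1 - G 0 = g 1 - g 0 by omega]
    have hDnc : NC (fun n => g n - H n) := hD.persist S.Cpos hDn
    obtain ⟨m, hm⟩ := hD.bin S hDn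
    refine no_third S (max N n) hHb hgb hgn hHn hDnc ⟨m, hm⟩ (fun k hk => hN k (le_trans (le_max_left _ _) hk)) hadr hadr2 hFg.1 ?_
    intro k hk
    have : n ≤ k := le_trans (le_max_right _ _) hk
    rw [hq, if_neg (by omega)]
    omega

def LL (T : Set (Fin 3 → ℝ)) (α : Fin 3 → ℤ) : Set (Fin 3 → ℝ) :=
  ⋃ β ∈ {β : Fin 3 → ℤ | β ∉ ({0, α} : Set (Fin 3 → ℤ))},
        T ∩ tileTranslate (toR α) T ∩ tileTranslate (toR β) T

theorem mem_LL {T : Set (Fin 3 → ℝ)} {α x} : x ∈ LL T α ↔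
    x ∈ T ∧ x ∈ tileTranslate (toR α) T ∧ ∃ β, β ≠ 0 ∧ β ≠ α ∧ x ∈ tileTranslate (toR β) T := by
  simp only [LL, Set.mem_iUnion, Set.mem_inter_iff, Set.mem_ofPred_eq, Set.mem_insert_iff, Set.mem_singleton_iff, not_or]
  constructor
  · rintro ⟨β, ⟨h1, h2⟩, ⟨h3, h4⟩, h5⟩; exact ⟨h3, h4, β, h1, h2, h5⟩
  · rintro ⟨h3, h4, β, h1, h2, h5⟩; exact ⟨β, ⟨h1, h2⟩, ⟨h3, h4⟩, h5⟩

theorem frontier_eq_LL {A B C : ℤ} {T : Set (Fin 3 → ℝ)} (S : Std A B C T) {α : Fin 3 → ℤ} (hα : α ≠ 0) :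
    Subtype.val '' (frontier ((Subtype.val ⁻¹' (T ∩ tileTranslate (toR α) T)) :
        Set (frontier T))) = LL T α := by
  have hcp := S.hT.2.2.2.2.1
  have hcl : IsClosed (T ∩ tileTranslate (toR α) T) := by
    refine hcp.isClosed.inter ?_
    have := tiles_closed hcp {α}
    simpa using this
  have hcl2 := hcl.preimage (continuous_subtype_val (p := fun y => y ∈ frontier T))
  change Subtype.val '' (frontier ((Subtype.val : frontier T → _) ⁻¹' (T ∩ tileTranslate (toR α) T))) = LL T α
  rw [hcl2.frontier_eq]
  ext x
  constructor
  · rintro ⟨⟨x', hx'⟩, ⟨h1, h2⟩, rfl⟩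
    obtain ⟨hxT, hxα⟩ := h1
    rw [mem_LL]
    refine ⟨hxT, hxα, ?_⟩
    by_contra hc
    push Not at hc
    apply h2
    obtain ⟨ε, hε, hav⟩ := tiles_avoid hcp {β | β ≠ 0 ∧ β ≠ α} x' (fun β hβ => hc β hβ.1 hβ.2)
    rw [mem_interior_iff_mem_nhds, Metric.mem_nhds_iff]
    refine ⟨ε, hε, ?_⟩
    rintro ⟨y, hy⟩ hd
    have hd' : dist y x' < ε := hd
    obtain ⟨β, hβ, hyβ⟩ := frontier_subset S.hT hy
    refine ⟨hcp.isClosed.frontier_subset hy, ?_⟩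
    by_cases hβα : β = α
    · rw [← hβα]; exact hyβ
    · exact absurd hyβ (hav y hd' β ⟨hβ, hβα⟩)
  · intro hx
    obtain ⟨hxT, hxα, β, hβ0, hβα, hxβ⟩ := mem_LL.mp hx
    refine ⟨⟨x, mem_frontier_of_nb S hxT hα hxα⟩, ⟨⟨hxT, hxα⟩, fun hi => ?_⟩, rfl⟩
    rw [mem_interior_iff_mem_nhds, Metric.mem_nhds_iff] at hi
    obtain ⟨ε, hε, hb⟩ := hi
    obtain ⟨y, hyT, hyβ, hyα, hd⟩ := edge_approx S hα hβ0 hβα hxT hxβ ε hε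
    have hyf := mem_frontier_of_nb S hyT hβ0 hyβ
    have := hb (show (⟨y, hyf⟩ : frontier T) ∈ Metric.ball _ ε from hd)
    exact hyα this.2

/-! triples -/
def A3 (A B C : ℤ) (Γ : ℕ → ℤ) : Prop := ∀ i : ℤ, Adr A B C (fun n => (Γ n + i) / 3)

def dv (x : ℤ) : ℤ := if 3 ∣ x then 1 else 0

def Q3 (A B C a b c d : ℤ) : ℤ := (A-1) * ((d-a)/3) + (B-A) * ((c-a)/3) + (C-B) * ((b-a)/3)

def w3 (A B C a b c d : ℤ) : ℤ := (A-1) * dv (d-a) + (B-A) * dv (c-a) + (C-B) * dv (b-a)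

theorem dv_div (x : ℤ) : (x + 2) / 3 = x / 3 + 1 - dv x := by
  unfold dv; split_ifs <;> omega

theorem dv_mem (x : ℤ) : 0 ≤ dv x ∧ dv x ≤ 1 := by
  unfold dv; split_ifs <;> norm_num

theorem step3 {A B C : ℤ} (hA : 1 ≤ A) (hB : A ≤ B) (hC : B < C) (a b c d e : ℤ) :
    (∀ i : ℤ, 0 ≤ (e+i)/3 + (A-1)*((d+i)/3) + (B-A)*((c+i)/3) + (C-B)*((b+i)/3) - C*((a+i)/3) ∧
      (e+i)/3 + (A-1)*((d+i)/3) + (B-A)*((c+i)/3) + (C-B)*((b+i)/3) - C*((a+i)/3) < C) ↔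
    a - 3 * Q3 A B C a b c d ≤ e ∧ e ≤ a - 3 * Q3 A B C a b c d + 3 * w3 A B C a b c d := by
  unfold Q3 w3
  constructor
  · intro h
    have h1 := (h (-a)).1
    have h2 := (h (2-a)).2
    simp only [← sub_eq_add_neg, sub_self] at h1
    rw [show d + (2-a) = (d-a)+2 by ring, show c + (2-a) = (c-a)+2 by ring, show b + (2-a) = (b-a)+2 by ring,
      show a+(2-a) = 2 by ring, show e + (2-a) = (e-a)+2 by ring, dv_div (d-a), dv_div (c-a), dv_div (b-a)] at h2
    norm_num at h1 h2
    generalize (d-a)/3 = x at *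
    generalize (c-a)/3 = y at *
    generalize (b-a)/3 = z at *
    generalize dv (d-a) = x' at *
    generalize dv (c-a) = y' at *
    generalize dv (b-a) = z' at *
    have e1 : (e-a)/3 ≥ -((A-1)*x + (B-A)*y+(C-B)*z) := by linarith
    have e2 : (e-a+2)/3 ≤ -((A-1)*x + (B-A)*y+(C-B)*z) + ((A-1)*x' + (B-A)*y'+(C-B)*z') := by
      have : C = A - 1 + (B-A) + (C-B) + 1 := by ring
      nlinarith
    generalize (A-1)*x + (B-A)*y+(C-B)*z = P at *
    generalize (A-1)*x' + (B-A)*y'+(C-B)*z' = P' at *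
    omega
  · rintro ⟨h1, h2⟩ i
    obtain ⟨r, s, hr0, hr2, hi⟩ : ∃ r s : ℤ, 0 ≤ r ∧ r ≤ 2 ∧ i = -a + r + 3 * s :=
      ⟨(i+a)%3, (i+a)/3, by omega, by omega, by omega⟩
    have sh : ∀ x, (x+i)/3 = (x - a + r)/3 + s := fun x => by rw [hi]; omega
    have mo : ∀ x : ℤ, x/3 ≤ (x+r)/3 ∧ (x+r)/3 ≤ x/3+1-dv x := fun x => by
      rw [← dv_div]; constructor <;> omega
    rw [sh, sh, sh, sh, sh]
    have ra : (a - a + r)/3 = 0 := by omega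
    rw [ra]
    have md := mo (d-a)
    have mc := mo (c-a)
    have mb := mo (b-a)
    have e1 : -((A-1) * ((d-a)/3) + (B-A) * ((c-a)/3) + (C-B) * ((b-a)/3)) ≤ (e-a+r)/3 := by
      generalize (A-1) * ((d-a)/3) + (B-A) * ((c-a)/3) + (C-B) * ((b-a)/3) = P at *
      omega
    have e2 : (e-a+r)/3 ≤ -((A-1) * ((d-a)/3) + (B-A) * ((c-a)/3) + (C-B) * ((b-a)/3)) + ((A-1) * dv (d-a) + (B-A) * dv (c-a) + (C-B) * dv (b-a)) := by
      generalize (A-1) * ((d-a)/3) + (B-A) * ((c-a)/3) + (C-B) * ((b-a)/3) = P at *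
      generalize (A-1) * dv (d-a) + (B-A) * dv (c-a) + (C-B) * dv (b-a) = P' at *
      omega
    have l1 := mul_le_mul_of_nonneg_left md.1 (by linarith : 0 ≤ A - 1)
    have l2 := mul_le_mul_of_nonneg_left mc.1 (by linarith : 0 ≤ B - A)
    have l3 := mul_le_mul_of_nonneg_left mb.1 (by linarith : 0 ≤ C - B)
    have u1 := mul_le_mul_of_nonneg_left md.2 (by linarith : 0 ≤ A - 1)
    have u2 := mul_le_mul_of_nonneg_left mc.2 (by linarith : 0 ≤ B - A)
    have u3 := mul_le_mul_of_nonneg_left mb.2 (by linarith : 0 ≤ C - B)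
    constructor <;> linarith

def lo3 (A B C : ℤ) (Γ : ℕ → ℤ) (k : ℕ) : ℤ := Γ k - 3 * Q3 A B C (Γ k) (Γ (k+1)) (Γ (k+2)) (Γ (k+3))
def ww (A B C : ℤ) (Γ : ℕ → ℤ) (k : ℕ) : ℤ := w3 A B C (Γ k) (Γ (k+1)) (Γ (k+2)) (Γ (k+3))
def jj (A B C : ℤ) (Γ : ℕ → ℤ) (k : ℕ) : ℤ := Γ (k+4) - lo3 A B C Γ k

theorem A3_iff {A B C : ℤ} (hA : 1 ≤ A) (hB : A ≤ B) (hC : B < C) (Γ : ℕ → ℤ) :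
    A3 A B C Γ ↔ ∀ k, 0 ≤ jj A B C Γ k ∧ jj A B C Γ k ≤ 3 * ww A B C Γ k := by
  have := fun k => step3 hA hB hC (Γ k) (Γ (k+1)) (Γ (k+2)) (Γ (k+3)) (Γ (k+4))
  constructor
  · intro h k
    have h2 := (this k).mp (fun i => h i k)
    simp only [jj, lo3, ww]
    constructor <;> linarith [h2.1, h2.2]
  · intro h i k
    have h2 := h k
    simp only [jj, lo3, ww] at h2
    exact (this k).mpr ⟨by linarith, by linarith⟩ i

/-- surjectivity of windows mod 3 -/
def sj (a b c d : ℤ) : Prop := (a % 3 = 0 ∨ b % 3 = 0 ∨ c % 3 = 0 ∨ d % 3 = 0) ∧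
  (a % 3 = 1 ∨ b % 3 = 1 ∨ c % 3 = 1 ∨ d % 3 = 1) ∧ (a % 3 = 2 ∨ b % 3 = 2 ∨ c % 3 = 2 ∨ d % 3 = 2)

def SJ (Γ : ℕ → ℤ) (k : ℕ) : Prop := sj (Γ k) (Γ (k+1)) (Γ (k+2)) (Γ (k+3))

def br4 (a b c d : ℤ) : Prop := b % 3 = a % 3 ∨ c % 3 = a % 3 ∨ d % 3 = a % 3
instance (a b c d : ℤ) : Decidable (br4 a b c d) := by unfold br4; infer_instance

def br (Γ : ℕ → ℤ) (k : ℕ) : Prop := br4 (Γ k) (Γ (k+1)) (Γ (k+2)) (Γ (k+3))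
instance (Γ : ℕ → ℤ) (k : ℕ) : Decidable (br Γ k) := by unfold br; infer_instance

theorem w3_nonneg {A B C : ℤ} (hA : 1 ≤ A) (hB : A ≤ B) (hC : B < C) (a b c d : ℤ) : 0 ≤ w3 A B C a b c d := by
  unfold w3
  have h1 := mul_nonneg (by linarith : 0 ≤ A - 1) (dv_mem (d-a)).1
  have h2 := mul_nonneg (by linarith : 0 ≤ B - A) (dv_mem (c-a)).1
  have h3 := mul_nonneg (by linarith : 0 ≤ C - B) (dv_mem (b-a)).1
  linarith

theorem w3_zero {A B C a b c d : ℤ} (h : ¬ br4 a b c d) : w3 A B C a b c d = 0 := by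
  unfold br4 at h
  unfold w3 dv
  rw [if_neg (by omega), if_neg (by omega), if_neg (by omega)]; ring

theorem sj_next {a b c d e : ℤ} (h : sj a b c d) (he : br4 a b c d ∨ e % 3 = a % 3) : sj b c d e := by
  unfold sj br4 at *
  omega

theorem A3.sj_succ {A B C : ℤ} (hA : 1 ≤ A) (hB : A ≤ B) (hC : B < C) {Γ : ℕ → ℤ} (h : A3 A B C Γ) {k : ℕ}
    (hs : SJ Γ k) : SJ Γ (k+1) := by
  refine sj_next hs ?_
  by_cases hb : br4 (Γ k) (Γ (k+1)) (Γ (k+2)) (Γ (k+3))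
  · exact Or.inl hb
  · right
    have := (A3_iff hA hB hC Γ).mp h k
    simp only [jj, lo3, ww, w3_zero hb] at this
    show Γ (k+4) % 3 = Γ k % 3
    generalize Q3 A B C (Γ k) (Γ (k+1)) (Γ (k+2)) (Γ (k+3)) = q at this
    omega

theorem A3.sj_all {A B C : ℤ} (hA : 1 ≤ A) (hB : A ≤ B) (hC : B < C) {Γ : ℕ → ℤ} (h : A3 A B C Γ)
    (hs : SJ Γ 0) (k : ℕ) : SJ Γ k := by
  induction k with
  | zero => exact hs
  | succ k ih => exact h.sj_succ hA hB hC ih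

theorem w3_pos {A B C : ℤ} (hA : 1 ≤ A) (hB : A < B) (hC : B < C) {a b c d : ℤ} (h : b % 3 = a % 3 ∨ c % 3 = a % 3) :
    1 ≤ w3 A B C a b c d := by
  unfold w3
  have h1 := mul_nonneg (by linarith : 0 ≤ A - 1) (dv_mem (d-a)).1
  have h2 := mul_nonneg (by linarith : 0 ≤ B - A) (dv_mem (c-a)).1
  have h3 := mul_nonneg (by linarith : 0 ≤ C - B) (dv_mem (b-a)).1
  rcases h with h | h
  · have : dv (b-a) = 1 := by unfold dv; rw [if_pos (by omega)]
    rw [this] at *; linarith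
  · have : dv (c-a) = 1 := by unfold dv; rw [if_pos (by omega)]
    rw [this] at *; linarith

/-- some branching within four steps -/
theorem A3.branch {A B C : ℤ} (hA : 1 ≤ A) (hB : A < B) (hC : B < C) {Γ : ℕ → ℤ} (h : A3 A B C Γ) {k : ℕ}
    (hs : SJ Γ k) : ∃ j < 4, 1 ≤ ww A B C Γ (k+j) := by
  by_contra hc
  push Not at hc
  have nn : ∀ j < 4, ¬ (Γ (k+j+1) % 3 = Γ (k+j) % 3 ∨ Γ (k+j+2) % 3 = Γ (k+j) % 3) := by
    intro j hj hh
    have := hc j hj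
    have := w3_pos hA hB hC (d := Γ (k+j+3)) hh
    simp only [ww] at *
    omega
  have z : ∀ j < 4, Γ (k+j+4) % 3 = Γ (k+j) % 3 := by
    intro j hj
    have h1 := hc j hj
    have h2 := (A3_iff hA hB.le hC Γ).mp h (k+j)
    have h3 := w3_nonneg hA hB.le hC (Γ (k+j)) (Γ (k+j+1)) (Γ (k+j+2)) (Γ (k+j+3))
    simp only [jj, lo3, ww] at *
    omega
  have n0 := nn 0 (by norm_num)
  have n1 := nn 1 (by norm_num)
  have n2 := nn 2 (by norm_num)
  have n3 := nn 3 (by norm_num)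
  have z0 := z 0 (by norm_num)
  have z1 := z 1 (by norm_num)
  have s1 := h.sj_succ hA hB.le hC hs
  have s2 := h.sj_succ hA hB.le hC s1
  simp only [SJ, sj] at hs s1 s2
  simp only [add_assoc, Nat.reduceAdd, add_zero] at *
  clear nn z hc h hA hB hC s1 s2
  omega

theorem bdist {b c d : ℤ} {a : ℤ} (hs : sj a b c d) (hb : br4 a b c d) : b % 3 ≠ c % 3 ∧ b % 3 ≠ d % 3 ∧ c % 3 ≠ d % 3 := by
  unfold sj br4 at *
  omega

structure Par (A B C : ℤ) : Prop where
  hA : 1 ≤ A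
  hB : A < B
  hC : B < C

theorem Std.par {A B C : ℤ} {T : Set (Fin 3 → ℝ)} (S : Std A B C T) : Par A B C := ⟨S.hA, S.hB, S.hC⟩

noncomputable def TPs (A B C : ℤ) (Γ : ℕ → ℤ) (k : ℕ) (τ : ℝ) : ℝ :=
  if br Γ k then 1 - ((jj A B C Γ k : ℝ) + τ) / (3 * (ww A B C Γ k : ℝ) + 1)
  else ((jj A B C Γ k : ℝ) + τ) / (3 * (ww A B C Γ k : ℝ) + 1)

def TP (A B C : ℤ) (Γ : ℕ → ℤ) (t : ℕ → ℝ) : Prop :=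
  ∀ k, 0 ≤ t k ∧ t k ≤ 1 ∧ t k = TPs A B C Γ k (t (k+1))

theorem A3.jj_mem {A B C : ℤ} (P : Par A B C) {Γ : ℕ → ℤ} (h : A3 A B C Γ) (k : ℕ) :
    0 ≤ jj A B C Γ k ∧ jj A B C Γ k ≤ 3 * ww A B C Γ k := (A3_iff P.hA P.hB.le P.hC Γ).mp h k

theorem A3.jjR {A B C : ℤ} (P : Par A B C) {Γ : ℕ → ℤ} (h : A3 A B C Γ) (k : ℕ) :
    (0:ℝ) ≤ jj A B C Γ k ∧ (jj A B C Γ k : ℝ) ≤ 3 * ww A B C Γ k ∧ (0:ℝ) ≤ ww A B C Γ k := by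
  have := h.jj_mem P k
  refine ⟨by exact_mod_cast this.1, by exact_mod_cast this.2, ?_⟩
  have : 0 ≤ ww A B C Γ k := by omega
  exact_mod_cast this

theorem TPs_mem {A B C : ℤ} (P : Par A B C) {Γ : ℕ → ℤ} (h : A3 A B C Γ) (k : ℕ) {τ : ℝ} (h0 : 0 ≤ τ) (h1 : τ ≤ 1) :
    0 ≤ TPs A B C Γ k τ ∧ TPs A B C Γ k τ ≤ 1 := by
  obtain ⟨a, b, c⟩ := h.jjR P k
  have p : (0:ℝ) < 3 * (ww A B C Γ k : ℝ) + 1 := by linarith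
  have l : 0 ≤ ((jj A B C Γ k : ℝ) + τ) / (3 * (ww A B C Γ k : ℝ) + 1) := by positivity
  have u : ((jj A B C Γ k : ℝ) + τ) / (3 * (ww A B C Γ k : ℝ) + 1) ≤ 1 := by
    rw [div_le_one p]; linarith
  unfold TPs
  split_ifs <;> constructor <;> linarith

theorem TPs_cont (A B C : ℤ) (Γ : ℕ → ℤ) (k : ℕ) : Continuous (TPs A B C Γ k) := by
  unfold TPs
  split_ifs <;> fun_prop

theorem TP_exists {A B C : ℤ} (P : Par A B C) {Γ : ℕ → ℤ} (h : A3 A B C Γ) : ∃ t, TP A B C Γ t := by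
  let K : ℕ → Set (ℕ → ℝ) := fun N => {u | (∀ k, u k ∈ Set.Icc (0:ℝ) 1) ∧ ∀ k < N, u k = TPs A B C Γ k (u (k+1))}
  have hb : IsCompact {u : ℕ → ℝ | ∀ k, u k ∈ Set.Icc (0:ℝ) 1} := by
    have := isCompact_univ_pi (fun k : ℕ => (isCompact_Icc : IsCompact (Set.Icc (0:ℝ) 1)))
    have e : {u : ℕ → ℝ | ∀ k, u k ∈ Set.Icc (0:ℝ) 1} = Set.univ.pi (fun _ => Set.Icc (0:ℝ) 1) := by
      ext u
      constructor
      · intro h k _; exact h k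
      · intro h k; exact h k trivial
    rw [e]; exact this
  have hclosed : ∀ N, IsClosed (K N) := by
    intro N
    refine hb.isClosed.inter ?_
    have e : {u : ℕ → ℝ | ∀ k < N, u k = TPs A B C Γ k (u (k+1))} =
          ⋂ k, ⋂ (_ : k < N), {u | u k = TPs A B C Γ k (u (k+1))} := by
        ext u; simp
    change IsClosed {u : ℕ → ℝ | ∀ k < N, u k = TPs A B C Γ k (u (k+1))}
    rw [e]
    refine isClosed_iInter fun k => isClosed_iInter fun _ => ?_
    exact isClosed_eq (by fun_prop) ((TPs_cont A B C Γ k).comp (by fun_prop))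
  have := IsCompact.nonempty_iInter_of_sequence_nonempty_isCompact_isClosed K ?_ ?_ ?_ hclosed
  · obtain ⟨u, hu⟩ := this
    simp only [Set.mem_iInter] at hu
    exact ⟨u, fun k => ⟨((hu 0).1 k).1, ((hu 0).1 k).2, (hu (k+1)).2 k (by omega)⟩⟩
  · intro n u hu
    exact ⟨hu.1, fun k hk => hu.2 k (by omega)⟩
  · intro n
    let f : ℕ → ℕ → ℝ := fun N => Nat.rec (fun _ => 0) (fun _ g k => TPs A B C Γ k (g (k+1))) N
    have fs : ∀ N k, f (N+1) k = TPs A B C Γ k (f N (k+1)) := fun _ _ => rfl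
    have fm : ∀ N k, 0 ≤ f N k ∧ f N k ≤ 1 := by
      intro N
      induction N with
      | zero => intro k; simp [f]
      | succ N ih => intro k; rw [fs]; exact TPs_mem P h k (ih _).1 (ih _).2
    refine ⟨fun k => f (n-k) k, fun k => fm _ _, fun k hk => ?_⟩
    show f (n-k) k = TPs A B C Γ k (f (n-(k+1)) (k+1))
    rw [← fs, show n - (k+1) + 1 = n - k by omega]
  · exact hb.of_isClosed_subset (hclosed 0) (fun u hu => hu.1)

theorem TPs_agree {A B C : ℤ} {Γ Γ' : ℕ → ℤ} {k : ℕ} (he : ∀ j < 5, Γ (k+j) = Γ' (k+j)) :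
    jj A B C Γ k = jj A B C Γ' k ∧ ww A B C Γ k = ww A B C Γ' k ∧ (br Γ k ↔ br Γ' k) := by
  have e0 : Γ k = Γ' k := he 0 (by norm_num)
  have e1 := he 1 (by norm_num)
  have e2 := he 2 (by norm_num)
  have e3 := he 3 (by norm_num)
  have e4 := he 4 (by norm_num)
  simp only [jj, lo3, ww, br, e0, e1, e2, e3, e4, and_self]

theorem TPs_congr {A B C : ℤ} {Γ Γ' : ℕ → ℤ} {k : ℕ} (he : ∀ j < 5, Γ (k+j) = Γ' (k+j)) (τ : ℝ) :
    TPs A B C Γ k τ = TPs A B C Γ' k τ := by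
  obtain ⟨a, b, c⟩ := TPs_agree (A := A) (B := B) (C := C) he
  simp only [TPs, a, b, c]

theorem TPs_diff {A B C : ℤ} (P : Par A B C) {Γ : ℕ → ℤ} (h : A3 A B C Γ) (k : ℕ) (τ τ' : ℝ) :
    |TPs A B C Γ k τ - TPs A B C Γ k τ'| = |τ - τ'| / (3 * (ww A B C Γ k : ℝ) + 1) := by
  obtain ⟨a, b, c⟩ := h.jjR P k
  have p : (0:ℝ) < 3 * (ww A B C Γ k : ℝ) + 1 := by linarith
  unfold TPs
  split_ifs
  · rw [show 1 - ((jj A B C Γ k : ℝ) + τ) / (3 * (ww A B C Γ k : ℝ) + 1) - (1 - ((jj A B C Γ k : ℝ) + τ') / (3 * (ww A B C Γ k : ℝ) + 1)) = -((τ - τ') / (3 * (ww A B C Γ k : ℝ) + 1)) by ring, abs_neg, abs_div, abs_of_pos p]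
  · rw [show ((jj A B C Γ k : ℝ) + τ) / (3 * (ww A B C Γ k : ℝ) + 1) - ((jj A B C Γ k : ℝ) + τ') / (3 * (ww A B C Γ k : ℝ) + 1) = ((τ - τ') / (3 * (ww A B C Γ k : ℝ) + 1)) by ring, abs_div, abs_of_pos p]

theorem TP_step {A B C : ℤ} (P : Par A B C) {Γ Γ' : ℕ → ℤ} {t t' : ℕ → ℝ} (h : A3 A B C Γ) (ht : TP A B C Γ t)
    (ht' : TP A B C Γ' t') {k : ℕ} (he : ∀ j < 5, Γ (k+j) = Γ' (k+j)) :
    |t k - t' k| = |t (k+1) - t' (k+1)| / (3 * (ww A B C Γ k : ℝ) + 1) := by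
  rw [(ht k).2.2, (ht' k).2.2, ← TPs_congr he, TPs_diff P h]

theorem TP_step_le {A B C : ℤ} (P : Par A B C) {Γ Γ' : ℕ → ℤ} {t t' : ℕ → ℝ} (h : A3 A B C Γ) (ht : TP A B C Γ t)
    (ht' : TP A B C Γ' t') {k : ℕ} (he : ∀ j < 5, Γ (k+j) = Γ' (k+j)) :
    |t k - t' k| ≤ |t (k+1) - t' (k+1)| := by
  rw [TP_step P h ht ht' he]
  obtain ⟨a, b, c⟩ := h.jjR P k
  exact div_le_self (abs_nonneg _) (by linarith)

theorem TP_step_quarter {A B C : ℤ} (P : Par A B C) {Γ Γ' : ℕ → ℤ} {t t' : ℕ → ℝ} (h : A3 A B C Γ) (ht : TP A B C Γ t)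
    (ht' : TP A B C Γ' t') {k : ℕ} (he : ∀ j < 5, Γ (k+j) = Γ' (k+j)) (hw : 1 ≤ ww A B C Γ k) :
    |t k - t' k| ≤ |t (k+1) - t' (k+1)| / 4 := by
  rw [TP_step P h ht ht' he]
  have : (1:ℝ) ≤ ww A B C Γ k := by exact_mod_cast hw
  exact div_le_div_of_nonneg_left (abs_nonneg _) (by norm_num) (by linarith)

theorem TP_four {A B C : ℤ} (P : Par A B C) {Γ Γ' : ℕ → ℤ} {t t' : ℕ → ℝ} (h : A3 A B C Γ) (ht : TP A B C Γ t)
    (ht' : TP A B C Γ' t') {k : ℕ} (hs : SJ Γ k) (he : ∀ j < 8, Γ (k+j) = Γ' (k+j)) :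
    |t k - t' k| ≤ |t (k+4) - t' (k+4)| / 4 := by
  have E : ∀ i < 4, ∀ j < 5, Γ (k+i+j) = Γ' (k+i+j) := fun i hi j hj => by
    rw [add_assoc]; exact he _ (by omega)
  have l0 : |t k - t' k| ≤ |t (k+1) - t' (k+1)| := TP_step_le P h ht ht' (E 0 (by norm_num))
  have l1 : |t (k+1) - t' (k+1)| ≤ |t (k+2) - t' (k+2)| := TP_step_le P h ht ht' (E 1 (by norm_num))
  have l2 : |t (k+2) - t' (k+2)| ≤ |t (k+3) - t' (k+3)| := TP_step_le P h ht ht' (E 2 (by norm_num))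
  have l3 : |t (k+3) - t' (k+3)| ≤ |t (k+4) - t' (k+4)| := TP_step_le P h ht ht' (E 3 (by norm_num))
  obtain ⟨j, hj, hw⟩ := h.branch P.hA P.hB P.hC hs
  have q := TP_step_quarter P h ht ht' (E j hj) hw
  interval_cases j
  · have q' : |t k - t' k| ≤ |t (k+1) - t' (k+1)| / 4 := q
    linarith
  · have q' : |t (k+1) - t' (k+1)| ≤ |t (k+2) - t' (k+2)| / 4 := q
    linarith
  · have q' : |t (k+2) - t' (k+2)| ≤ |t (k+3) - t' (k+3)| / 4 := q
    linarith
  · have q' : |t (k+3) - t' (k+3)| ≤ |t (k+4) - t' (k+4)| / 4 := q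
    linarith

theorem TP_close {A B C : ℤ} (P : Par A B C) {Γ Γ' : ℕ → ℤ} {t t' : ℕ → ℝ} (h : A3 A B C Γ) (ht : TP A B C Γ t)
    (ht' : TP A B C Γ' t') (hs : SJ Γ 0) (n : ℕ) : ∀ k, (∀ j < 4*n+4, Γ (k+j) = Γ' (k+j)) →
    |t k - t' k| ≤ (1/4)^n := by
  induction n with
  | zero =>
    intro k _
    have a := ht k
    have b := ht' k
    rw [pow_zero, abs_le]; constructor <;> linarith
  | succ n ih =>
    intro k he
    have h4 := TP_four P h ht ht' (k := k) (h.sj_all P.hA P.hB.le P.hC hs k) (fun j hj => he j (by omega))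
    have := ih (k+4) (fun j hj => by rw [add_assoc]; exact he (4+j) (by omega))
    rw [pow_succ]; linarith

theorem TP_unique {A B C : ℤ} (P : Par A B C) {Γ : ℕ → ℤ} {t t' : ℕ → ℝ} (h : A3 A B C Γ) (ht : TP A B C Γ t)
    (ht' : TP A B C Γ t') (hs : SJ Γ 0) (k : ℕ) : t k = t' k := by
  have := fun n => TP_close P h ht ht' hs n k (fun _ _ => rfl)
  have lim : Filter.Tendsto (fun n : ℕ => ((1:ℝ)/4)^n) Filter.atTop (nhds 0) :=
    tendsto_pow_atTop_nhds_zero_of_lt_one (by norm_num) (by norm_num)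
  have := ge_of_tendsto' lim this
  have := abs_nonpos_iff.mp this
  linarith

theorem TP_surj {A B C : ℤ} (P : Par A B C) (a b c d : ℤ) (τ : ℝ) (h0 : 0 ≤ τ) (h1 : τ ≤ 1) :
    ∃ Γ t, Γ 0 = a ∧ Γ 1 = b ∧ Γ 2 = c ∧ Γ 3 = d ∧ A3 A B C Γ ∧ TP A B C Γ t ∧ t 0 = τ := by
  have H : ∀ p : {p : ℤ × ℤ × ℤ × ℤ × ℝ // 0 ≤ p.2.2.2.2 ∧ p.2.2.2.2 ≤ 1},
      ∃ p' : {p : ℤ × ℤ × ℤ × ℤ × ℝ // 0 ≤ p.2.2.2.2 ∧ p.2.2.2.2 ≤ 1},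
      p'.1.1 = p.1.2.1 ∧ p'.1.2.1 = p.1.2.2.1 ∧ p'.1.2.2.1 = p.1.2.2.2.1 ∧
      ∃ j : ℤ, p'.1.2.2.2.1 = p.1.1 - 3 * Q3 A B C p.1.1 p.1.2.1 p.1.2.2.1 p.1.2.2.2.1 + j ∧ 0 ≤ j ∧
        j ≤ 3 * w3 A B C p.1.1 p.1.2.1 p.1.2.2.1 p.1.2.2.2.1 ∧
        p.1.2.2.2.2 = if br4 p.1.1 p.1.2.1 p.1.2.2.1 p.1.2.2.2.1 then
          1 - ((j:ℝ) + p'.1.2.2.2.2) / (3 * (w3 A B C p.1.1 p.1.2.1 p.1.2.2.1 p.1.2.2.2.1 : ℝ) + 1) else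
          ((j:ℝ) + p'.1.2.2.2.2) / (3 * (w3 A B C p.1.1 p.1.2.1 p.1.2.2.1 p.1.2.2.2.1 : ℝ) + 1) := by
    rintro ⟨⟨a, b, c, d, τ⟩, h0, h1⟩
    dsimp only at h0 h1 ⊢
    have hw := w3_nonneg P.hA P.hB.le P.hC a b c d
    set w := w3 A B C a b c d
    have key : ∀ s : ℝ, 0 ≤ s → s ≤ 1 → ∃ j : ℤ, ∃ τ' : ℝ, 0 ≤ j ∧ j ≤ 3 * w ∧ 0 ≤ τ' ∧ τ' ≤ 1 ∧ s = ((j:ℝ) + τ') / (3 * (w:ℝ) + 1) := by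
      intro s s0 s1
      have hw' : (0:ℝ) ≤ w := by exact_mod_cast hw
      have p : (0:ℝ) < 3 * (w:ℝ) + 1 := by linarith
      rcases le_total (3 * (w:ℝ)) ((3*(w:ℝ)+1) * s) with h | h
      · refine ⟨3*w, (3*(w:ℝ)+1) * s - 3 * w, by omega, le_rfl, by linarith, ?_, ?_⟩
        · have := mul_le_mul_of_nonneg_left s1 p.le
          linarith
        · rw [eq_div_iff p.ne']; push_cast; ring
      · refine ⟨⌊(3*(w:ℝ)+1) * s⌋, (3*(w:ℝ)+1) * s - ⌊(3*(w:ℝ)+1) * s⌋, Int.floor_nonneg.mpr (by positivity), ?_, ?_, ?_, ?_⟩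
        · have : (⌊(3*(w:ℝ)+1) * s⌋ : ℝ) ≤ ((3 * w : ℤ) : ℝ) := by push_cast; exact (Int.floor_le _).trans h
          exact_mod_cast this
        · linarith [Int.floor_le ((3*(w:ℝ)+1) * s)]
        · linarith [Int.lt_floor_add_one ((3*(w:ℝ)+1) * s)]
        · rw [eq_div_iff p.ne']; ring
    by_cases hb : br4 a b c d
    · obtain ⟨j, τ', a1, a2, a3, a4, a5⟩ := key (1-τ) (by linarith) (by linarith)
      exact ⟨⟨⟨b, c, d, _, τ'⟩, a3, a4⟩, rfl, rfl, rfl, j, rfl, a1, a2, by rw [if_pos hb, ← a5]; ring⟩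
    · obtain ⟨j, τ', a1, a2, a3, a4, a5⟩ := key τ h0 h1
      exact ⟨⟨⟨b, c, d, _, τ'⟩, a3, a4⟩, rfl, rfl, rfl, j, rfl, a1, a2, by rw [if_neg hb, ← a5]⟩
  choose f f1 f2 f3 j f4 j0 j1 ft using H
  let s : ℕ → {p : ℤ × ℤ × ℤ × ℤ × ℝ // 0 ≤ p.2.2.2.2 ∧ p.2.2.2.2 ≤ 1} := fun n => f^[n] ⟨⟨a,b,c,d,τ⟩, h0, h1⟩
  have hs : ∀ n, s (n+1) = f (s n) := fun n => Function.iterate_succ_apply' _ _ _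
  have e1 : ∀ n, (s n).1.2.1 = (s (n+1)).1.1 := fun n => by rw [hs, f1]
  have e2 : ∀ n, (s n).1.2.2.1 = (s (n+2)).1.1 := fun n => by rw [← e1 (n+1), hs, f2]
  have e3 : ∀ n, (s n).1.2.2.2.1 = (s (n+3)).1.1 := fun n => by rw [← e2 (n+1), hs, f3]
  have ej : ∀ n, jj A B C (fun n => (s n).1.1) n = j (s n) := by
    intro n
    have := f4 (s n)
    rw [← hs, e3] at this
    simp only [jj, lo3]
    rw [show n + 4 = n+1+3 by ring, this, e1, e2, e3]; ring
  have ew : ∀ n, ww A B C (fun n => (s n).1.1) n = w3 A B C (s n).1.1 (s n).1.2.1 (s n).1.2.2.1 (s n).1.2.2.2.1 := by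
    intro n
    rw [e1, e2, e3]; rfl
  refine ⟨fun n => (s n).1.1, fun n => (s n).1.2.2.2.2, rfl, (e1 0).symm, (e2 0).symm, (e3 0).symm, ?_, ?_, rfl⟩
  · rw [A3_iff P.hA P.hB.le P.hC]
    intro k
    rw [ej, ew]
    exact ⟨j0 _, j1 _⟩
  · intro k
    refine ⟨(s k).2.1, (s k).2.2, ?_⟩
    have := ft (s k)
    rw [← hs] at this
    have hbr : br (fun n => (s n).1.1) k ↔ br4 (s k).1.1 (s k).1.2.1 (s k).1.2.2.1 (s k).1.2.2.2.1 := by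
      rw [e1, e2, e3]; rfl
    rw [TPs, ej, ew]
    dsimp only
    simp only [hbr]
    exact this

/-- same window, same parameter -/
theorem TP_cases {A B C : ℤ} (P : Par A B C) {Γ Γ' : ℕ → ℤ} {t t' : ℕ → ℝ} (h : A3 A B C Γ) (h' : A3 A B C Γ')
    (ht : TP A B C Γ t) (ht' : TP A B C Γ' t') {k : ℕ} (he : ∀ j < 4, Γ (k+j) = Γ' (k+j)) (hk : t k = t' k) :
    (Γ' (k+4) = Γ (k+4) ∧ t (k+1) = t' (k+1)) ∨
    (br Γ k ∧ Γ' (k+4) = Γ (k+4) + 1 ∧ t (k+1) = 1 ∧ t' (k+1) = 0) ∨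
    (br Γ k ∧ Γ (k+4) = Γ' (k+4) + 1 ∧ t' (k+1) = 1 ∧ t (k+1) = 0) := by
  have e0 : Γ k = Γ' k := he 0 (by norm_num)
  have e1 := he 1 (by norm_num)
  have e2 := he 2 (by norm_num)
  have e3 := he 3 (by norm_num)
  have ew : ww A B C Γ k = ww A B C Γ' k := by simp only [ww, e0, e1, e2, e3]
  have eb : br Γ k ↔ br Γ' k := by simp only [br, e0, e1, e2, e3]
  have el : lo3 A B C Γ k = lo3 A B C Γ' k := by simp only [lo3, e0, e1, e2, e3]
  have q : (jj A B C Γ k : ℝ) + t (k+1) = (jj A B C Γ' k : ℝ) + t' (k+1) := by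
    obtain ⟨a, b, c⟩ := h.jjR P k
    have p : (0:ℝ) < 3 * (ww A B C Γ k : ℝ) + 1 := by linarith
    rw [(ht k).2.2, (ht' k).2.2, TPs, TPs, ← ew] at hk
    have : ((jj A B C Γ k : ℝ) + t (k+1)) / (3 * (ww A B C Γ k : ℝ) + 1) = ((jj A B C Γ' k : ℝ) + t' (k+1)) / (3 * (ww A B C Γ k : ℝ) + 1) := by
      by_cases hb : br Γ k
      · rw [if_pos hb, if_pos (eb.mp hb)] at hk
        linarith
      · rw [if_neg hb, if_neg (fun x => hb (eb.mpr x))] at hk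
        exact hk
    rw [div_left_inj' p.ne'] at this
    exact this
  have m := ht (k+1)
  have m' := ht' (k+1)
  have d1 : jj A B C Γ' k - jj A B C Γ k = Γ' (k+4) - Γ (k+4) := by
    simp only [jj, el]; ring
  have jm := h.jj_mem P k
  have jm' := h'.jj_mem P k
  have hbr : jj A B C Γ k ≠ jj A B C Γ' k → br Γ k := by
    intro hne
    by_contra hb
    have : ww A B C Γ k = 0 := w3_zero hb
    omega
  have u1 : jj A B C Γ' k ≤ jj A B C Γ k + 1 := by
    have : (jj A B C Γ' k : ℝ) ≤ ((jj A B C Γ k + 1 : ℤ) : ℝ) := by push_cast; linarith [m.1, m'.1, m.2.1, m'.2.1]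
    exact_mod_cast this
  have u2 : jj A B C Γ k ≤ jj A B C Γ' k + 1 := by
    have : (jj A B C Γ k : ℝ) ≤ ((jj A B C Γ' k + 1 : ℤ) : ℝ) := by push_cast; linarith [m.1, m'.1, m.2.1, m'.2.1]
    exact_mod_cast this
  rcases (by omega : jj A B C Γ' k = jj A B C Γ k ∨ jj A B C Γ' k = jj A B C Γ k + 1 ∨ jj A B C Γ k = jj A B C Γ' k + 1) with e | e | e
  · left
    refine ⟨by omega, ?_⟩
    rw [e] at q; linarith
  · right; left
    have := hbr (by omega)
    rw [e] at q; push_cast at q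
    exact ⟨this, by omega, by linarith [m.2.1, m'.1], by linarith [m.2.1, m'.1]⟩
  · right; right
    have := hbr (by omega)
    rw [e] at q; push_cast at q
    exact ⟨this, by omega, by linarith [m'.2.1, m.1], by linarith [m'.2.1, m.1]⟩

theorem TP_ext_step {A B C : ℤ} (P : Par A B C) {Γ Γ' : ℕ → ℤ} {t t' : ℕ → ℝ} (h : A3 A B C Γ) (h' : A3 A B C Γ')
    (ht : TP A B C Γ t) (ht' : TP A B C Γ' t') {k : ℕ} (he : ∀ j < 4, Γ (k+j) = Γ' (k+j)) (hk : t k = t' k)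
    (hx : t k = 0 ∨ t k = 1) :
    Γ' (k+4) = Γ (k+4) ∧ t (k+1) = t' (k+1) ∧ (t (k+1) = 0 ∨ t (k+1) = 1) := by
  have key : ∀ {Γ : ℕ → ℤ} {t : ℕ → ℝ}, A3 A B C Γ → TP A B C Γ t → (t k = 0 ∨ t k = 1) →
      (jj A B C Γ k = 0 ∧ t (k+1) = 0) ∨ (jj A B C Γ k = 3 * ww A B C Γ k ∧ t (k+1) = 1) := by
    intro Γ t h ht hx
    obtain ⟨a, b, c⟩ := h.jjR P k
    have p : (0:ℝ) < 3 * (ww A B C Γ k : ℝ) + 1 := by linarith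
    have m := ht (k+1)
    have hs : ((jj A B C Γ k : ℝ) + t (k+1)) / (3 * (ww A B C Γ k : ℝ) + 1) = 0 ∨ ((jj A B C Γ k : ℝ) + t (k+1)) / (3 * (ww A B C Γ k : ℝ) + 1) = 1 := by
      rw [(ht k).2.2, TPs] at hx
      by_cases hb : br Γ k
      · simp only [hb, if_true] at hx
        rcases hx with hx | hx
        · right; linarith
        · left; linarith
      · simpa only [hb, if_false] using hx
    rcases hs with hs | hs
    · rw [div_eq_zero_iff] at hs
      left
      have : (jj A B C Γ k : ℝ) + t (k+1) = 0 := by rcases hs with h | h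
                                                    · exact h
                                                    · linarith
      have h0 : (jj A B C Γ k : ℝ) = 0 := by linarith [m.1]
      exact ⟨by exact_mod_cast h0, by linarith⟩
    · rw [div_eq_one_iff_eq p.ne'] at hs
      right
      have h0 : (jj A B C Γ k : ℝ) = ((3 * ww A B C Γ k : ℤ) : ℝ) := by push_cast; linarith [m.2.1]
      exact ⟨by exact_mod_cast h0, by push_cast at h0; linarith⟩
  have k1 := key h ht hx
  have k2 := key h' ht' (hk ▸ hx)
  have ht1 : t (k+1) = 0 ∨ t (k+1) = 1 := by
    rcases k1 with k1 | k1
    · exact Or.inl k1.2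
    · exact Or.inr k1.2
  rcases TP_cases P h h' ht ht' he hk with c | ⟨b, c1, c2, c3⟩ | ⟨b, c1, c2, c3⟩
  · exact ⟨c.1, c.2, ht1⟩
  all_goals
    exfalso
    have e0 : Γ k = Γ' k := he 0 (by norm_num)
    have e1 := he 1 (by norm_num)
    have e2 := he 2 (by norm_num)
    have e3 := he 3 (by norm_num)
    have ew : ww A B C Γ k = ww A B C Γ' k := by simp only [ww, e0, e1, e2, e3]
    have el : lo3 A B C Γ k = lo3 A B C Γ' k := by simp only [lo3, e0, e1, e2, e3]
    have d1 : jj A B C Γ' k - jj A B C Γ k = Γ' (k+4) - Γ (k+4) := by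
      simp only [jj, el]; ring
    have jm := h.jj_mem P k
    have jm' := h'.jj_mem P k
    rcases k1 with ⟨a1, b1⟩ | ⟨a1, b1⟩ <;> rcases k2 with ⟨a2, b2⟩ | ⟨a2, b2⟩ <;> first | omega | linarith

theorem TP_ext_eq {A B C : ℤ} (P : Par A B C) {Γ Γ' : ℕ → ℤ} {t t' : ℕ → ℝ} (h : A3 A B C Γ) (h' : A3 A B C Γ')
    (ht : TP A B C Γ t) (ht' : TP A B C Γ' t') {k : ℕ} (he : ∀ j < 4, Γ (k+j) = Γ' (k+j)) (hk : t k = t' k)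
    (hx : t k = 0 ∨ t k = 1) : ∀ j, Γ (k+j) = Γ' (k+j) := by
  have : ∀ n, (∀ j < 4, Γ (k+n+j) = Γ' (k+n+j)) ∧ t (k+n) = t' (k+n) ∧ (t (k+n) = 0 ∨ t (k+n) = 1) := by
    intro n
    induction n with
    | zero => exact ⟨he, hk, hx⟩
    | succ n ih =>
      have s := TP_ext_step P h h' ht ht' ih.1 ih.2.1 ih.2.2
      refine ⟨fun j hj => ?_, s.2⟩
      rw [show k + (n+1) + j = k+n+(j+1) by ring]
      by_cases h3 : j = 3
      · subst h3; exact s.1.symm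
      · exact ih.1 _ (by omega)
  intro j
  exact (this j).1 0 (by norm_num)

theorem first_diff {Γ Γ' : ℕ → ℤ} (he : ∀ j < 4, Γ j = Γ' j) (hne : Γ ≠ Γ') :
    ∃ m, (∀ j < m + 4, Γ j = Γ' j) ∧ Γ (m+4) ≠ Γ' (m+4) := by
  classical
  have : ∃ n, Γ n ≠ Γ' n := by
    by_contra hc; push Not at hc; exact hne (funext hc)
  have h1 := Nat.find_spec this
  have h2 : ∀ j < Nat.find this, Γ j = Γ' j := fun j hj => by
    have := Nat.find_min this hj; push Not at this; exact this
  have h4 : 4 ≤ Nat.find this := by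
    by_contra hc; exact h1 (he _ (by omega))
  refine ⟨Nat.find this - 4, fun j hj => h2 j (by omega), ?_⟩
  rw [show Nat.find this - 4 + 4 = Nat.find this by omega]; exact h1

/-- equal parameters propagate along an agreeing prefix -/
theorem TP_prefix {A B C : ℤ} (P : Par A B C) {Γ Γ' : ℕ → ℤ} {t t' : ℕ → ℝ} (h : A3 A B C Γ) (h' : A3 A B C Γ')
    (ht : TP A B C Γ t) (ht' : TP A B C Γ' t') (m : ℕ) (he : ∀ j < m + 4, Γ j = Γ' j) :
    t 0 = t' 0 ↔ t m = t' m := by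
  constructor
  · intro h0
    have : ∀ n ≤ m, t n = t' n := by
      intro n
      induction n with
      | zero => intro _; exact h0
      | succ n ih =>
        intro hn
        rcases TP_cases P h h' ht ht' (k := n) (fun j hj => he _ (by omega)) (ih (by omega)) with c | c | c
        · exact c.2
        · have := he (n+4) (by omega); omega
        · have := he (n+4) (by omega); omega
    exact this m le_rfl
  · intro hm
    have : ∀ n ≤ m, t (m-n) = t' (m-n) := by
      intro n
      induction n with
      | zero => intro _; exact hm
      | succ n ih =>
        intro hn
        have e := TP_step P h ht ht' (k := m-(n+1)) (fun j hj => he _ (by omega))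
        rw [show m - (n+1) + 1 = m - n by omega, ih (by omega)] at e
        simp only [sub_self, abs_zero, zero_div, abs_eq_zero] at e
        linarith
    simpa using this m le_rfl

theorem TP_split {A B C : ℤ} (P : Par A B C) {Γ Γ' : ℕ → ℤ} {t t' : ℕ → ℝ} (h : A3 A B C Γ) (h' : A3 A B C Γ')
    (ht : TP A B C Γ t) (ht' : TP A B C Γ' t') (he : ∀ j < 4, Γ j = Γ' j) (h0 : t 0 = t' 0) (hne : Γ ≠ Γ') :
    ∃ m, (∀ j < m + 4, Γ j = Γ' j) ∧ br Γ m ∧ 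
    ((Γ' (m+4) = Γ (m+4) + 1 ∧ t (m+1) = 1 ∧ t' (m+1) = 0) ∨
     (Γ (m+4) = Γ' (m+4) + 1 ∧ t' (m+1) = 1 ∧ t (m+1) = 0)) := by
  obtain ⟨m, hm, hd⟩ := first_diff he hne
  have e := (TP_prefix P h h' ht ht' m hm).mp h0
  rcases TP_cases P h h' ht ht' (k := m) (fun j hj => hm _ (by omega)) e with c | c | c
  · exact absurd c.1.symm hd
  · exact ⟨m, hm, c.1, Or.inl c.2⟩
  · exact ⟨m, hm, c.1, Or.inr c.2⟩

/-! quadruples -/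
def d4 (a b c d : ℤ) : Prop := a % 4 ≠ b % 4 ∧ a % 4 ≠ c % 4 ∧ a % 4 ≠ d % 4 ∧ b % 4 ≠ c % 4 ∧ b % 4 ≠ d % 4 ∧ c % 4 ≠ d % 4

def Q4 (A B C a b c d : ℤ) : ℤ := (A-1) * ((d-a)/4) + (B-A) * ((c-a)/4) + (C-B) * ((b-a)/4)

theorem step4 {A B C : ℤ} (P : Par A B C) {a b c d : ℤ} (hd : d4 a b c d) (e : ℤ) :
    (∀ i : ℤ, 0 ≤ (e+i)/4 + (A-1)*((d+i)/4) + (B-A)*((c+i)/4) + (C-B)*((b+i)/4) - C*((a+i)/4) ∧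
      (e+i)/4 + (A-1)*((d+i)/4) + (B-A)*((c+i)/4) + (C-B)*((b+i)/4) - C*((a+i)/4) < C) ↔
    e = a - 4 * Q4 A B C a b c d := by
  obtain ⟨hA, hB, hC⟩ := P
  unfold Q4
  unfold d4 at hd
  constructor
  · intro h
    have h1 := (h (-a)).1
    have h2 := (h (3-a)).2
    simp only [← sub_eq_add_neg, sub_self] at h1
    rw [show (d + (3-a))/4 = (d-a)/4 + 1 by omega, show (c + (3-a))/4 = (c-a)/4 + 1 by omega, show (b + (3-a))/4 = (b-a)/4 + 1 by omega,
      show a+(3-a) = 3 by ring, show e + (3-a) = (e-a)+3 by ring] at h2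
    norm_num at h1 h2
    generalize (d-a)/4 = x at *
    generalize (c-a)/4 = y at *
    generalize (b-a)/4 = z at *
    have e1 : (e-a)/4 ≥ -((A-1)*x + (B-A)*y+(C-B)*z) := by linarith
    have e2 : (e-a+3)/4 ≤ -((A-1)*x + (B-A)*y+(C-B)*z) := by
      have : C = A - 1 + (B-A) + (C-B) + 1 := by ring
      nlinarith
    generalize (A-1)*x + (B-A)*y+(C-B)*z = Z at *
    omega
  · intro he i
    obtain ⟨r, s, hr0, hr2, hi⟩ : ∃ r s : ℤ, 0 ≤ r ∧ r ≤ 3 ∧ i = -a + r + 4 * s :=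
      ⟨(i+a)%4, (i+a)/4, by omega, by omega, by omega⟩
    have sh : ∀ x, (x+i)/4 = (x - a + r)/4 + s := fun x => by rw [hi]; omega
    have mo : ∀ x : ℤ, x/4 ≤ (x+r)/4 ∧ (x+r)/4 ≤ x/4+1 := fun x => by
      constructor <;> omega
    rw [sh, sh, sh, sh, sh]
    have ra : (a - a + r)/4 = 0 := by omega
    rw [ra]
    have md := mo (d-a)
    have mc := mo (c-a)
    have mb := mo (b-a)
    have e1 : (e-a+r)/4 = -((A-1) * ((d-a)/4) + (B-A) * ((c-a)/4) + (C-B) * ((b-a)/4)) := by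
      generalize (A-1) * ((d-a)/4) + (B-A) * ((c-a)/4) + (C-B) * ((b-a)/4) = P at *
      omega
    have l1 := mul_le_mul_of_nonneg_left md.1 (by linarith : 0 ≤ A - 1)
    have l2 := mul_le_mul_of_nonneg_left mc.1 (by linarith : 0 ≤ B - A)
    have l3 := mul_le_mul_of_nonneg_left mb.1 (by linarith : 0 ≤ C - B)
    have u1 := mul_le_mul_of_nonneg_left md.2 (by linarith : 0 ≤ A - 1)
    have u2 := mul_le_mul_of_nonneg_left mc.2 (by linarith : 0 ≤ B - A)
    have u3 := mul_le_mul_of_nonneg_left mb.2 (by linarith : 0 ≤ C - B)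
    rw [e1]
    constructor <;> linarith

structure V4 (A B C : ℤ) (Θ : ℕ → ℤ) : Prop where
  dst : ∀ k, d4 (Θ k) (Θ (k+1)) (Θ (k+2)) (Θ (k+3))
  rc : ∀ k, Θ (k+4) = Θ k - 4 * Q4 A B C (Θ k) (Θ (k+1)) (Θ (k+2)) (Θ (k+3))

theorem d4_succ {a b c d e q : ℤ} (h : d4 a b c d) (he : e = a - 4 * q) : d4 b c d e := by
  unfold d4 at *
  have : e % 4 = a % 4 := by omega
  rw [this]
  omega

theorem V4.of_adr {A B C : ℤ} (P : Par A B C) {Θ : ℕ → ℤ} (h0 : d4 (Θ 0) (Θ 1) (Θ 2) (Θ 3))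
    (h : ∀ i : ℤ, Adr A B C (fun n => (Θ n + i) / 4)) : V4 A B C Θ := by
  have key : ∀ k, d4 (Θ k) (Θ (k+1)) (Θ (k+2)) (Θ (k+3)) := by
    intro k
    induction k with
    | zero => exact h0
    | succ k ih => exact d4_succ ih ((step4 P ih (Θ (k+4))).mp (fun i => h i k))
  exact ⟨key, fun k => (step4 P (key k) (Θ (k+4))).mp (fun i => h i k)⟩

theorem V4.adr {A B C : ℤ} (P : Par A B C) {Θ : ℕ → ℤ} (h : V4 A B C Θ) (i : ℤ) : Adr A B C (fun n => (Θ n + i) / 4) :=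
  fun k => (step4 P (h.dst k) (Θ (k+4))).mpr (h.rc k) i

theorem V4_exists {A B C : ℤ} {a b c d : ℤ} (h : d4 a b c d) :
    ∃ Θ, Θ 0 = a ∧ Θ 1 = b ∧ Θ 2 = c ∧ Θ 3 = d ∧ V4 A B C Θ := by
  obtain ⟨Θ, h0, h1, h2, h3, hr⟩ := rec4 a b c d (fun _ a b c d => a - 4 * Q4 A B C a b c d)
  refine ⟨Θ, h0, h1, h2, h3, ?_, hr⟩
  intro k
  induction k with
  | zero => simpa only [zero_add, h0, h1, h2, h3] using h
  | succ k ih => exact d4_succ ih (hr k)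

def om (m x : ℤ) : ℤ := x - (x + m) / 4

theorem om_div (m x i : ℤ) : (om m x + i) / 3 = (x + (m + 1 + (i - m) % 3)) / 4 + (i - m) / 3 := by
  unfold om
  have hi : i = m + (i-m)%3 + 3 * ((i-m)/3) := by omega
  have h0 : 0 ≤ (i-m)%3 := by omega
  have h2 : (i-m)%3 ≤ 2 := by omega
  generalize (i-m)%3 = j at *
  generalize (i-m)/3 = q at *
  omega

theorem V4.a3 {A B C : ℤ} (P : Par A B C) {Θ : ℕ → ℤ} (h : V4 A B C Θ) (m : ℤ) : A3 A B C (fun n => om m (Θ n)) := by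
  intro i
  simp only [om_div]
  exact (h.adr P _).addc _

def ev (m a b c : ℤ) : ℤ :=
  if (a+m)%4 = 3 then 1 else if (a+m)%4 = 0 then 0 else
  if (b+m)%4 = 3 then 1 else if (b+m)%4 = 0 then 0 else
  if (c+m)%4 = 3 then 1 else 0

theorem ev_mem (m a b c : ℤ) : 0 ≤ ev m a b c ∧ ev m a b c ≤ 1 := by
  unfold ev; split_ifs <;> norm_num

theorem om_lo {m a x : ℤ} (ha : (a+m)%4 ≠ 0) (hx : (a+m)%4 ≠ (x+m)%4) : (om m x - om m a)/3 = (x-a)/4 := by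
  unfold om; omega

theorem om_up {m a x : ℤ} (ha : (a+m)%4 = 0) (hx : (a+m)%4 ≠ (x+m)%4) : (om m x - om m a)/3 = (x-a)/4 + dv (om m x - om m a) := by
  unfold om dv; split_ifs <;> omega

theorem om_br {m a b c d : ℤ} (h : d4 a b c d) : br4 (om m a) (om m b) (om m c) (om m d) ↔ ((a+m)%4 = 0 ∨ (a+m)%4=3) := by
  unfold d4 at h
  have k : ∀ x, a % 4 ≠ x % 4 → (om m x % 3 = om m a % 3 ↔ ((a+m)%4 = 0 ∧ (x+m)%4=3 ∨ (a+m)%4=3 ∧ (x+m)%4=0)) := by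
    intro x hx; unfold om; omega
  unfold br4
  rw [k b h.1, k c h.2.1, k d h.2.2.1]
  have s0 : (a+m)%4 = 0 → ((b+m)%4=3 ∨ (c+m)%4=3 ∨ (d+m)%4=3) := by omega
  have s3 : (a+m)%4 = 3 → ((b+m)%4=0 ∨ (c+m)%4=0 ∨ (d+m)%4=0) := by omega
  clear k h
  constructor
  · rintro (h1 | h1 | h1) <;> rcases h1 with h1 | h1 <;> simp [h1.1]
  · rintro (h1 | h1)
    · have := s0 h1; simp [h1]; exact this
    · have := s3 h1; simp [h1]; omega

theorem V4.jj_eq {A B C : ℤ} {Θ : ℕ → ℤ} (h : V4 A B C Θ) (m : ℤ) (k : ℕ) :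
    jj A B C (fun n => om m (Θ n)) k = if (Θ k + m) % 4 = 0 then 3 * ww A B C (fun n => om m (Θ n)) k else 0 := by
  have e : om m (Θ (k+4)) = om m (Θ k) - 3 * Q4 A B C (Θ k) (Θ (k+1)) (Θ (k+2)) (Θ (k+3)) := by
    rw [h.rc k]; unfold om; omega
  have hd := h.dst k
  unfold d4 at hd
  simp only [jj, lo3, ww]
  rw [e]
  split_ifs with h0
  · simp only [Q3, Q4, w3]
    rw [om_up h0 (x := Θ (k+1)) (by omega), om_up h0 (x := Θ (k+2)) (by omega), om_up h0 (x := Θ (k+3)) (by omega)]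
    ring
  · simp only [Q3, Q4]
    rw [om_lo h0 (x := Θ (k+1)) (by omega), om_lo h0 (x := Θ (k+2)) (by omega), om_lo h0 (x := Θ (k+3)) (by omega)]
    ring

theorem V4.tp {A B C : ℤ} (P : Par A B C) {Θ : ℕ → ℤ} (h : V4 A B C Θ) (m : ℤ) :
    TP A B C (fun n => om m (Θ n)) (fun k => (ev m (Θ k) (Θ (k+1)) (Θ (k+2)) : ℝ)) := by
  intro k
  have hm := ev_mem m (Θ k) (Θ (k+1)) (Θ (k+2))
  refine ⟨by dsimp only; exact_mod_cast hm.1, by dsimp only; exact_mod_cast hm.2, ?_⟩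
  have hj := h.jj_eq m k
  have hb : br (fun n => om m (Θ n)) k ↔ _ := om_br (h.dst k) (m := m)
  have hd := h.dst k
  have e4 : (Θ (k+4) + m) % 4 = (Θ k + m) % 4 := by rw [h.rc k]; omega
  have p : (0:ℝ) < 3 * (ww A B C (fun n => om m (Θ n)) k : ℝ) + 1 := by
    have := ((h.a3 P m).jjR P k).2.2; linarith
  unfold d4 at hd
  show (ev m (Θ k) (Θ (k+1)) (Θ (k+2)) : ℝ) = TPs A B C _ k (ev m (Θ (k+1)) (Θ (k+2)) (Θ (k+3)) : ℝ)
  unfold TPs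
  by_cases h0 : (Θ k + m) % 4 = 0
  · rw [if_pos (hb.mpr (Or.inl h0)), hj, if_pos h0]
    have e1 : ev m (Θ k) (Θ (k+1)) (Θ (k+2)) = 0 := by unfold ev; split_ifs <;> omega
    have e2 : ev m (Θ (k+1)) (Θ (k+2)) (Θ (k+3)) = 1 := by unfold ev; split_ifs <;> omega
    rw [e1, e2]; push_cast; rw [div_self p.ne']; norm_num
  · by_cases h3 : (Θ k + m) % 4 = 3
    · rw [if_pos (hb.mpr (Or.inr h3)), hj, if_neg h0]
      have e1 : ev m (Θ k) (Θ (k+1)) (Θ (k+2)) = 1 := by unfold ev; split_ifs <;> omega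
      have e2 : ev m (Θ (k+1)) (Θ (k+2)) (Θ (k+3)) = 0 := by unfold ev; split_ifs <;> omega
      rw [e1, e2]; push_cast; norm_num
    · have hn : ¬ br (fun n => om m (Θ n)) k := fun hh => by have := hb.mp hh; omega
      rw [if_neg hn, hj, if_neg h0]
      have hw : ww A B C (fun n => om m (Θ n)) k = 0 := w3_zero hn
      have e1 : ev m (Θ k) (Θ (k+1)) (Θ (k+2)) = ev m (Θ (k+1)) (Θ (k+2)) (Θ (k+3)) := by
        unfold ev; split_ifs <;> omega
      rw [hw, e1]; simp

theorem A3.shift {A B C : ℤ} {Γ : ℕ → ℤ} (h : A3 A B C Γ) (n : ℕ) : A3 A B C (fun k => Γ (n+k)) :=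
  fun i k => h i (n+k)

theorem TP.shift {A B C : ℤ} {Γ : ℕ → ℤ} {t : ℕ → ℝ} (h : TP A B C Γ t) (n : ℕ) :
    TP A B C (fun k => Γ (n+k)) (fun k => t (n+k)) :=
  fun k => h (n+k)

theorem D5 (p q r s : ℤ) (h1 : p % 3 ≠ q % 3) (h2 : p % 3 ≠ r % 3) (h3 : q % 3 ≠ r % 3) :
    ∃ m a b c d, d4 a b c d ∧ om m a = p ∧ om m b = q ∧ om m c = r ∧ om m d = s ∧ ev m a b c = 1 ∧
      om (m-1) a = p ∧ om (m-1) b = q ∧ om (m-1) c = r ∧ om (m-1) d = s + 1 ∧ ev (m-1) a b c = 0 := by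
  let f : ℤ → ℤ := fun x => if x % 3 ≤ s % 3 then 4 * (x/3) + x % 3 else 4 * (x/3) + x % 3 + 1
  have key : ∀ x, f x % 4 = (if x % 3 ≤ s % 3 then x % 3 else x % 3 + 1) ∧ om (3 - s % 3) (f x) = x ∧ om (2 - s % 3) (f x) = x := by
    intro x
    simp only [f, om]
    split_ifs <;> omega
  have kp := key p
  have kq := key q
  have kr := key r
  refine ⟨3 - s % 3, f p, f q, f r, 4 * (s/3) + s % 3 + 1, ?_, kp.2.1, kq.2.1, kr.2.1, ?_, ?_, ?_, ?_, ?_, ?_, ?_⟩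
  · have e : (4 * (s/3) + s % 3 + 1) % 4 = s % 3 + 1 := by omega
    unfold d4
    rw [kp.1, kq.1, kr.1, e]
    clear e key kp kq kr
    generalize s % 3 = σ at *
    split_ifs <;> omega
  · unfold om; omega
  · unfold ev
    generalize f p = P at *
    generalize f q = Q at *
    generalize f r = R at *
    clear key f
    have k1 := kp.1
    have k2 := kq.1
    have k3 := kr.1
    clear kp kq kr
    split_ifs at * <;> omega
  · rw [show 3 - s % 3 - 1 = 2 - s % 3 by ring]; exact kp.2.2
  · rw [show 3 - s % 3 - 1 = 2 - s % 3 by ring]; exact kq.2.2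
  · rw [show 3 - s % 3 - 1 = 2 - s % 3 by ring]; exact kr.2.2
  · unfold om; omega
  · rw [show 3 - s % 3 - 1 = 2 - s % 3 by ring]
    unfold ev
    generalize f p = P at *
    generalize f q = Q at *
    generalize f r = R at *
    clear key f
    have k1 := kp.1
    have k2 := kq.1
    have k3 := kr.1
    clear kp kq kr
    split_ifs at * <;> omega

theorem fin4 {f g : ℕ → ℤ} (h0 : f 0 = g 0) (h1 : f 1 = g 1) (h2 : f 2 = g 2) (h3 : f 3 = g 3) : ∀ j < 4, f (0+j) = g (0+j) := by
  intro j hj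
  interval_cases j <;> assumption

theorem ext_is_om {A B C : ℤ} (P : Par A B C) {Γ Θ : ℕ → ℤ} {t : ℕ → ℝ} (h : A3 A B C Γ) (ht : TP A B C Γ t)
    (hΘ : V4 A B C Θ) (m : ℤ) (h0 : om m (Θ 0) = Γ 0) (h1 : om m (Θ 1) = Γ 1) (h2 : om m (Θ 2) = Γ 2) (h3 : om m (Θ 3) = Γ 3)
    (he : t 0 = (ev m (Θ 0) (Θ 1) (Θ 2) : ℝ)) : ∀ j, Γ j = om m (Θ j) := by
  have := TP_ext_eq P h (hΘ.a3 P m) ht (hΘ.tp P m) (k := 0) (fin4 (g := fun n => om m (Θ n)) h0.symm h1.symm h2.symm h3.symm) he (by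
    rw [he]
    have := ev_mem m (Θ 0) (Θ 1) (Θ 2)
    rcases (by omega : ev m (Θ 0) (Θ 1) (Θ 2) = 0 ∨ ev m (Θ 0) (Θ 1) (Θ 2) = 1) with e | e <;> simp [e])
  simpa using this

theorem rev_aux {A B C : ℤ} (P : Par A B C) {Γ Γ' : ℕ → ℤ} {t t' : ℕ → ℝ} (h : A3 A B C Γ) (h' : A3 A B C Γ')
    (ht : TP A B C Γ t) (ht' : TP A B C Γ' t') (d1 : Γ 0 % 3 ≠ Γ 1 % 3) (d2 : Γ 0 % 3 ≠ Γ 2 % 3) (d3 : Γ 1 % 3 ≠ Γ 2 % 3)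
    (e0 : Γ' 0 = Γ 0) (e1 : Γ' 1 = Γ 1) (e2 : Γ' 2 = Γ 2) (e3 : Γ' 3 = Γ 3 + 1) (ht0 : t 0 = 1) (ht0' : t' 0 = 0) :
    ∀ k, Γ k ≤ Γ' k ∧ Γ' k ≤ Γ k + 1 := by
  obtain ⟨m, a, b, c, d, hd, ma, mb, mc, md, me, na, nb, nc, nd, ne⟩ := D5 (Γ 0) (Γ 1) (Γ 2) (Γ 3) d1 d2 d3
  obtain ⟨Θ, rfl, rfl, rfl, rfl, hΘ⟩ := V4_exists (A := A) (B := B) (C := C) hd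
  have k1 := ext_is_om P h ht hΘ m ma mb mc md (by rw [me, ht0]; norm_num)
  have k2 := ext_is_om P h' ht' hΘ (m-1) (by rw [na, e0]) (by rw [nb, e1]) (by rw [nc, e2]) (by rw [nd, e3]) (by rw [ne, ht0']; norm_num)
  intro k
  rw [k1, k2]
  unfold om; omega

/-- same window and parameter: bounded difference -/
theorem rev_same {A B C : ℤ} (P : Par A B C) {Γ Γ' : ℕ → ℤ} {t t' : ℕ → ℝ} (h : A3 A B C Γ) (h' : A3 A B C Γ')
    (ht : TP A B C Γ t) (ht' : TP A B C Γ' t') (hs : SJ Γ 0) (he : ∀ j < 4, Γ j = Γ' j) (h0 : t 0 = t' 0) :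
    ∀ k, Γ k - 1 ≤ Γ' k ∧ Γ' k ≤ Γ k + 1 := by
  by_cases hne : Γ = Γ'
  · intro k; rw [hne]; omega
  obtain ⟨m, hm, hb, hc⟩ := TP_split P h h' ht ht' he h0 hne
  have bd := bdist (h.sj_all P.hA P.hB.le P.hC hs m) hb
  have key : ∀ j, Γ (m+1+j) - 1 ≤ Γ' (m+1+j) ∧ Γ' (m+1+j) ≤ Γ (m+1+j) + 1 := by
    have f1 := hm (m+1) (by omega)
    have f2 := hm (m+2) (by omega)
    have f3 := hm (m+3) (by omega)
    rcases hc with ⟨c1, c2, c3⟩ | ⟨c1, c2, c3⟩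
    · have := rev_aux P (h.shift (m+1)) (h'.shift (m+1)) (ht.shift (m+1)) (ht'.shift (m+1)) bd.1 bd.2.1 bd.2.2
        f1.symm f2.symm f3.symm c1 c2 c3
      intro j; have := this j; omega
    · have := rev_aux P (h'.shift (m+1)) (h.shift (m+1)) (ht'.shift (m+1)) (ht.shift (m+1)) 
        (by show Γ' (m+1) % 3 ≠ Γ' (m+2) % 3; rw [← f1, ← f2]; exact bd.1)
        (by show Γ' (m+1) % 3 ≠ Γ' (m+3) % 3; rw [← f1, ← f3]; exact bd.2.1)
        (by show Γ' (m+2) % 3 ≠ Γ' (m+3) % 3; rw [← f2, ← f3]; exact bd.2.2)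
        f1 f2 f3 c1 c2 c3
      intro j; have := this j; omega
  intro k
  by_cases hk : k ≤ m
  · rw [hm k (by omega)]; omega
  · have := key (k - (m+1))
    rwa [show m+1+(k-(m+1)) = k by omega] at this

def Ncw (f : ℕ → ℤ) : Prop := ¬ (f 1 = f 0 ∧ f 2 = f 0 ∧ f 3 = f 0)

theorem Ncw.both {f : ℕ → ℤ} (h : Ncw f) {m : ℤ} (hb : ∀ k, m ≤ f k ∧ f k ≤ m + 1) :
    (f 0 = m ∨ f 1 = m ∨ f 2 = m ∨ f 3 = m) ∧ (f 0 = m + 1 ∨ f 1 = m + 1 ∨ f 2 = m + 1 ∨ f 3 = m + 1) := by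
  unfold Ncw at h
  have h0 := hb 0
  have h1 := hb 1
  have h2 := hb 2
  have h3 := hb 3
  omega

theorem d4_of_all {a b c d : ℤ} (h0 : a % 4 = 0 ∨ b % 4 = 0 ∨ c % 4 = 0 ∨ d % 4 = 0)
    (h1 : a % 4 = 1 ∨ b % 4 = 1 ∨ c % 4 = 1 ∨ d % 4 = 1) (h2 : a % 4 = 2 ∨ b % 4 = 2 ∨ c % 4 = 2 ∨ d % 4 = 2)
    (h3 : a % 4 = 3 ∨ b % 4 = 3 ∨ c % 4 = 3 ∨ d % 4 = 3) : d4 a b c d := by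
  unfold d4
  generalize a % 4 = a at *
  generalize b % 4 = b at *
  generalize c % 4 = c at *
  generalize d % 4 = d at *
  omega

theorem bd_shift3 {h Γ : ℕ → ℤ} (hb : BdInc (fun n => h n - Γ n / 3)) (i : ℤ) : BdInc (fun n => h n - (Γ n + i) / 3) := by
  have := hb.sub (BdInc.of_bdd (G := fun n => (Γ n + i)/3 - Γ n / 3) (i/3) 1 (fun k => by omega))
  convert this using 2
  ring

/-- quadruples from a triple and another tile -/
theorem lemQ {A B C : ℤ} {T : Set (Fin 3 → ℝ)} (S : Std A B C T) {Γ h : ℕ → ℤ} (hΓ : A3 A B C Γ) (hs : SJ Γ 0)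
    (hh : Adr A B C h) (hb : BdInc (fun n => h n - Γ n / 3))
    (hn : ∀ i : ℤ, 0 ≤ i → i < 3 → Ncw (fun n => h n - (Γ n + i) / 3)) :
    ∃ c m : ℤ, 1 ≤ m ∧ m ≤ 3 ∧ V4 A B C (fun n => Γ n + h n - c) ∧ (∀ n, Γ n = om m (Γ n + h n - c)) ∧
      ∀ n, h n = (Γ n + h n - c + m) / 4 + c := by
  have bin : ∀ i : ℤ, 0 ≤ i → i < 3 → ∃ m, ∀ k, m ≤ h k - (Γ k + i) / 3 ∧ h k - (Γ k + i) / 3 ≤ m + 1 := by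
    intro i h0 h3
    exact (NbSeq.of_adr (hΓ i) hh (bd_shift3 hb i)).bin S (hn i h0 h3)
  obtain ⟨c, b0⟩ := bin 0 le_rfl (by norm_num)
  obtain ⟨m1, b1⟩ := bin 1 (by norm_num) (by norm_num)
  obtain ⟨m2, b2⟩ := bin 2 (by norm_num) (by norm_num)
  have n0 := (hn 0 le_rfl (by norm_num)).both b0
  have n1 := (hn 1 (by norm_num) (by norm_num)).both b1
  have n2 := (hn 2 (by norm_num) (by norm_num)).both b2
  clear bin
  -- residues
  have sj0 := hs
  unfold SJ sj at sj0
  simp only [zero_add, add_zero] at sj0 b0 n0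
  have hm1 : m1 = c - 1 ∨ m1 = c := by
    have a0 := b0 0
    have a1 := b0 1
    have a2 := b0 2
    have a3 := b0 3
    clear hn hb hh hs hΓ sj0 n2 n0 b0 b1 b2
    omega
  have hm2 : m2 = c - 1 ∨ m2 = c := by
    have a0 := b0 0
    have a1 := b0 1
    have a2 := b0 2
    have a3 := b0 3
    clear hn hb hh hs hΓ sj0 n1 n0 b0 b1 b2
    omega
  have main : ∀ m : ℤ, 1 ≤ m → m ≤ 3 → (∀ n, Γ n = om m (Γ n + h n - c)) → (∀ n, h n = (Γ n + h n - c + m) / 4 + c) →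
      d4 (Γ 0 + h 0 - c) (Γ 1 + h 1 - c) (Γ 2 + h 2 - c) (Γ 3 + h 3 - c) → 
      ∃ c m : ℤ, 1 ≤ m ∧ m ≤ 3 ∧ V4 A B C (fun n => Γ n + h n - c) ∧ (∀ n, Γ n = om m (Γ n + h n - c)) ∧
      ∀ n, h n = (Γ n + h n - c + m) / 4 + c := by
    intro m ha hb' he hf hd
    refine ⟨c, m, ha, hb', V4.of_adr S.par hd ?_, he, hf⟩
    intro i
    by_cases him : (i - m) % 4 = 0
    · have : (fun n => (Γ n + h n - c + i)/4) = fun n => h n + ((i-m)/4 - c) := by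
        funext n; have := hf n; omega
      rw [this]; exact hh.addc _
    · have : (fun n => (Γ n + h n - c + i)/4) = fun n => (Γ n + (m + ((i-m)%4 - 1))) / 3 + (i-m)/4 := by
        funext n
        have h1 := om_div m (Γ n + h n - c) (m + ((i-m)%4 - 1))
        rw [← he n] at h1
        rw [h1]
        omega
      rw [this]; exact (hΓ _).addc _
  clear hn hb hh hΓ
  rcases hm1 with e1 | e1
  · -- between 0 and 1
    refine main 1 le_rfl (by norm_num) (fun n => ?_) (fun n => ?_) ?_
    · have := b0 n; have := b1 n; unfold om; clear main n0 n1 n2 b0 b1 b2 sj0; omega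
    · have := b0 n; have := b1 n; clear main n0 n1 n2 b0 b1 b2 sj0; omega
    · have key : ∀ k, ((Γ k + h k - c) % 4 = 0 ↔ Γ k % 3 = 0) ∧ ((Γ k + h k - c) % 4 = 1 ↔ Γ k % 3 = 1) ∧
          ((Γ k + h k - c) % 4 = 2 ↔ h k - (Γ k + 1)/3 = m1) ∧ ((Γ k + h k - c) % 4 = 3 ↔ h k - Γ k/3 = c + 1) := by
        intro k; have := b0 k; have := b1 k; clear main n0 n1 n2 b0 b1 b2 sj0; omega
      apply d4_of_all
      · rw [(key 0).1, (key 1).1, (key 2).1, (key 3).1]; exact sj0.1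
      · rw [(key 0).2.1, (key 1).2.1, (key 2).2.1, (key 3).2.1]; exact sj0.2.1
      · rw [(key 0).2.2.1, (key 1).2.2.1, (key 2).2.2.1, (key 3).2.2.1]; exact n1.1
      · rw [(key 0).2.2.2, (key 1).2.2.2, (key 2).2.2.2, (key 3).2.2.2]; exact n0.2
  · rcases hm2 with e2 | e2
    · refine main 2 (by norm_num) (by norm_num) (fun n => ?_) (fun n => ?_) ?_
      · have := b2 n; have := b1 n; unfold om; clear main n0 n1 n2 b0 b1 b2 sj0; omega
      · have := b2 n; have := b1 n; clear main n0 n1 n2 b0 b1 b2 sj0; omega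
      · have key : ∀ k, ((Γ k + h k - c) % 4 = 0 ↔ Γ k % 3 = 0) ∧ ((Γ k + h k - c) % 4 = 1 ↔ h k - (Γ k + 2)/3 = m2) ∧
            ((Γ k + h k - c) % 4 = 2 ↔ h k - (Γ k + 1)/3 = m1 + 1) ∧ ((Γ k + h k - c) % 4 = 3 ↔ Γ k % 3 = 2) := by
          intro k; have := b1 k; have := b2 k; clear main n0 n1 n2 b0 b1 b2 sj0; omega
        apply d4_of_all
        · rw [(key 0).1, (key 1).1, (key 2).1, (key 3).1]; exact sj0.1
        · rw [(key 0).2.1, (key 1).2.1, (key 2).2.1, (key 3).2.1]; exact n2.1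
        · rw [(key 0).2.2.1, (key 1).2.2.1, (key 2).2.2.1, (key 3).2.2.1]; exact n1.2
        · rw [(key 0).2.2.2, (key 1).2.2.2, (key 2).2.2.2, (key 3).2.2.2]; exact sj0.2.2
    · refine main 3 (by norm_num) (by norm_num) (fun n => ?_) (fun n => ?_) ?_
      · have := b0 n; have := b2 n; unfold om; clear main n0 n1 n2 b0 b1 b2 sj0; omega
      · have := b0 n; have := b2 n; clear main n0 n1 n2 b0 b1 b2 sj0; omega
      · have key : ∀ k, ((Γ k + h k - c) % 4 = 0 ↔ h k - Γ k/3 = c) ∧ ((Γ k + h k - c) % 4 = 1 ↔ h k - (Γ k + 2)/3 = m2 + 1) ∧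
            ((Γ k + h k - c) % 4 = 2 ↔ Γ k % 3 = 1) ∧ ((Γ k + h k - c) % 4 = 3 ↔ Γ k % 3 = 2) := by
          intro k; have := b0 k; have := b2 k; clear main n0 n1 n2 b0 b1 b2 sj0; omega
        apply d4_of_all
        · rw [(key 0).1, (key 1).1, (key 2).1, (key 3).1]; exact n0.1
        · rw [(key 0).2.1, (key 1).2.1, (key 2).2.1, (key 3).2.1]; exact n2.2
        · rw [(key 0).2.2.1, (key 1).2.2.1, (key 2).2.2.1, (key 3).2.2.1]; exact sj0.2.1
        · rw [(key 0).2.2.2, (key 1).2.2.2, (key 2).2.2.2, (key 3).2.2.2]; exact sj0.2.2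

theorem bd_i {Γ Γ' : ℕ → ℤ} (hb : BdInc (fun n => Γ' n / 3 - Γ n / 3)) (i : ℤ) :
    BdInc (fun n => (Γ' n + i) / 3 - Γ n / 3) := by
  have := hb.sub (BdInc.of_bdd (G := fun n => Γ' n / 3 - (Γ' n + i)/3) (-(i/3)-1) 1 (fun k => by omega))
  convert this using 2
  ring

theorem ncw_case {Γ Γ' : ℕ → ℤ} (d1 : Γ 0 % 3 ≠ Γ 1 % 3) (d2 : Γ 0 % 3 ≠ Γ 2 % 3) (d3 : Γ 1 % 3 ≠ Γ 2 % 3)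
    (e0 : Γ' 0 = Γ 0) (e1 : Γ' 1 = Γ 1) (e2 : Γ' 2 = Γ 2) (i : ℤ) (hi : (Γ' 3 + i)/3 ≠ (Γ 3 + i)/3) (j : ℤ) :
    Ncw (fun n => (Γ' n + i) / 3 - (Γ n + j) / 3) := by
  unfold Ncw
  dsimp only
  rw [e0, e1, e2]
  by_cases hij : (i - j) % 3 = 0
  · obtain ⟨q, rfl⟩ : ∃ q, i = j + 3 * q := ⟨(i-j)/3, by omega⟩
    omega
  · omega

theorem sj_of_d {a b c d : ℤ} (d1 : a % 3 ≠ b % 3) (d2 : a % 3 ≠ c % 3) (d3 : b % 3 ≠ c % 3) : sj a b c d := by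
  unfold sj; omega

theorem fwd_th {A B C : ℤ} {T : Set (Fin 3 → ℝ)} (S : Std A B C T) {Γ Γ' : ℕ → ℤ} {t : ℕ → ℝ} (h : A3 A B C Γ)
    (h' : A3 A B C Γ') (ht : TP A B C Γ t) (hb : BdInc (fun n => Γ' n / 3 - Γ n / 3))
    (d1 : Γ 0 % 3 ≠ Γ 1 % 3) (d2 : Γ 0 % 3 ≠ Γ 2 % 3) (d3 : Γ 1 % 3 ≠ Γ 2 % 3)
    (e0 : Γ' 0 = Γ 0) (e1 : Γ' 1 = Γ 1) (e2 : Γ' 2 = Γ 2) (i : ℤ) (hi : (Γ' 3 + i)/3 ≠ (Γ 3 + i)/3) :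
    ∃ (Θ : ℕ → ℤ) (m c : ℤ), V4 A B C Θ ∧ (∀ n, Γ n = om m (Θ n)) ∧ (∀ n, (Γ' n + i)/3 = (Θ n + m)/4 + c) ∧
      t 0 = (ev m (Θ 0) (Θ 1) (Θ 2) : ℝ) := by
  have hs : SJ Γ 0 := sj_of_d d1 d2 d3
  obtain ⟨c, m, -, -, hV, hG, hh⟩ := lemQ S h hs (h' i) (bd_i hb i) (fun j _ _ => ncw_case d1 d2 d3 e0 e1 e2 i hi j)
  refine ⟨_, m, c, hV, hG, hh, ?_⟩
  have hE : Γ = fun n => om m (Γ n + (Γ' n + i)/3 - c) := funext hG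
  have htp := hV.tp S.par m
  rw [← hE] at htp
  exact TP_unique S.par h ht htp hs 0

theorem fwd_up {A B C : ℤ} {T : Set (Fin 3 → ℝ)} (S : Std A B C T) {Γ Γ' : ℕ → ℤ} {t : ℕ → ℝ} (h : A3 A B C Γ)
    (h' : A3 A B C Γ') (ht : TP A B C Γ t) (hb : BdInc (fun n => Γ' n / 3 - Γ n / 3))
    (d1 : Γ 0 % 3 ≠ Γ 1 % 3) (d2 : Γ 0 % 3 ≠ Γ 2 % 3) (d3 : Γ 1 % 3 ≠ Γ 2 % 3)
    (e0 : Γ' 0 = Γ 0) (e1 : Γ' 1 = Γ 1) (e2 : Γ' 2 = Γ 2) (i : ℤ) (hi : (Γ 3 + i)/3 < (Γ' 3 + i)/3) :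
    t 0 = 1 ∧ (Γ 3 + i) % 3 = 2 ∧ (Γ' 3 + i)/3 = (Γ 3 + i)/3 + 1 := by
  obtain ⟨Θ, m, c, hV, hG, hh, h0⟩ := fwd_th S h h' ht hb d1 d2 d3 e0 e1 e2 i hi.ne'
  have hd := hV.dst 0
  have q : ∀ n, (Γ n + i)/3 = (Θ n + m + (1 + (i-m)%3))/4 + (i-m)/3 := fun n => by
    rw [hG n, om_div m (Θ n) i]; congr 2; ring
  have q0 := q 0
  have q1 := q 1
  have q2 := q 2
  have q3 := q 3
  have h3 := hh 3
  have hh0 := hh 0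
  have hh1 := hh 1
  have hh2 := hh 2
  have g3 := hG 3
  rw [e0] at hh0
  rw [e1] at hh1
  rw [e2] at hh2
  clear q hh
  have hr0 : 0 ≤ (i-m)%3 := by omega
  have hr2 : (i-m)%3 ≤ 2 := by omega
  have him : i = m + (i-m)%3 + 3 * ((i-m)/3) := by omega
  have key : (i-m)%3 = 2 ∧ (Θ 3 + m) % 4 = 0 ∧ (Θ 3 + m)/4 + c = (Θ 3 + m + (1 + (i-m)%3))/4 + (i-m)/3 + 1 := by
    clear hG h h' hb ht h0 d1 d2 d3 e0 e1 e2 hV g3 him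
    unfold d4 at hd
    simp only [zero_add] at hd
    generalize (i-m)%3 = r at *
    generalize (i-m)/3 = s at *
    rw [q3, h3] at hi
    rw [q0] at hh0
    rw [q1] at hh1
    rw [q2] at hh2
    clear q0 q1 q2 q3 h3
    have dd : (Θ 0 + m) % 4 ≠ (Θ 1 + m) % 4 ∧ (Θ 0 + m) % 4 ≠ (Θ 2 + m) % 4 ∧ (Θ 1 + m) % 4 ≠ (Θ 2 + m) % 4 := by
      omega
    clear hd
    generalize Θ 0 + m = y0 at *
    generalize Θ 1 + m = y1 at *
    generalize Θ 2 + m = y2 at *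
    generalize Θ 3 + m = y3 at *
    interval_cases r <;> omega
  obtain ⟨k1, k2, k3⟩ := key
  refine ⟨?_, ?_, ?_⟩
  · rw [h0]
    have : ev m (Θ 0) (Θ 1) (Θ 2) = 1 := by
      unfold d4 at hd
      simp only [zero_add] at hd
      clear q0 q1 q2 q3 h3 hh0 hh1 hh2 g3 hr0 hr2 him k1 hi hG
      unfold ev
      split_ifs <;> omega
    rw [this]; norm_num
  · unfold om at g3; omega
  · rw [q3, h3, k3]

theorem fwd_dn {A B C : ℤ} {T : Set (Fin 3 → ℝ)} (S : Std A B C T) {Γ Γ' : ℕ → ℤ} {t : ℕ → ℝ} (h : A3 A B C Γ)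
    (h' : A3 A B C Γ') (ht : TP A B C Γ t) (hb : BdInc (fun n => Γ' n / 3 - Γ n / 3))
    (d1 : Γ 0 % 3 ≠ Γ 1 % 3) (d2 : Γ 0 % 3 ≠ Γ 2 % 3) (d3 : Γ 1 % 3 ≠ Γ 2 % 3)
    (e0 : Γ' 0 = Γ 0) (e1 : Γ' 1 = Γ 1) (e2 : Γ' 2 = Γ 2) (i : ℤ) (hi : (Γ' 3 + i)/3 < (Γ 3 + i)/3) :
    t 0 = 0 := by
  obtain ⟨Θ, m, c, hV, hG, hh, h0⟩ := fwd_th S h h' ht hb d1 d2 d3 e0 e1 e2 i hi.ne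
  have hd := hV.dst 0
  have q : ∀ n, (Γ n + i)/3 = (Θ n + m + (1 + (i-m)%3))/4 + (i-m)/3 := fun n => by
    rw [hG n, om_div m (Θ n) i]; congr 2; ring
  have q0 := q 0
  have q1 := q 1
  have q2 := q 2
  have q3 := q 3
  have h3 := hh 3
  have hh0 := hh 0
  have hh1 := hh 1
  have hh2 := hh 2
  rw [e0] at hh0
  rw [e1] at hh1
  rw [e2] at hh2
  clear q hh
  have hr0 : 0 ≤ (i-m)%3 := by omega
  have hr2 : (i-m)%3 ≤ 2 := by omega
  have key : (Θ 3 + m) % 4 = 3 := by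
    clear hG h h' hb ht h0 d1 d2 d3 e0 e1 e2 hV
    unfold d4 at hd
    simp only [zero_add] at hd
    generalize (i-m)%3 = r at *
    generalize (i-m)/3 = s at *
    rw [q3, h3] at hi
    rw [q0] at hh0
    rw [q1] at hh1
    rw [q2] at hh2
    clear q0 q1 q2 q3 h3
    have dd : (Θ 0 + m) % 4 ≠ (Θ 1 + m) % 4 ∧ (Θ 0 + m) % 4 ≠ (Θ 2 + m) % 4 ∧ (Θ 1 + m) % 4 ≠ (Θ 2 + m) % 4 := by
      omega
    clear hd
    generalize Θ 0 + m = y0 at *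
    generalize Θ 1 + m = y1 at *
    generalize Θ 2 + m = y2 at *
    generalize Θ 3 + m = y3 at *
    interval_cases r <;> omega
  rw [h0]
  have : ev m (Θ 0) (Θ 1) (Θ 2) = 0 := by
    unfold d4 at hd
    simp only [zero_add] at hd
    clear q0 q1 q2 q3 h3 hh0 hh1 hh2 hr0 hr2 hi hG
    unfold ev
    split_ifs <;> omega
  rw [this]; norm_num

theorem fwd_aux {A B C : ℤ} {T : Set (Fin 3 → ℝ)} (S : Std A B C T) {Γ Γ' : ℕ → ℤ} {t t' : ℕ → ℝ} (h : A3 A B C Γ)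
    (h' : A3 A B C Γ') (ht : TP A B C Γ t) (ht' : TP A B C Γ' t') (hb : BdInc (fun n => Γ' n / 3 - Γ n / 3))
    (d1 : Γ 0 % 3 ≠ Γ 1 % 3) (d2 : Γ 0 % 3 ≠ Γ 2 % 3) (d3 : Γ 1 % 3 ≠ Γ 2 % 3)
    (e0 : Γ' 0 = Γ 0) (e1 : Γ' 1 = Γ 1) (e2 : Γ' 2 = Γ 2) (hi : Γ 3 < Γ' 3) :
    Γ' 3 = Γ 3 + 1 ∧ t 0 = 1 ∧ t' 0 = 0 := by
  have u := fwd_up S h h' ht hb d1 d2 d3 e0 e1 e2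
  have u1 := u (2 - Γ 3 % 3) (by omega)
  have v : Γ' 3 = Γ 3 + 1 := by
    by_contra hc
    have := (u (1 - Γ 3 % 3) (by omega)).2.1
    omega
  have hb' : BdInc (fun n => Γ n / 3 - Γ' n / 3) := by
    obtain ⟨R, hR⟩ := hb
    refine ⟨R, fun k => ?_⟩
    rw [← abs_neg]
    convert hR k using 2
    ring
  refine ⟨v, u1.1, ?_⟩
  exact fwd_dn S h' h ht' hb' (by rw [e0, e1]; exact d1) (by rw [e0, e2]; exact d2) (by rw [e1, e2]; exact d3)
    e0.symm e1.symm e2.symm (2 - Γ 3 % 3) (by omega)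

theorem jj_br {A B C : ℤ} (P : Par A B C) {Γ Γ' : ℕ → ℤ} (h : A3 A B C Γ) (h' : A3 A B C Γ') {m : ℕ}
    (he : ∀ j < 4, Γ (m+j) = Γ' (m+j)) (hne : Γ (m+4) ≠ Γ' (m+4)) : br Γ m := by
  by_contra hb
  have hz : ww A B C Γ m = 0 := w3_zero hb
  have a0 : Γ m = Γ' m := he 0 (by norm_num)
  have a1 := he 1 (by norm_num)
  have a2 := he 2 (by norm_num)
  have a3 := he 3 (by norm_num)
  have hz' : ww A B C Γ' m = 0 := by rw [← hz]; simp only [ww, a0, a1, a2, a3]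
  have el : lo3 A B C Γ m = lo3 A B C Γ' m := by simp only [lo3, a0, a1, a2, a3]
  have j := h.jj_mem P m
  have j' := h'.jj_mem P m
  simp only [jj, el] at j j'
  rw [hz] at j
  rw [hz'] at j'
  omega

theorem join_step {A B C : ℤ} {Γ Γ' : ℕ → ℤ} {t t' : ℕ → ℝ} 
    (ht : TP A B C Γ t) (ht' : TP A B C Γ' t') {m : ℕ} (hb : br Γ m)
    (he : ∀ j < 4, Γ (m+j) = Γ' (m+j)) (hd : Γ' (m+4) = Γ (m+4) + 1) (h1 : t (m+1) = 1) (h0 : t' (m+1) = 0) : t m = t' m := by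
  have a0 : Γ m = Γ' m := he 0 (by norm_num)
  have a1 := he 1 (by norm_num)
  have a2 := he 2 (by norm_num)
  have a3 := he 3 (by norm_num)
  have hw : ww A B C Γ' m = ww A B C Γ m := by simp only [ww, a0, a1, a2, a3]
  have el : lo3 A B C Γ m = lo3 A B C Γ' m := by simp only [lo3, a0, a1, a2, a3]
  have hb' : br Γ' m := by unfold br at *; rw [← a0, ← a1, ← a2, ← a3]; exact hb
  have hj : jj A B C Γ' m = jj A B C Γ m + 1 := by simp only [jj, el, hd]; ring
  rw [(ht m).2.2, (ht' m).2.2, h1, h0, TPs, TPs, if_pos hb, if_pos hb', hw, hj]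
  push_cast
  ring

/-- same window and same point: same parameter -/
theorem fwd_same {A B C : ℤ} {T : Set (Fin 3 → ℝ)} (S : Std A B C T) {Γ Γ' : ℕ → ℤ} {t t' : ℕ → ℝ} (h : A3 A B C Γ)
    (h' : A3 A B C Γ') (ht : TP A B C Γ t) (ht' : TP A B C Γ' t') (hb : BdInc (fun n => Γ' n / 3 - Γ n / 3))
    (hs : SJ Γ 0) (he : ∀ j < 4, Γ j = Γ' j) : t 0 = t' 0 := by
  by_cases hne : Γ = Γ'
  · subst hne; exact TP_unique S.par h ht ht' hs 0
  obtain ⟨m, hm, hd⟩ := first_diff he hne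
  have P := S.par
  have hbr := jj_br P h h' (m := m) (fun j hj => hm _ (by omega)) hd
  have bd := bdist (h.sj_all P.hA P.hB.le P.hC hs m) hbr
  have f0 : Γ m = Γ' m := hm m (by omega)
  have f1 := hm (m+1) (by omega)
  have f2 := hm (m+2) (by omega)
  have f3 := hm (m+3) (by omega)
  rw [TP_prefix P h h' ht ht' m hm]
  have hb2 : BdInc (fun n => Γ' (m+1+n) / 3 - Γ (m+1+n) / 3) := by
    obtain ⟨R, hR⟩ := hb
    exact ⟨R, fun k => hR (m+1+k)⟩
  have hb' : BdInc (fun n => Γ (m+1+n) / 3 - Γ' (m+1+n) / 3) := by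
    obtain ⟨R, hR⟩ := hb2
    refine ⟨R, fun k => ?_⟩
    rw [← abs_neg]
    convert hR k using 2
    ring
  rcases lt_or_gt_of_ne hd with hl | hl
  · have := fwd_aux S (h.shift (m+1)) (h'.shift (m+1)) (ht.shift (m+1)) (ht'.shift (m+1)) hb2 bd.1 bd.2.1 bd.2.2
        f1.symm f2.symm f3.symm hl
    exact join_step ht ht' hbr (fun j hj => hm _ (by omega)) this.1 this.2.1 this.2.2
  · have := fwd_aux S (h'.shift (m+1)) (h.shift (m+1)) (ht'.shift (m+1)) (ht.shift (m+1)) hb' 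
        (by show Γ' (m+1) % 3 ≠ Γ' (m+2) % 3; rw [← f1, ← f2]; exact bd.1)
        (by show Γ' (m+1) % 3 ≠ Γ' (m+3) % 3; rw [← f1, ← f3]; exact bd.2.1)
        (by show Γ' (m+2) % 3 ≠ Γ' (m+3) % 3; rw [← f2, ← f3]; exact bd.2.2)
        f1 f2 f3 hl
    have hbr' : br Γ' m := by unfold br at *; rw [← f0, ← f1, ← f2, ← f3]; exact hbr
    exact (join_step ht' ht hbr' (fun j hj => (hm _ (by omega)).symm) this.1 this.2.1 this.2.2).symm

/-! The polygons: for a face `W` (binary code) the cyclic list of its edges and vertices, in base 4. -/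
def eTab : List (List ℕ) := [[], [6, 278, 274, 338, 66, 70], [9, 281, 280, 344, 72, 73], [6, 282, 265, 74],
  [33, 293, 292, 356, 96, 97], [18, 294, 289, 98], [24, 297, 292, 104], [22, 282, 281, 297, 37, 38],
  [129, 389, 388, 404, 144, 145], [66, 390, 385, 146], [72, 393, 388, 152], [70, 330, 329, 393, 133, 134],
  [96, 417, 400, 164], [82, 354, 353, 417, 145, 146], [88, 360, 356, 420, 148, 152]]

def vTab : List (List ℕ) := [[], [75, 27, 39, 99, 147, 135], [78, 30, 45, 108, 156, 141], [75, 27, 30, 78],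
  [114, 54, 57, 120, 180, 177], [99, 39, 54, 114], [108, 45, 57, 120], [39, 27, 30, 45, 57, 54],
  [210, 198, 201, 216, 228, 225], [147, 135, 198, 210], [156, 141, 201, 216], [135, 75, 78, 141, 201, 198],
  [180, 177, 225, 228], [147, 99, 114, 177, 225, 210], [156, 108, 120, 180, 228, 216]]

def fN (W : ℕ) : ℕ := (eTab.getD W []).length
def eD (W i : ℕ) : ℕ := (eTab.getD W []).getD i 0
def vD (W i : ℕ) : ℕ := (vTab.getD W []).getD i 0
def dg (c j : ℕ) : ℤ := ((c / 4 ^ j % 4 : ℕ) : ℤ)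
def ori (W i : ℕ) : ℕ := eD W i / 256
def uu (o : ℕ) (e : ℤ) : ℕ := if o = 1 then e.toNat else 1 - e.toNat

theorem fN_cases : ∀ W < 15, 1 ≤ W → 4 ≤ fN W ∧ fN W ≤ 6 := by decide

set_option synthInstance.maxSize 2000 in
set_option synthInstance.maxHeartbeats 400000 in
theorem poly_a : ∀ W < 15, 1 ≤ W → ∀ i < fN W, ∀ e < 2, ∃ m < 4, 
    om (m:ℕ) (dg (vD W ((i + uu (ori W i) (e:ℕ)) % fN W)) 0) = dg (eD W i) 0 ∧
    om (m:ℕ) (dg (vD W ((i + uu (ori W i) (e:ℕ)) % fN W)) 1) = dg (eD W i) 1 ∧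
    om (m:ℕ) (dg (vD W ((i + uu (ori W i) (e:ℕ)) % fN W)) 2) = dg (eD W i) 2 ∧
    om (m:ℕ) (dg (vD W ((i + uu (ori W i) (e:ℕ)) % fN W)) 3) = dg (eD W i) 3 ∧
    ev (m:ℕ) (dg (vD W ((i + uu (ori W i) (e:ℕ)) % fN W)) 0) (dg (vD W ((i + uu (ori W i) (e:ℕ)) % fN W)) 1)
      (dg (vD W ((i + uu (ori W i) (e:ℕ)) % fN W)) 2) = (e:ℕ) := by
  decide +kernel

set_option synthInstance.maxSize 2000 in
set_option synthInstance.maxHeartbeats 400000 in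
theorem poly_v : ∀ W < 15, 1 ≤ W → ∀ i < fN W, d4 (dg (vD W i) 0) (dg (vD W i) 1) (dg (vD W i) 2) (dg (vD W i) 3) := by
  unfold d4
  decide +kernel

def pbs (W i m s0 s1 s2 : ℕ) : Prop := ∀ s3 < 4, om (m:ℕ) (s3:ℕ) = dg (eD W i) 3 →
    (s0 ≠ s1 ∧ s0 ≠ s2 ∧ s0 ≠ s3 ∧ s1 ≠ s2 ∧ s1 ≠ s3 ∧ s2 ≠ s3) →
    vD W ((i + uu (ori W i) (ev (m:ℕ) (s0:ℕ) (s1:ℕ) (s2:ℕ))) % fN W) = s0 + 4 * s1 + 16 * s2 + 64 * s3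
instance (W i m s0 s1 s2 : ℕ) : Decidable (pbs W i m s0 s1 s2) := by unfold pbs; infer_instance

def pbt (W i m : ℕ) : Prop := ∀ s0 < 4, om (m:ℕ) (s0:ℕ) = dg (eD W i) 0 →
    ∀ s1 < 4, om (m:ℕ) (s1:ℕ) = dg (eD W i) 1 → ∀ s2 < 4, om (m:ℕ) (s2:ℕ) = dg (eD W i) 2 → pbs W i m s0 s1 s2
set_option synthInstance.maxSize 2000 in
set_option synthInstance.maxHeartbeats 400000 in
instance (W i m : ℕ) : Decidable (pbt W i m) := by unfold pbt; infer_instance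

set_option synthInstance.maxSize 2000 in
set_option synthInstance.maxHeartbeats 400000 in
theorem poly_b : ∀ W < 15, 1 ≤ W → ∀ i < fN W, ∀ m < 4, 1 ≤ m → pbt W i m := by
  decide +kernel

set_option synthInstance.maxSize 2000 in
set_option synthInstance.maxHeartbeats 400000 in
theorem poly_ninj : ∀ W < 15, 1 ≤ W → ∀ i < fN W, ∀ j < fN W, vD W i = vD W j → i = j := by decide +kernel

set_option synthInstance.maxSize 2000 in
set_option synthInstance.maxHeartbeats 400000 in
theorem poly_einj : ∀ W < 15, 1 ≤ W → ∀ i < fN W, ∀ j < fN W, eD W i % 256 = eD W j % 256 → i = j := by decide +kernel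

set_option synthInstance.maxSize 2000 in
set_option synthInstance.maxHeartbeats 400000 in
theorem poly_sj : ∀ W < 15, 1 ≤ W → ∀ i < fN W, 
    ((dg (eD W i) 0) % 3 = 0 ∨ (dg (eD W i) 1) % 3 = 0 ∨ (dg (eD W i) 2) % 3 = 0 ∨ (dg (eD W i) 3) % 3 = 0) ∧
    ((dg (eD W i) 0) % 3 = 1 ∨ (dg (eD W i) 1) % 3 = 1 ∨ (dg (eD W i) 2) % 3 = 1 ∨ (dg (eD W i) 3) % 3 = 1) ∧ 
    ((dg (eD W i) 0) % 3 = 2 ∨ (dg (eD W i) 1) % 3 = 2 ∨ (dg (eD W i) 2) % 3 = 2 ∨ (dg (eD W i) 3) % 3 = 2) := by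
  decide +kernel

set_option synthInstance.maxSize 2000 in
set_option synthInstance.maxHeartbeats 400000 in
theorem poly_le : ∀ W < 15, 1 ≤ W → ∀ i < fN W, ∀ j < 4, dg (eD W i) j ≤ 2 := by
  decide +kernel

set_option synthInstance.maxSize 2000 in
set_option synthInstance.maxHeartbeats 400000 in
theorem poly_W : ∀ W < 15, 1 ≤ W → ∀ i < fN W, 
    (∀ j < 4, ((W / 2 ^ j % 2 : ℕ) : ℤ) = (dg (eD W i) j + 1) / 3) ∨
    (∀ j < 4, ((W / 2 ^ j % 2 : ℕ) : ℤ) = (dg (eD W i) j + 2) / 3) := by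
  decide +kernel

set_option synthInstance.maxSize 2000 in
set_option synthInstance.maxHeartbeats 400000 in
theorem poly_e : ∀ W < 15, 1 ≤ W → ∀ V < 15, 1 ≤ V → V ≠ W →
    ((∀ j < 4, W / 2 ^ j % 2 ≤ V / 2 ^ j % 2) ∨ (∀ j < 4, V / 2 ^ j % 2 ≤ W / 2 ^ j % 2)) →
    ∃ i < fN W, ∀ j < 4, dg (eD W i) j = ((W / 2 ^ j % 2 + V / 2 ^ j % 2 : ℕ) : ℤ) := by
  decide +kernel

def bt (W j : ℕ) : ℤ := ((W / 2 ^ j % 2 : ℕ) : ℤ)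

def fz (A B : ℤ) (W : ℕ) : Fin 3 → ℤ := wz A B (bt W 0) (bt W 1) (bt W 2) (bt W 3)

theorem bt_code {a b c d : ℤ} (ha : 0 ≤ a ∧ a ≤ 1) (hb : 0 ≤ b ∧ b ≤ 1) (hc : 0 ≤ c ∧ c ≤ 1) (hd : 0 ≤ d ∧ d ≤ 1) :
    ∃ W < 16, bt W 0 = a ∧ bt W 1 = b ∧ bt W 2 = c ∧ bt W 3 = d := by
  refine ⟨(a + 2 * b + 4 * c + 8 * d).toNat, by omega, ?_, ?_, ?_, ?_⟩ <;> simp only [bt] <;> norm_num <;> omega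

theorem code_ne {W : ℕ} (hW : W < 16) (h : ¬ (bt W 1 = bt W 0 ∧ bt W 2 = bt W 0 ∧ bt W 3 = bt W 0)) : 1 ≤ W ∧ W < 15 := by
  simp only [bt] at h
  norm_num at h
  omega

theorem bt_mem (W j : ℕ) : 0 ≤ bt W j ∧ bt W j ≤ 1 := by unfold bt; omega

theorem bt_nc {W : ℕ} (h1 : 1 ≤ W) (h2 : W < 15) : ¬ (bt W 1 = bt W 0 ∧ bt W 2 = bt W 0 ∧ bt W 3 = bt W 0) := by
  have : ∀ W < 15, 1 ≤ W → ¬ (bt W 1 = bt W 0 ∧ bt W 2 = bt W 0 ∧ bt W 3 = bt W 0) := by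
    unfold bt; decide
  exact this W h2 h1

theorem face_of {A B C : ℤ} {T : Set (Fin 3 → ℝ)} (S : Std A B C T) {α : Fin 3 → ℤ} (hα : α ∈ Neighbors T) :
    ∃ W, 1 ≤ W ∧ W < 15 ∧ α = fz A B W := by
  rw [S.nb] at hα
  obtain ⟨w, hw, rfl⟩ := hα
  have b01 : ∀ i, 0 ≤ ((w i).val : ℤ) ∧ ((w i).val : ℤ) ≤ 1 := fun i => by have := (w i).isLt; omega
  obtain ⟨W, hW, h0, h1, h2, h3⟩ := bt_code (b01 0) (b01 1) (b01 2) (b01 3)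
  simp only [bwin, Finset.coe_filter, Finset.mem_univ, true_and, Set.mem_ofPred_eq, Fin.ext_iff] at hw
  have := code_ne hW (by rw [h0, h1, h2, h3]; omega)
  exact ⟨W, this.1, this.2, by simp only [fz, bz, h0, h1, h2, h3]⟩

def KK (A B C : ℤ) (W : ℕ) : Set (ℕ → ℤ) := {Γ | A3 A B C Γ ∧ ∃ i < fN W, ∀ j < 4, Γ j = dg (eD W i) j}

theorem dg_nonneg (c j : ℕ) : 0 ≤ dg c j := by unfold dg; omega

theorem KK_sj {W i : ℕ} {Γ : ℕ → ℤ} (h1 : 1 ≤ W) (h2 : W < 15) (hi : i < fN W) (h : ∀ j < 4, Γ j = dg (eD W i) j) : SJ Γ 0 := by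
  have := poly_sj W h2 h1 i hi
  unfold SJ sj
  simp only [zero_add]
  rw [h 0 (by norm_num), h 1 (by norm_num), h 2 (by norm_num), h 3 (by norm_num)]
  exact this

theorem KK_mem {W i : ℕ} {Γ : ℕ → ℤ} (h1 : 1 ≤ W) (h2 : W < 15) (hi : i < fN W) (h : ∀ j < 4, Γ j = dg (eD W i) j) :
    ∀ j < 4, 0 ≤ Γ j ∧ Γ j ≤ 2 := by
  intro j hj
  rw [h j hj]
  exact ⟨dg_nonneg _ _, poly_le W h2 h1 i hi j hj⟩

theorem tile_rep {A B C : ℤ} {Γ : ℕ → ℤ} (h : A3 A B C Γ) {x} (hx : TRep A B C (fun n => Γ n / 3) x) (i : ℤ) :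
    TRep A B C (fun n => (Γ n + i) / 3) x := by
  refine hx.of_bd (h i) (BdInc.of_bdd (i/3) 1 (fun k => by omega))

theorem KK_LL {A B C : ℤ} {T : Set (Fin 3 → ℝ)} (S : Std A B C T) {W : ℕ} (h1 : 1 ≤ W) (h2 : W < 15) {Γ : ℕ → ℤ}
    (hΓ : Γ ∈ KK A B C W) {x} (hx : TRep A B C (fun n => Γ n / 3) x) : x ∈ LL T (fz A B W) := by
  obtain ⟨h, i, hi, hw⟩ := hΓ
  have hs := KK_sj h1 h2 hi hw
  have hm := KK_mem h1 h2 hi hw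
  have m0 := hm 0 (by norm_num)
  have m1 := hm 1 (by norm_num)
  have m2 := hm 2 (by norm_num)
  have m3 := hm 3 (by norm_num)
  have t1 := (tile_rep h hx 1).mem S.hT
  have t2 := (tile_rep h hx 2).mem S.hT
  rw [win_eq_wz] at t1 t2
  rw [mem_LL]
  have hz : ZWin (fun n => Γ n / 3) := ⟨by dsimp only; omega, by dsimp only; omega, by dsimp only; omega, by dsimp only; omega⟩
  unfold SJ sj at hs
  simp only [zero_add] at hs
  have n1 : wz A B ((Γ 0 + 1)/3) ((Γ 1 + 1)/3) ((Γ 2 + 1)/3) ((Γ 3 + 1)/3) ≠ 0 := wz_ne_zero (by omega)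
  have n2 : wz A B ((Γ 0 + 2)/3) ((Γ 1 + 2)/3) ((Γ 2 + 2)/3) ((Γ 3 + 2)/3) ≠ 0 := wz_ne_zero (by omega)
  have n3 : wz A B ((Γ 0 + 1)/3) ((Γ 1 + 1)/3) ((Γ 2 + 1)/3) ((Γ 3 + 1)/3) ≠ 
      wz A B ((Γ 0 + 2)/3) ((Γ 1 + 2)/3) ((Γ 2 + 2)/3) ((Γ 3 + 2)/3) := by
    intro he
    have := wz_inj he
    omega
  refine ⟨hz.mem S.hT hx, ?_⟩
  rcases poly_W W h2 h1 i hi with hc | hc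
  · have e : fz A B W = wz A B ((Γ 0 + 1)/3) ((Γ 1 + 1)/3) ((Γ 2 + 1)/3) ((Γ 3 + 1)/3) := by
      unfold fz bt
      rw [hc 0 (by norm_num), hc 1 (by norm_num), hc 2 (by norm_num), hc 3 (by norm_num),
        hw 0 (by norm_num), hw 1 (by norm_num), hw 2 (by norm_num), hw 3 (by norm_num)]
    rw [e]
    exact ⟨t1, _, n2, n3.symm, t2⟩
  · have e : fz A B W = wz A B ((Γ 0 + 2)/3) ((Γ 1 + 2)/3) ((Γ 2 + 2)/3) ((Γ 3 + 2)/3) := by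
      unfold fz bt
      rw [hc 0 (by norm_num), hc 1 (by norm_num), hc 2 (by norm_num), hc 3 (by norm_num),
        hw 0 (by norm_num), hw 1 (by norm_num), hw 2 (by norm_num), hw 3 (by norm_num)]
    rw [e]
    exact ⟨t2, _, n1, n3, t1⟩

theorem LL_KK {A B C : ℤ} {T : Set (Fin 3 → ℝ)} (S : Std A B C T) {W : ℕ} (h1 : 1 ≤ W) (h2 : W < 15) {x}
    (hx : x ∈ LL T (fz A B W)) : ∃ Γ ∈ KK A B C W, TRep A B C (fun n => Γ n / 3) x := by
  obtain ⟨hxT, hxα, β, hβ0, hβα, hxβ⟩ := mem_LL.mp hx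
  have hα0 : fz A B W ≠ 0 := wz_ne_zero (bt_nc h1 h2)
  obtain ⟨F, hz, hF⟩ := zero_rep S.hT hxT
  obtain ⟨G, hG, bG, ncG, -, wG⟩ := pair_bin S hF hz hα0 hxα
  obtain ⟨g, hg, bg, ncg, -, wg⟩ := pair_bin S hF hz hβ0 hxβ
  have nb := NbSeq.of_rep hG hg
  have hne : Ncw (fun n => F n + g n - (F n + G n)) := by
    rintro ⟨a, b, c⟩
    apply hβα
    rw [← wg, ← wG]
    unfold wz
    rw [show g 3 - g 2 = G 3 - G 2 by linarith, show g 2 - g 1 = G 2 - G 1 by linarith, show g 1 - g 0 = G 1 - G 0 by linarith]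
  obtain ⟨m, hm⟩ := nb.bin S hne
  obtain ⟨W', hW', v0, v1, v2, v3⟩ := bt_code (bg 0) (bg 1) (bg 2) (bg 3)
  have nc0 := ncg 0
  have ncG0 := ncG 0
  simp only [zero_add] at nc0 ncG0
  have hV := code_ne hW' (by rw [v0, v1, v2, v3]; exact nc0)
  have eG := wz_inj wG
  have k0 := bt_mem W 0
  have k1 := bt_mem W 1
  have k2 := bt_mem W 2
  have k3 := bt_mem W 3
  have g0 := bG 0
  have g1 := bG 1
  have g2 := bG 2
  have g3 := bG 3
  have ncW := bt_nc h1 h2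
  have E : G 0 = bt W 0 ∧ G 1 = bt W 1 ∧ G 2 = bt W 2 ∧ G 3 = bt W 3 := by
    clear hm nb hne wG wg hxα hxβ hx hV nc0
    omega
  obtain ⟨E0, E1, E2, E3⟩ := E
  have hVW : W' ≠ W := by
    rintro rfl
    apply hne
    simp only [← v0, ← v1, ← v2, ← v3, E0, E1, E2, E3]
    refine ⟨?_, ?_, ?_⟩ <;> ring
  have dich : (∀ k, G k ≤ g k) ∨ (∀ k, g k ≤ G k) := by
    rcases le_or_gt 0 m with h | h
    · left; intro k; have := hm k; omega
    · right; intro k; have := hm k; omega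
  have cmp : (∀ j < 4, W / 2 ^ j % 2 ≤ W' / 2 ^ j % 2) ∨ (∀ j < 4, W' / 2 ^ j % 2 ≤ W / 2 ^ j % 2) := by
    have q : ∀ j < 4, bt W j = G j ∧ bt W' j = g j := by
      intro j hj
      interval_cases j
      · exact ⟨E0.symm, v0⟩
      · exact ⟨E1.symm, v1⟩
      · exact ⟨E2.symm, v2⟩
      · exact ⟨E3.symm, v3⟩
    rcases dich with h | h
    · left; intro j hj; have := q j hj; have := h j; simp only [bt] at *; omega
    · right; intro j hj; have := q j hj; have := h j; simp only [bt] at *; omega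
  obtain ⟨i, hi, hd⟩ := poly_e W h2 h1 W' hV.2 hV.1 hVW cmp
  obtain ⟨z0, z1, z2, z3⟩ := hz
  have hF3 : (fun n => (3 * F n + G n + g n) / 3) = fun n => F n := by
    funext n
    have : G n + g n ≤ 2 ∧ 0 ≤ G n + g n := by have := bG n; have := bg n; omega
    by_cases h : G n + g n = 3
    · omega
    · omega
  refine ⟨fun n => 3 * F n + G n + g n, ⟨?_, i, hi, ?_⟩, by dsimp only; rw [hF3]; exact hF⟩
  · intro s
    obtain ⟨r, q, hr0, hr2, rfl⟩ : ∃ r q : ℤ, 0 ≤ r ∧ r ≤ 2 ∧ s = r + 3 * q := ⟨s % 3, s / 3, by omega, by omega, by omega⟩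
    have key : ∀ f : ℕ → ℤ, Adr A B C f → (∀ n, (3 * F n + G n + g n + (r + 3 * q))/3 = f n + q) → 
        Adr A B C (fun n => (3 * F n + G n + g n + (r + 3 * q))/3) := by
      intro f hf he
      have : (fun n => (3 * F n + G n + g n + (r + 3 * q))/3) = fun n => f n + q := funext he
      rw [this]; exact hf.addc q
    have sp : ∀ n, (0 ≤ G n ∧ G n ≤ 1) ∧ 0 ≤ g n ∧ g n ≤ 1 := fun n => ⟨bG n, bg n⟩
    interval_cases r
    · exact key _ hF.1 (fun n => by have := sp n; omega)
    · rcases dich with h | h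
      · exact key _ hG.1 (fun n => by have := sp n; have := h n; omega)
      · exact key _ hg.1 (fun n => by have := sp n; have := h n; omega)
    · rcases dich with h | h
      · exact key _ hg.1 (fun n => by have := sp n; have := h n; omega)
      · exact key _ hG.1 (fun n => by have := sp n; have := h n; omega)
  · intro j hj
    rw [hd j hj]
    push_cast
    interval_cases j
    · show 3 * F 0 + G 0 + g 0 = bt W 0 + bt W' 0
      omega
    · show 3 * F 1 + G 1 + g 1 = bt W 1 + bt W' 1
      omega
    · show 3 * F 2 + G 2 + g 2 = bt W 2 + bt W' 2
      omega
    · show 3 * F 3 + G 3 + g 3 = bt W 3 + bt W' 3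
      omega

/-- index of the third tile along the edge `i` of the face `W` -/
def oi (W i : ℕ) : ℕ := if ((W / 2 ^ 0 % 2 : ℕ) : ℤ) = (dg (eD W i) 0 + 1) / 3 ∧ ((W / 2 ^ 1 % 2 : ℕ) : ℤ) = (dg (eD W i) 1 + 1) / 3 ∧
  ((W / 2 ^ 2 % 2 : ℕ) : ℤ) = (dg (eD W i) 2 + 1) / 3 ∧ ((W / 2 ^ 3 % 2 : ℕ) : ℤ) = (dg (eD W i) 3 + 1) / 3 then 2 else 1

set_option synthInstance.maxSize 2000 in
set_option synthInstance.maxHeartbeats 400000 in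
theorem oi_nc : ∀ W < 15, 1 ≤ W → ∀ i < fN W, ∀ j < fN W, i ≠ j → ∀ k < 3,
    ¬ ((dg (eD W j) 1 + (oi W j : ℕ)) / 3 - (dg (eD W i) 1 + (k : ℕ)) / 3 = (dg (eD W j) 0 + (oi W j : ℕ)) / 3 - (dg (eD W i) 0 + (k : ℕ)) / 3 ∧
      (dg (eD W j) 2 + (oi W j : ℕ)) / 3 - (dg (eD W i) 2 + (k : ℕ)) / 3 = (dg (eD W j) 0 + (oi W j : ℕ)) / 3 - (dg (eD W i) 0 + (k : ℕ)) / 3 ∧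
      (dg (eD W j) 3 + (oi W j : ℕ)) / 3 - (dg (eD W i) 3 + (k : ℕ)) / 3 = (dg (eD W j) 0 + (oi W j : ℕ)) / 3 - (dg (eD W i) 0 + (k : ℕ)) / 3) := by
  decide +kernel

set_option synthInstance.maxSize 2000 in
set_option synthInstance.maxHeartbeats 400000 in
theorem oi_both : ∀ W < 15, 1 ≤ W → ∀ i < fN W,
    (∃ j < 4, (dg (eD W i) j + (oi W i : ℕ)) / 3 = 0) ∧ (∃ j < 4, (dg (eD W i) j + (oi W i : ℕ)) / 3 = 1) := by
  decide +kernel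

set_option synthInstance.maxSize 2000 in
set_option synthInstance.maxHeartbeats 400000 in
theorem oi_sym : ∀ W < 15, 1 ≤ W → ∀ i < fN W, ∀ k < fN W, ∀ j < 4,
    dg (eD W i) j + (dg (eD W k) j + (oi W k : ℕ)) / 3 = dg (eD W k) j + (dg (eD W i) j + (oi W i : ℕ)) / 3 := by
  decide +kernel

theorem half {A B C : ℤ} {T : Set (Fin 3 → ℝ)} (S : Std A B C T) {W i i' : ℕ} (h1 : 1 ≤ W) (h2 : W < 15)
    (hi : i < fN W) (hi' : i' < fN W) (hne : i ≠ i') {Γ Γ' : ℕ → ℤ} {t : ℕ → ℝ} (h : A3 A B C Γ) (h' : A3 A B C Γ')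
    (hw : ∀ j < 4, Γ j = dg (eD W i) j) (hw' : ∀ j < 4, Γ' j = dg (eD W i') j) (ht : TP A B C Γ t)
    (hb : BdInc (fun n => Γ' n / 3 - Γ n / 3)) :
    ∃ e : ℕ, e < 2 ∧ t 0 = e ∧ ((vD W ((i + uu (ori W i) (e : ℕ)) % fN W) : ℕ) : ℤ) =
      (dg (eD W i) 0 + (dg (eD W i') 0 + (oi W i' : ℕ)) / 3) + 4 * (dg (eD W i) 1 + (dg (eD W i') 1 + (oi W i' : ℕ)) / 3) +
      16 * (dg (eD W i) 2 + (dg (eD W i') 2 + (oi W i' : ℕ)) / 3) + 64 * (dg (eD W i) 3 + (dg (eD W i') 3 + (oi W i' : ℕ)) / 3) := by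
  have hs := KK_sj h1 h2 hi hw
  have hm := KK_mem h1 h2 hi hw
  have nc := oi_nc W h2 h1 i hi i' hi' hne
  obtain ⟨⟨j0, hj0, q0⟩, j1, hj1, q1⟩ := oi_both W h2 h1 i' hi'
  have z : (0:ℕ) < 4 := by norm_num
  have o : (1:ℕ) < 4 := by norm_num
  have tw : (2:ℕ) < 4 := by norm_num
  have th : (3:ℕ) < 4 := by norm_num
  obtain ⟨c, m, m1, m3, V, hom, hh⟩ := lemQ S (h := fun n => (Γ' n + (oi W i' : ℕ)) / 3) h hs (h' _) (bd_i hb _) (by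
    intro k k0 k3
    unfold Ncw
    beta_reduce
    rw [hw 0 z, hw 1 o, hw 2 tw, hw 3 th, hw' 0 z, hw' 1 o, hw' 2 tw, hw' 3 th]
    have := nc k.toNat (by omega)
    rwa [Int.toNat_of_nonneg k0] at this)
  have hm0 := hm 0 z
  have hm1 := hm 1 o
  have hm2 := hm 2 tw
  have hm3 := hm 3 th
  have rng : ∀ j < 4, 0 ≤ Γ j + (Γ' j + (oi W i' : ℕ)) / 3 - c ∧ Γ j + (Γ' j + (oi W i' : ℕ)) / 3 - c ≤ 3 := by
    intro j hj
    have a := hom j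
    have b := hm j hj
    unfold om at a
    generalize (Γ' j + (oi W i' : ℕ)) / 3 = y at *
    omega
  have hc : c = 0 := by
    have a0 := hh j0
    have a1 := hh j1
    have r0 := rng j0 hj0
    have r1 := rng j1 hj1
    rw [← hw' j0 hj0] at q0
    rw [← hw' j1 hj1] at q1
    rw [q0] at a0 r0
    rw [q1] at a1 r1
    omega
  subst hc
  have tp := V.tp S.par m
  have e1 : (fun n => om m (Γ n + (Γ' n + (oi W i' : ℕ)) / 3 - 0)) = Γ := (funext hom).symm
  rw [e1] at tp
  have ht0 := TP_unique S.par h ht tp hs 0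
  simp only [sub_zero] at ht0 rng hom
  have r0 := rng 0 z
  have r1 := rng 1 o
  have r2 := rng 2 tw
  have r3 := rng 3 th
  have d := V.dst 0
  simp only [sub_zero, zero_add] at d ht0
  have o0 := hom 0
  have o1 := hom 1
  have o2 := hom 2
  have o3 := hom 3
  have pb := poly_b W h2 h1 i hi m.toNat (by omega) (by omega)
  rw [hw 0 z, hw' 0 z] at r0 o0 d ht0
  rw [hw 1 o, hw' 1 o] at r1 o1 d ht0
  rw [hw 2 tw, hw' 2 tw] at r2 o2 d ht0
  rw [hw 3 th, hw' 3 th] at r3 o3 d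
  clear hm rng nc hom hh hb V tp e1 q0 q1 hm0 hm1 hm2 hm3
  generalize dg (eD W i) 0 + (dg (eD W i') 0 + (oi W i' : ℕ)) / 3 = s0 at *
  generalize dg (eD W i) 1 + (dg (eD W i') 1 + (oi W i' : ℕ)) / 3 = s1 at *
  generalize dg (eD W i) 2 + (dg (eD W i') 2 + (oi W i' : ℕ)) / 3 = s2 at *
  generalize dg (eD W i) 3 + (dg (eD W i') 3 + (oi W i' : ℕ)) / 3 = s3 at *
  have em := ev_mem m s0 s1 s2
  lift s0 to ℕ using r0.1
  lift s1 to ℕ using r1.1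
  lift s2 to ℕ using r2.1
  lift s3 to ℕ using r3.1
  lift m to ℕ using (by omega)
  simp only [Int.toNat_natCast] at pb
  have := pb s0 (by omega) o0.symm s1 (by omega) o1.symm s2 (by omega) o2.symm s3 (by omega) o3.symm
    (by unfold d4 at d; omega)
  refine ⟨(ev m s0 s1 s2).toNat, by omega, ?_, ?_⟩
  · rw [ht0]
    have : ((ev m s0 s1 s2).toNat : ℤ) = ev m s0 s1 s2 := Int.toNat_of_nonneg em.1
    exact_mod_cast this.symm
  · rw [Int.toNat_of_nonneg em.1]
    exact_mod_cast this

def Glue (W i i' : ℕ) (τ τ' : ℝ) : Prop := (i = i' ∧ τ = τ') ∨ ∃ e e' : ℕ, e < 2 ∧ e' < 2 ∧ τ = e ∧ τ' = e' ∧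
  (i + uu (ori W i) (e : ℕ)) % fN W = (i' + uu (ori W i') (e' : ℕ)) % fN W

theorem BdInc.neg {G : ℕ → ℤ} (h : BdInc G) : BdInc (fun n => - G n) := by
  obtain ⟨R, hR⟩ := h
  refine ⟨R, fun k => ?_⟩
  have := hR k
  rw [show -G (k+1) - -G k = -(G (k+1) - G k) by ring, abs_neg]
  exact this

theorem ker_fwd {A B C : ℤ} {T : Set (Fin 3 → ℝ)} (S : Std A B C T) {W i i' : ℕ} (h1 : 1 ≤ W) (h2 : W < 15)
    (hi : i < fN W) (hi' : i' < fN W) {Γ Γ' : ℕ → ℤ} {t t' : ℕ → ℝ} (h : A3 A B C Γ) (h' : A3 A B C Γ')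
    (hw : ∀ j < 4, Γ j = dg (eD W i) j) (hw' : ∀ j < 4, Γ' j = dg (eD W i') j) (ht : TP A B C Γ t) (ht' : TP A B C Γ' t')
    {x} (hx : TRep A B C (fun n => Γ n / 3) x) (hx' : TRep A B C (fun n => Γ' n / 3) x) : Glue W i i' (t 0) (t' 0) := by
  have hb := hx.bd hx'
  have hb' := hx'.bd hx
  by_cases hii : i = i'
  · subst hii
    exact Or.inl ⟨rfl, fwd_same S h h' ht ht' hb (KK_sj h1 h2 hi hw) (fun j hj => by rw [hw j hj, hw' j hj])⟩
  · right
    obtain ⟨e, he, te, ve⟩ := half S h1 h2 hi hi' hii h h' hw hw' ht hb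
    obtain ⟨e', he', te', ve'⟩ := half S h1 h2 hi' hi (Ne.symm hii) h' h hw' hw ht' hb'
    refine ⟨e, e', he, he', te, te', ?_⟩
    have hN := (fN_cases W h2 h1).1
    refine poly_ninj W h2 h1 _ (Nat.mod_lt _ (by omega)) _ (Nat.mod_lt _ (by omega)) ?_
    have sy := oi_sym W h2 h1 i hi i' hi'
    rw [sy 0 (by norm_num), sy 1 (by norm_num), sy 2 (by norm_num), sy 3 (by norm_num), ← ve'] at ve
    exact_mod_cast ve

theorem ker_rev {A B C : ℤ} {T : Set (Fin 3 → ℝ)} (S : Std A B C T) {W i i' : ℕ} (h1 : 1 ≤ W) (h2 : W < 15)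
    (hi : i < fN W) (hi' : i' < fN W) {Γ Γ' : ℕ → ℤ} {t t' : ℕ → ℝ} (h : A3 A B C Γ) (h' : A3 A B C Γ')
    (hw : ∀ j < 4, Γ j = dg (eD W i) j) (hw' : ∀ j < 4, Γ' j = dg (eD W i') j) (ht : TP A B C Γ t) (ht' : TP A B C Γ' t')
    {x x'} (hx : TRep A B C (fun n => Γ n / 3) x) (hx' : TRep A B C (fun n => Γ' n / 3) x') (hg : Glue W i i' (t 0) (t' 0)) :
    x = x' := by
  suffices hbd : ∃ c R : ℤ, ∀ k, c ≤ Γ' k - Γ k ∧ Γ' k - Γ k ≤ c + R by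
    obtain ⟨c, R, hk⟩ := hbd
    have hA : Adr A B C (fun n => Γ' n / 3) := hx'.1
    exact TRep.unique S.hT (hx.of_bd hA (BdInc.of_bdd (c / 3 - 1) (R / 3 + 3) (fun k => by have := hk k; omega))) hx'
  rcases hg with ⟨rfl, e⟩ | ⟨e, e', he, he', te, te', hv⟩
  · have := rev_same S.par h h' ht ht' (KK_sj h1 h2 hi hw) (fun j hj => by rw [hw j hj, hw' j hj]) e
    exact ⟨-1, 2, fun k => by have := this k; omega⟩
  · obtain ⟨m, -, a0, a1, a2, a3, a4⟩ := poly_a W h2 h1 i hi e he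
    obtain ⟨m', -, b0, b1, b2, b3, b4⟩ := poly_a W h2 h1 i' hi' e' he'
    rw [← hv] at b0 b1 b2 b3 b4
    have hN := (fN_cases W h2 h1).1
    obtain ⟨Θ, q0, q1, q2, q3, V⟩ := V4_exists (A := A) (B := B) (C := C)
      (poly_v W h2 h1 ((i + uu (ori W i) (e : ℕ)) % fN W) (Nat.mod_lt _ (by omega)))
    rw [← q0] at a0 a4 b0 b4
    rw [← q1] at a1 a4 b1 b4
    rw [← q2] at a2 a4 b2 b4
    rw [← q3] at a3 b3
    have z : (0:ℕ) < 4 := by norm_num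
    have o : (1:ℕ) < 4 := by norm_num
    have tw : (2:ℕ) < 4 := by norm_num
    have th : (3:ℕ) < 4 := by norm_num
    have E := ext_is_om S.par h ht V m (a0.trans (hw 0 z).symm) (a1.trans (hw 1 o).symm) (a2.trans (hw 2 tw).symm)
      (a3.trans (hw 3 th).symm) (by rw [te, a4]; simp)
    have E' := ext_is_om S.par h' ht' V m' (b0.trans (hw' 0 z).symm) (b1.trans (hw' 1 o).symm) (b2.trans (hw' 2 tw).symm)
      (b3.trans (hw' 3 th).symm) (by rw [te', b4]; simp)
    refine ⟨-(m' : ℤ) - 2, m + m' + 6, fun k => ?_⟩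
    rw [E k, E' k]
    unfold om
    omega

theorem KK_fin {A B C : ℤ} (P : Par A B C) (W k : ℕ) :
    {p : ℤ × ℤ × ℤ × ℤ | ∃ Γ ∈ KK A B C W, p = (Γ k, Γ (k+1), Γ (k+2), Γ (k+3))}.Finite := by
  induction k with
  | zero =>
    refine ((Set.finite_lt_nat (fN W)).image (fun i => (dg (eD W i) 0, dg (eD W i) 1, dg (eD W i) 2, dg (eD W i) 3))).subset ?_
    rintro p ⟨Γ, ⟨-, i, hi, hw⟩, rfl⟩
    refine ⟨i, hi, ?_⟩
    simp only [zero_add]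
    rw [hw 0 (by norm_num), hw 1 (by norm_num), hw 2 (by norm_num), hw 3 (by norm_num)]
  | succ k ih =>
    refine (ih.biUnion (t := fun p => (fun e => (p.2.1, p.2.2.1, p.2.2.2, e)) ''
      Set.Icc (p.1 - 3 * Q3 A B C p.1 p.2.1 p.2.2.1 p.2.2.2)
        (p.1 - 3 * Q3 A B C p.1 p.2.1 p.2.2.1 p.2.2.2 + 3 * w3 A B C p.1 p.2.1 p.2.2.1 p.2.2.2))
      (fun p _ => (Set.finite_Icc _ _).image _)).subset ?_
    rintro p ⟨Γ, hΓ, rfl⟩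
    have := hΓ.1.jj_mem P k
    unfold jj lo3 ww at this
    refine Set.mem_biUnion (x := (Γ k, Γ (k+1), Γ (k+2), Γ (k+3))) ⟨Γ, hΓ, rfl⟩ ⟨Γ (k+4), ⟨?_, ?_⟩, rfl⟩
    · dsimp only; linarith [this.1]
    · dsimp only; linarith [this.2]

theorem KK_closed (A B C : ℤ) (W : ℕ) : IsClosed (KK A B C W) := by
  have c1 : ∀ (n : ℕ) (i : ℤ), Continuous (fun Γ : ℕ → ℤ => (Γ n + i) / 3) := fun n i =>
    (continuous_of_discreteTopology (f := fun z : ℤ => (z + i) / 3)).comp (continuous_apply n)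
  have e : KK A B C W = (⋂ i : ℤ, ⋂ k : ℕ, (fun Γ : ℕ → ℤ => qq A B C (fun n => (Γ n + i) / 3) k) ⁻¹' (Set.Ico 0 C)) ∩
      ⋃ i ∈ {i : ℕ | i < fN W}, ⋂ j : ℕ, ⋂ _ : j < 4, (fun Γ : ℕ → ℤ => Γ j) ⁻¹' {dg (eD W i) j} := by
    ext Γ
    simp only [KK, A3, Adr, Set.mem_inter_iff, Set.mem_iInter, Set.mem_iUnion, Set.mem_preimage, Set.mem_Ico,
      Set.mem_singleton_iff, Set.mem_ofPred_eq, exists_prop]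
  rw [e]
  refine IsClosed.inter ?_ ?_
  · refine isClosed_iInter fun i => isClosed_iInter fun k => ?_
    refine IsClosed.preimage ?_ (isClosed_discrete _)
    unfold qq
    have := c1 k i
    have := c1 (k+1) i
    have := c1 (k+2) i
    have := c1 (k+3) i
    have := c1 (k+4) i
    fun_prop
  · refine (Set.finite_lt_nat (fN W)).isClosed_biUnion fun i _ => ?_
    exact isClosed_iInter fun j => isClosed_iInter fun _ => (isClosed_discrete _).preimage (continuous_apply j)

theorem KK_compact {A B C : ℤ} (P : Par A B C) (W : ℕ) : IsCompact (KK A B C W) := by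
  have hc : IsCompact (Set.univ.pi (fun k : ℕ => (fun p : ℤ × ℤ × ℤ × ℤ => p.1) ''
      {p : ℤ × ℤ × ℤ × ℤ | ∃ Γ ∈ KK A B C W, p = (Γ k, Γ (k+1), Γ (k+2), Γ (k+3))})) :=
    isCompact_univ_pi fun k => ((KK_fin P W k).image _).isCompact
  refine hc.of_isClosed_subset (KK_closed A B C W) ?_
  intro Γ hΓ k _
  exact ⟨_, ⟨Γ, hΓ, rfl⟩, rfl⟩

theorem near {S : Set (ℕ → ℤ)} (Γ : S) (n : ℕ) : ∀ᶠ Γ' : S in nhds Γ, ∀ k < n, Γ.1 k = Γ'.1 k := by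
  have : ∀ᶠ Γ' : S in nhds Γ, ∀ k ∈ {k : ℕ | k < n}, Γ.1 k = Γ'.1 k := by
    rw [Filter.eventually_all_finite (Set.finite_lt_nat n)]
    intro k _
    have hc : Continuous (fun Γ' : S => Γ'.1 k) := (continuous_apply k).comp continuous_subtype_val
    have := hc.continuousAt (x := Γ) |>.eventually ((isOpen_discrete {Γ.1 k}).mem_nhds rfl)
    exact this.mono fun _ h => h.symm
  exact this

noncomputable def uR (o : ℕ) (τ : ℝ) : ℝ := if o = 1 then τ else 1 - τ

theorem uR_mem {o : ℕ} {τ : ℝ} (h0 : 0 ≤ τ) (h1 : τ ≤ 1) : 0 ≤ uR o τ ∧ uR o τ ≤ 1 := by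
  unfold uR; split_ifs <;> constructor <;> linarith

theorem uR_uR (o : ℕ) (τ : ℝ) : uR o (uR o τ) = τ := by
  unfold uR; split_ifs <;> ring

theorem uR_uu (o e : ℕ) (he : e < 2) : uR o (e : ℝ) = ((uu o (e : ℕ) : ℕ) : ℝ) := by
  unfold uR uu
  split_ifs
  · simp
  · interval_cases e <;> norm_num

theorem circ_eq {N : ℕ} {r r' : ℝ} : (r : AddCircle (N : ℝ)) = (r' : AddCircle (N : ℝ)) ↔ ∃ n : ℤ, r - r' = n * N := by
  rw [← sub_eq_zero, ← AddCircle.coe_sub, AddCircle.coe_eq_zero_iff]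
  simp only [zsmul_eq_mul, eq_comm]

theorem glue_iff {W i i' : ℕ} {τ τ' : ℝ} (hi : i < fN W) (hi' : i' < fN W) (h0 : 0 ≤ τ) (h1 : τ ≤ 1) (h0' : 0 ≤ τ') (h1' : τ' ≤ 1) :
    (((i : ℝ) + uR (ori W i) τ : ℝ) : AddCircle (fN W : ℝ)) = (((i' : ℝ) + uR (ori W i') τ' : ℝ) : AddCircle (fN W : ℝ)) ↔
      Glue W i i' τ τ' := by
  rw [circ_eq]
  constructor
  · rintro ⟨n, hn⟩
    have u1 := uR_mem (o := ori W i) h0 h1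
    have u2 := uR_mem (o := ori W i') h0' h1'
    set u := uR (ori W i) τ with hu
    set u' := uR (ori W i') τ' with hu'
    have hd : u - u' = (((i' : ℤ) - i + n * fN W : ℤ) : ℝ) := by push_cast; linarith
    have key : ∀ e e' : ℕ, e < 2 → e' < 2 → u = e → u' = e' → Glue W i i' τ τ' := by
      intro e e' he he' hue hue'
      have inv : ∀ o f : ℕ, f < 2 → ∃ g < 2, uR o f = (g : ℕ) := by
        intro o f hf
        rw [uR_uu _ _ hf]
        refine ⟨_, ?_, rfl⟩
        unfold uu
        split_ifs <;> omega
      obtain ⟨g, hg, eg⟩ := inv (ori W i) e he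
      obtain ⟨g', hg', eg'⟩ := inv (ori W i') e' he'
      rw [← hue, hu, uR_uR] at eg
      rw [← hue', hu', uR_uR] at eg'
      refine Or.inr ⟨g, g', hg, hg', eg, eg', ?_⟩
      have a := uR_uu (ori W i) g hg
      have b := uR_uu (ori W i') g' hg'
      rw [← eg, ← hu] at a
      rw [← eg', ← hu'] at b
      rw [a, b] at hn
      have hz : ((i : ℤ) + (uu (ori W i) (g:ℕ) : ℕ)) - (i' + (uu (ori W i') (g':ℕ) : ℕ)) = n * fN W := by exact_mod_cast hn
      have : ((i + uu (ori W i) (g:ℕ) : ℕ) : ℤ) % (fN W : ℕ) = ((i' + uu (ori W i') (g':ℕ) : ℕ) : ℤ) % (fN W : ℕ) := by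
        rw [Int.emod_eq_emod_iff_emod_sub_eq_zero]
        push_cast
        rw [hz]; simp
      exact_mod_cast this
    have b1 : -1 ≤ ((i' : ℤ) - i + n * fN W : ℤ) := by
      have : (-1:ℝ) ≤ (((i' : ℤ) - i + n * fN W : ℤ) : ℝ) := by rw [← hd]; linarith
      exact_mod_cast this
    have b2 : ((i' : ℤ) - i + n * fN W : ℤ) ≤ 1 := by
      have : (((i' : ℤ) - i + n * fN W : ℤ) : ℝ) ≤ 1 := by rw [← hd]; linarith
      exact_mod_cast this
    rcases (by omega : ((i' : ℤ) - i + n * fN W : ℤ) = -1 ∨ ((i' : ℤ) - i + n * fN W : ℤ) = 0 ∨ ((i' : ℤ) - i + n * fN W : ℤ) = 1) with q | q | q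
    · rw [q] at hd
      push_cast at hd
      exact key 0 1 (by norm_num) (by norm_num) (by push_cast; linarith) (by push_cast; linarith)
    · rw [q] at hd
      push_cast at hd
      have hii : i = i' := by
        have dv : ((fN W : ℕ) : ℤ) ∣ (i : ℤ) - i' := ⟨n, by linarith⟩
        have := Int.eq_zero_of_abs_lt_dvd dv (by rw [abs_lt]; constructor <;> omega)
        omega
      subst hii
      left
      refine ⟨rfl, ?_⟩
      have : u = u' := by linarith
      rw [← uR_uR (ori W i) τ, ← hu, this, hu', uR_uR]
    · rw [q] at hd
      push_cast at hd
      exact key 1 0 (by norm_num) (by norm_num) (by push_cast; linarith) (by push_cast; linarith)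
  · rintro (⟨rfl, rfl⟩ | ⟨e, e', he, he', rfl, rfl, hm⟩)
    · exact ⟨0, by simp⟩
    · rw [uR_uu _ _ he, uR_uu _ _ he']
      have hz : ((i + uu (ori W i) (e:ℕ) : ℕ) : ℤ) % (fN W : ℕ) = ((i' + uu (ori W i') (e':ℕ) : ℕ) : ℤ) % (fN W : ℕ) := by
        exact_mod_cast hm
      rw [Int.emod_eq_emod_iff_emod_sub_eq_zero] at hz
      obtain ⟨n, hn⟩ := Int.dvd_of_emod_eq_zero hz
      refine ⟨n, ?_⟩
      rw [mul_comm]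
      exact_mod_cast hn

theorem homeo_of_kernel {K X Y : Type*} [TopologicalSpace K] [TopologicalSpace X] [TopologicalSpace Y] [CompactSpace K]
    [T2Space X] [T2Space Y] {p : K → X} {q : K → Y} (hp : Continuous p) (hq : Continuous q) (sp : Function.Surjective p)
    (sq : Function.Surjective q) (hk : ∀ a b, p a = p b ↔ q a = q b) : Nonempty (X ≃ₜ Y) := by
  choose g hg using sp
  have hX : CompactSpace X := ⟨by
    have := isCompact_range hp
    rwa [Set.range_eq_univ.mpr (fun x => ⟨g x, hg x⟩)] at this⟩
  have quo : Topology.IsQuotientMap p := Topology.IsQuotientMap.of_surjective_continuous (fun x => ⟨g x, hg x⟩) hp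
  have hf : Continuous (fun x => q (g x)) := by
    rw [quo.continuous_iff]
    have : (fun x => q (g x)) ∘ p = q := by
      funext a
      exact (hk _ _).mp (hg (p a))
    rw [this]; exact hq
  have hb : Function.Bijective (fun x => q (g x)) := by
    constructor
    · intro a b hab
      have := (hk _ _).mpr hab
      rwa [hg, hg] at this
    · intro y
      obtain ⟨a, rfl⟩ := sq y
      exact ⟨p a, (hk _ _).mp (hg (p a))⟩
  exact ⟨Continuous.homeoOfEquivCompactToT2 (f := Equiv.ofBijective _ hb) hf⟩

theorem LL_circle {A B C : ℤ} {T : Set (Fin 3 → ℝ)} (S : Std A B C T) {W : ℕ} (h1 : 1 ≤ W) (h2 : W < 15) :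
    Nonempty (LL T (fz A B W) ≃ₜ AddCircle (fN W : ℝ)) := by
  have P := S.par
  have hN := (fN_cases W h2 h1).1
  have : CompactSpace (KK A B C W) := isCompact_iff_compactSpace.mp (KK_compact P W)
  have hA : ∀ Γ : KK A B C W, A3 A B C Γ.1 := fun Γ => Γ.2.1
  choose ix hix hw using fun Γ : KK A B C W => Γ.2.2
  choose t ht using fun Γ : KK A B C W => TP_exists P (hA Γ)
  have hr : ∀ Γ : KK A B C W, ∃ x, TRep A B C (fun n => Γ.1 n / 3) x := fun Γ => by
    have := (hA Γ) 0
    simp only [add_zero] at this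
    exact this.rep S.hT
  choose x hx using hr
  have sj : ∀ Γ : KK A B C W, SJ Γ.1 0 := fun Γ => KK_sj h1 h2 (hix Γ) (hw Γ)
  have ixeq : ∀ Γ Γ' : KK A B C W, (∀ k < 4, Γ.1 k = Γ'.1 k) → ix Γ = ix Γ' := by
    intro Γ Γ' h
    refine poly_einj W h2 h1 _ (hix Γ) _ (hix Γ') ?_
    have e : ∀ j < 4, dg (eD W (ix Γ)) j = dg (eD W (ix Γ')) j := fun j hj => by
      rw [← hw Γ j hj, ← hw Γ' j hj, h j hj]
    have e0 := e 0 (by norm_num)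
    have e1 := e 1 (by norm_num)
    have e2 := e 2 (by norm_num)
    have e3 := e 3 (by norm_num)
    unfold dg at e0 e1 e2 e3
    norm_num at e0 e1 e2 e3
    omega
  let p : KK A B C W → LL T (fz A B W) := fun Γ => ⟨x Γ, KK_LL S h1 h2 Γ.2 (hx Γ)⟩
  let r : KK A B C W → ℝ := fun Γ => (ix Γ : ℝ) + uR (ori W (ix Γ)) (t Γ 0)
  let q : KK A B C W → AddCircle (fN W : ℝ) := fun Γ => ((r Γ : ℝ) : AddCircle (fN W : ℝ))
  have hp : Continuous p := by
    refine Continuous.subtype_mk ?_ _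
    rw [continuous_iff_continuousAt]
    intro Γ
    rw [Metric.continuousAt_iff']
    intro ε hε
    obtain ⟨n, hn⟩ := TRep.close S.hT ε hε
    filter_upwards [near Γ (n+1)] with Γ' h'
    exact hn _ _ _ _ (hx Γ') (hx Γ) (fun k hk => by rw [h' k (by omega)])
  have hrc : Continuous r := by
    rw [continuous_iff_continuousAt]
    intro Γ
    rw [Metric.continuousAt_iff']
    intro ε hε
    obtain ⟨n, hn⟩ := exists_pow_lt_of_lt_one hε (by norm_num : (1/4 : ℝ) < 1)
    filter_upwards [near Γ (4*n+4)] with Γ' h'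
    have c := TP_close P (hA Γ) (ht Γ) (ht Γ') (sj Γ) n 0 (fun j hj => by simpa using h' j hj)
    have e := ixeq Γ Γ' (fun k hk => h' k (by omega))
    have : dist (r Γ') (r Γ) = |t Γ 0 - t Γ' 0| := by
      simp only [r, ← e, Real.dist_eq, uR]
      split_ifs
      · rw [abs_sub_comm]; congr 1; ring
      · congr 1; ring
    rw [this]
    exact lt_of_le_of_lt c hn
  have hq : Continuous q := (AddCircle.continuous_mk' _).comp hrc
  have sp : Function.Surjective p := by
    rintro ⟨y, hy⟩
    obtain ⟨Γ, hΓ, hrep⟩ := LL_KK S h1 h2 hy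
    exact ⟨⟨Γ, hΓ⟩, Subtype.ext (TRep.unique S.hT (hx ⟨Γ, hΓ⟩) hrep)⟩
  have sq : Function.Surjective q := by
    intro z
    have hNp : Fact ((0:ℝ) < (fN W : ℝ)) := ⟨by exact_mod_cast (by omega : 0 < fN W)⟩
    obtain ⟨y, ⟨hy0, hy1⟩, rfl⟩ : z ∈ ((↑) : ℝ → AddCircle (fN W : ℝ)) '' Set.Ico 0 (0 + (fN W : ℝ)) := by
      rw [AddCircle.coe_image_Ico_eq]; trivial
    rw [zero_add] at hy1
    have f0 := Nat.floor_le hy0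
    have f1 := Nat.lt_floor_add_one y
    set i := ⌊y⌋₊ with hi
    have hiN : i < fN W := by
      have : (i : ℝ) < fN W := by linarith
      exact_mod_cast this
    obtain ⟨u0, u1⟩ := uR_mem (o := ori W i) (τ := y - i) (by linarith) (by linarith)
    obtain ⟨Γ, t', g0, g1, g2, g3, a3, tp, t0⟩ := TP_surj P (dg (eD W i) 0) (dg (eD W i) 1) (dg (eD W i) 2) (dg (eD W i) 3)
      (uR (ori W i) (y - i)) u0 u1
    have hww : ∀ j < 4, Γ j = dg (eD W i) j := by
      simpa using fin4 (g := fun j => dg (eD W i) j) g0 g1 g2 g3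
    let G : KK A B C W := ⟨Γ, a3, i, hiN, hww⟩
    refine ⟨G, ?_⟩
    have e : ix G = i := by
      refine poly_einj W h2 h1 _ (hix G) _ hiN ?_
      have e : ∀ j < 4, dg (eD W (ix G)) j = dg (eD W i) j := fun j hj => by
        rw [← hw G j hj, ← hww j hj]
      have e0 := e 0 (by norm_num)
      have e1 := e 1 (by norm_num)
      have e2 := e 2 (by norm_num)
      have e3 := e 3 (by norm_num)
      unfold dg at e0 e1 e2 e3
      norm_num at e0 e1 e2 e3
      omega
    have et : t G 0 = uR (ori W i) (y - i) := by
      rw [← t0]; exact TP_unique P a3 (ht G) tp (sj G) 0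
    simp only [q, r, e, et, uR_uR]
    congr 1; ring
  refine homeo_of_kernel hp hq sp sq fun Γ Γ' => ?_
  have b := ht Γ 0
  have b' := ht Γ' 0
  rw [show q Γ = q Γ' ↔ _ from glue_iff (hix Γ) (hix Γ') b.1 b.2.1 b'.1 b'.2.1]
  constructor
  · intro h
    have hxx : x Γ = x Γ' := congrArg Subtype.val h
    have h' := hx Γ'
    rw [← hxx] at h'
    exact ker_fwd S h1 h2 (hix Γ) (hix Γ') (hA Γ) (hA Γ') (hw Γ) (hw Γ') (ht Γ) (ht Γ') (hx Γ) h'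
  · intro h
    exact Subtype.ext (ker_rev S h1 h2 (hix Γ) (hix Γ') (hA Γ) (hA Γ') (hw Γ) (hw Γ') (ht Γ) (ht Γ') (hx Γ) (hx Γ') h)

theorem circle_sphere : Nonempty (Circle ≃ₜ Metric.sphere (0 : EuclideanSpace ℝ (Fin 2)) 1) := by
  let e : ℂ ≃ₗᵢ[ℝ] EuclideanSpace ℝ (Fin 2) := Complex.orthonormalBasisOneI.repr
  refine ⟨(e.toHomeomorph.subtype (p := fun z => z ∈ Submonoid.unitSphere ℂ) (q := fun z => z ∈ Metric.sphere (0 : EuclideanSpace ℝ (Fin 2)) 1) ?_)⟩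
  intro z
  have : ‖e z‖ = ‖z‖ := e.norm_map z
  rw [mem_sphere_zero_iff_norm]
  change z ∈ Metric.sphere (0:ℂ) 1 ↔ ‖e z‖ = 1
  rw [mem_sphere_zero_iff_norm, this]

theorem stmt18 (A B C : ℤ) (T : Set (Fin 3 → ℝ)) (hT : IsABCTile A B C T)
    (h14 : (Neighbors T).ncard = 14) (α : Fin 3 → ℤ) (hα : α ∈ Neighbors T) :
    Subtype.val '' (frontier ((Subtype.val ⁻¹' (T ∩ tileTranslate (toR α) T)) :
        Set (frontier T))) =
      (⋃ β ∈ {β : Fin 3 → ℤ | β ∉ ({0, α} : Set (Fin 3 → ℤ))},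
        T ∩ tileTranslate (toR α) T ∩ tileTranslate (toR β) T) ∧
    Nonempty ((frontier ((Subtype.val ⁻¹' (T ∩ tileTranslate (toR α) T)) :
        Set (frontier T)) : Set (frontier T)) ≃ₜ
      Metric.sphere (0 : EuclideanSpace ℝ (Fin 2)) 1) := by
  have S := std_of hT h14
  have key := frontier_eq_LL S hα.1
  refine ⟨key, ?_⟩
  obtain ⟨W, h1, h2, hW⟩ := face_of S hα
  have hN := (fN_cases W h2 h1).1
  obtain ⟨f⟩ := LL_circle S h1 h2
  obtain ⟨g⟩ := circle_sphere
  have c := AddCircle.homeomorphCircle (T := (fN W : ℝ)) (by exact_mod_cast (by omega : fN W ≠ 0))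
  have a := Topology.IsEmbedding.subtypeVal.homeomorphImage (frontier ((Subtype.val ⁻¹' (T ∩ tileTranslate (toR α) T)) :
        Set (frontier T)))
  have b : (Subtype.val '' (frontier ((Subtype.val ⁻¹' (T ∩ tileTranslate (toR α) T)) :
        Set (frontier T)))) ≃ₜ LL T (fz A B W) := Homeomorph.setCongr (by rw [key, hW])
  exact ⟨a.trans (b.trans (f.trans (c.trans g)))⟩
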